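/- arXiv:1406.0867 — 3 statements merged into one kernel-verified Lean document; each statement's English description precedes it below -/
import Mathlib

section
/- Let A be a complex affine Poisson algebra (a finitely generated integral domain ℂ-algebra with a Poisson bracket) and let P be a Poisson prime ideal of A. If P is Poisson rational, then P is Poisson primitive. -/
/-- A Poisson bracket on a commutative `k`-algebra `A`: a `k`-bilinear map which is
antisymmetric, satisfies the Jacobi identity, and the Leibniz rule. -/
structure PoissonBracket (k A : Type*) [CommRing k] [CommRing A] [Algebra k A] where
  br : A →ₗ[k] A →ₗ[k] A
  antisymm : ∀ a b : A, br a b = - br b a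
  jacobi : ∀ a b c : A, br a (br b c) + br c (br a b) + br b (br c a) = 0
  leibniz : ∀ a b c : A, br (a * b) c = a * br b c + b * br a c

/-- An ideal `I` is a Poisson ideal if `{I, A} ⊆ I`. -/
def PoissonBracket.IsPoissonIdeal {k A : Type*} [CommRing k] [CommRing A] [Algebra k A]
    (pb : PoissonBracket k A) (I : Ideal A) : Prop :=
  ∀ a ∈ I, ∀ b : A, pb.br a b ∈ I

/-- `P` is the Poisson core of `J`: the largest Poisson ideal contained in `J`. -/
def PoissonBracket.IsPoissonCore {k A : Type*} [CommRing k] [CommRing A] [Algebra k A]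
    (pb : PoissonBracket k A) (P J : Ideal A) : Prop :=
  pb.IsPoissonIdeal P ∧ P ≤ J ∧ ∀ I : Ideal A, pb.IsPoissonIdeal I → I ≤ J → I ≤ P

/-- `P` is Poisson primitive if it is the Poisson core of some maximal ideal. -/
def PoissonBracket.IsPoissonPrimitive {k A : Type*} [CommRing k] [CommRing A] [Algebra k A]
    (pb : PoissonBracket k A) (P : Ideal A) : Prop :=
  ∃ J : Ideal A, J.IsMaximal ∧ pb.IsPoissonCore P J

/-- `P` is Poisson rational: every element of the Poisson center of the fraction field of
`A ⧸ P` (with the unique extension of the Poisson bracket, captured by quantifying over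
all compatible Poisson brackets on `Frac(A ⧸ P)`) is algebraic over `k`. -/
def PoissonBracket.IsPoissonRational {k A : Type*} [Field k] [CommRing A] [Algebra k A]
    (pb : PoissonBracket k A) (P : Ideal A) : Prop :=
  ∀ pbF : PoissonBracket k (FractionRing (A ⧸ P)),
    (∀ a b : A,
      pbF.br (algebraMap (A ⧸ P) (FractionRing (A ⧸ P)) (Ideal.Quotient.mk P a))
          (algebraMap (A ⧸ P) (FractionRing (A ⧸ P)) (Ideal.Quotient.mk P b)) =
        algebraMap (A ⧸ P) (FractionRing (A ⧸ P)) (Ideal.Quotient.mk P (pb.br a b))) →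
    ∀ f : FractionRing (A ⧸ P), (∀ g, pbF.br f g = 0) → IsAlgebraic k f

open scoped TensorProduct in
theorem pr_der_exists {B K M : Type*} [CommRing B] [Field K] [Algebra ℂ B]
    [Algebra ℂ K] [Algebra B K] [IsScalarTower ℂ B K] [IsFractionRing B K]
    [AddCommGroup M] [Module K M] [Module B M] [Module ℂ M] [IsScalarTower B K M]
    [IsScalarTower ℂ K M] [IsScalarTower ℂ B M]
    (D : Derivation ℂ B M) : ∃ E : Derivation ℂ K M, ∀ b : B, E (algebraMap B K b) = D b := by
  have := Algebra.FormallyEtale.of_isLocalization (Rₘ := K) (nonZeroDivisors B)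
  refine ⟨((D.liftKaehlerDifferential.liftBaseChange K).comp
    (KaehlerDifferential.tensorKaehlerEquivOfFormallyEtale ℂ B K).symm.toLinearMap).compDer
      (KaehlerDifferential.D ℂ K), fun b => ?_⟩
  simp [KaehlerDifferential.tensorKaehlerEquivOfFormallyEtale_symm_D_algebraMap]

theorem pr_der_ext {B K M : Type*} [CommRing B] [Field K] [Algebra ℂ K] [Algebra B K]
    [IsDomain B] [IsFractionRing B K]
    [AddCommGroup M] [Module K M] [Module ℂ M]
    {D E : Derivation ℂ K M} (h : ∀ b : B, D (algebraMap B K b) = E (algebraMap B K b)) :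
    D = E := by
  ext x
  obtain ⟨a, b, hb, rfl⟩ := IsFractionRing.div_surjective (A := B) x
  rw [Derivation.leibniz_div, Derivation.leibniz_div, h, h]

theorem pr_frac_bracket {B K : Type*} [CommRing B] [IsDomain B] [Field K] [Algebra ℂ B]
    [Algebra ℂ K] [Algebra B K] [IsScalarTower ℂ B K] [IsFractionRing B K]
    (pb : PoissonBracket ℂ B) : ∃ pbF : PoissonBracket ℂ K, ∀ a b : B,
      pbF.br (algebraMap B K a) (algebraMap B K b) = algebraMap B K (pb.br a b) := by
  have h1 : ∀ b : B, ∃ E : Derivation ℂ K K, ∀ c : B,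
      E (algebraMap B K c) = algebraMap B K (pb.br b c) := by
    intro b
    let D : Derivation ℂ B K := Derivation.mk'
      ((IsScalarTower.toAlgHom ℂ B K).toLinearMap.comp (pb.br b)) (by
        intro x y
        have : pb.br b (x * y) = x * pb.br b y + y * pb.br b x := by
          rw [pb.antisymm, pb.leibniz, pb.antisymm y, pb.antisymm x]; ring
        simp [this, Algebra.smul_def])
    obtain ⟨E, hE⟩ := pr_der_exists (K := K) D
    exact ⟨E, fun c => by rw [hE]; rfl⟩
  choose E hE using h1
  let DD : Derivation ℂ B (Derivation ℂ K K) := Derivation.mk'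
    { toFun := E
      map_add' := fun x y => pr_der_ext (B := B) fun c => by simp [hE]
      map_smul' := fun r x => pr_der_ext (B := B) fun c => by
        rw [hE, map_smul, LinearMap.smul_apply, Algebra.smul_def, map_mul,
          ← IsScalarTower.algebraMap_apply ℂ B K, ← hE, ← Algebra.smul_def]
        rfl } (by
      intro x y
      refine pr_der_ext (B := B) fun c => ?_
      simp [hE, pb.leibniz, Algebra.smul_def])
  obtain ⟨F, hF⟩ := pr_der_exists (K := K) DD
  have hFE : ∀ a b : B, F (algebraMap B K a) (algebraMap B K b) = algebraMap B K (pb.br a b) := by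
    intro a b
    rw [hF]; exact hE a b
  have leib : ∀ a b c, F (a * b) c = a * F b c + b * F a c := by
    intro a b c
    simp
  have hanti : ∀ a b : K, F a b = - F b a := by
    -- flipped derivation
    let G : K → Derivation ℂ K K := fun a => Derivation.mk'
      { toFun := fun b => - F b a
        map_add' := fun x y => by simp; ring
        map_smul' := fun r x => by simp } (by
        intro x y; simp; ring)
    have hG : ∀ a b, G a b = - F b a := fun a b => rfl
    have key1 : ∀ a : B, F (algebraMap B K a) = G (algebraMap B K a) := by
      intro a
      refine pr_der_ext (B := B) fun c => ?_
      rw [hG, hFE, hFE, pb.antisymm]; simp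
    have key2 : ∀ a : K, F a = G a := by
      intro a
      refine pr_der_ext (B := B) fun c => ?_
      rw [hG, key1, hG, neg_neg]
    intro a b
    rw [key2, hG]
  have hjac : ∀ a b c : K, F a (F b c) + F c (F a b) + F b (F c a) = 0 := by
    have J : ∀ a b : K, (∀ c : B, F a (F b (algebraMap B K c)) + F (algebraMap B K c) (F a b)
        + F b (F (algebraMap B K c) a) = 0) →
        ∀ c : K, F a (F b c) + F c (F a b) + F b (F c a) = 0 := by
      intro a b h
      have h2 : ⁅F a, F b⁆ = F (F a b) := by
        refine pr_der_ext (B := B) fun c => ?_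
        have := h c
        rw [hanti (algebraMap B K c) (F a b), hanti (algebraMap B K c) a, map_neg] at this
        rw [Derivation.commutator_apply]
        linear_combination this
      intro c
      have h3 := Derivation.congr_fun h2 c
      rw [Derivation.commutator_apply] at h3
      rw [hanti c (F a b), hanti c a, map_neg]
      linear_combination h3
    have s1 : ∀ (a b : B) (c : K), F (algebraMap B K a) (F (algebraMap B K b) c)
        + F c (F (algebraMap B K a) (algebraMap B K b))
        + F (algebraMap B K b) (F c (algebraMap B K a)) = 0 := by
      intro a b
      refine J _ _ fun c => ?_
      simp only [hFE, ← map_add, pb.jacobi, map_zero]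
    have s2 : ∀ (b : B) (c d : K), F (algebraMap B K b) (F c d)
        + F d (F (algebraMap B K b) c) + F c (F d (algebraMap B K b)) = 0 := by
      intro b c
      refine J _ _ fun a => ?_
      linear_combination s1 a b c
    intro a b
    refine J _ _ fun c => ?_
    linear_combination s2 c a b
  refine ⟨⟨LinearMap.mk₂ ℂ (fun a b => F a b) ?_ ?_ ?_ ?_, hanti, hjac, leib⟩, hFE⟩ <;>
    intros <;> simp

theorem pr_quot_bracket {A : Type*} [CommRing A] [Algebra ℂ A] (pb : PoissonBracket ℂ A)
    (P : Ideal A) (hPoisson : pb.IsPoissonIdeal P) :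
    ∃ pbB : PoissonBracket ℂ (A ⧸ P), ∀ a b : A,
      pbB.br (Ideal.Quotient.mk P a) (Ideal.Quotient.mk P b) =
        Ideal.Quotient.mk P (pb.br a b) := by
  have hs := Ideal.Quotient.mk_surjective (I := P)
  let q : A ⧸ P → A ⧸ P → A ⧸ P := fun x y =>
    Ideal.Quotient.mk P (pb.br (Function.surjInv hs x) (Function.surjInv hs y))
  have hq : ∀ a b : A, q (Ideal.Quotient.mk P a) (Ideal.Quotient.mk P b) =
      Ideal.Quotient.mk P (pb.br a b) := by
    intro a b
    set a' := Function.surjInv hs (Ideal.Quotient.mk P a) with ha'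
    set b' := Function.surjInv hs (Ideal.Quotient.mk P b) with hb'
    have ha : a' - a ∈ P := by
      rw [← Ideal.Quotient.mk_eq_mk_iff_sub_mem]; exact Function.surjInv_eq hs _
    have hb : b' - b ∈ P := by
      rw [← Ideal.Quotient.mk_eq_mk_iff_sub_mem]; exact Function.surjInv_eq hs _
    change Ideal.Quotient.mk P (pb.br a' b') = _
    rw [Ideal.Quotient.mk_eq_mk_iff_sub_mem]
    have e : pb.br a' b' - pb.br a b = pb.br (a' - a) b' - pb.br (b' - b) a := by
      rw [pb.antisymm (b' - b) a]; simp
    rw [e]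
    exact P.sub_mem (hPoisson _ ha _) (hPoisson _ hb _)
  have hsm : ∀ (r : ℂ) (a : A), r • Ideal.Quotient.mk P a = Ideal.Quotient.mk P (r • a) :=
    fun r a => rfl
  refine ⟨⟨LinearMap.mk₂ ℂ q ?_ ?_ ?_ ?_, ?_, ?_, ?_⟩, hq⟩
  · intro x y z
    obtain ⟨x, rfl⟩ := hs x; obtain ⟨y, rfl⟩ := hs y; obtain ⟨z, rfl⟩ := hs z
    simp only [← map_add, hq]
    rw [map_add, LinearMap.add_apply]
  · intro c x y
    obtain ⟨x, rfl⟩ := hs x; obtain ⟨y, rfl⟩ := hs y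
    simp only [hsm, hq, map_smul, LinearMap.smul_apply]
  · intro x y z
    obtain ⟨x, rfl⟩ := hs x; obtain ⟨y, rfl⟩ := hs y; obtain ⟨z, rfl⟩ := hs z
    simp only [← map_add, hq]
  · intro c x y
    obtain ⟨x, rfl⟩ := hs x; obtain ⟨y, rfl⟩ := hs y
    simp only [hsm, hq, map_smul]
  · intro x y
    obtain ⟨x, rfl⟩ := hs x; obtain ⟨y, rfl⟩ := hs y
    simp only [LinearMap.mk₂_apply, hq]
    rw [pb.antisymm, map_neg]
  · intro x y z
    obtain ⟨x, rfl⟩ := hs x; obtain ⟨y, rfl⟩ := hs y; obtain ⟨z, rfl⟩ := hs z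
    simp only [LinearMap.mk₂_apply, hq, ← map_add, pb.jacobi, map_zero]
  · intro x y z
    obtain ⟨x, rfl⟩ := hs x; obtain ⟨y, rfl⟩ := hs y; obtain ⟨z, rfl⟩ := hs z
    simp only [LinearMap.mk₂_apply, hq, ← map_add, ← map_mul, pb.leibniz]

/-- Countable closed generating set. -/
theorem pr_countable {B : Type*} [CommRing B] [Algebra ℂ B] (hfg : Algebra.FiniteType ℂ B)
    (pb : PoissonBracket ℂ B) : ∃ S : Set B, S.Countable ∧ (1 : B) ∈ S ∧
      (∀ a ∈ S, ∀ b ∈ S, a - b ∈ S) ∧ (∀ a ∈ S, ∀ b ∈ S, a * b ∈ S) ∧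
      (∀ a ∈ S, ∀ b ∈ S, pb.br a b ∈ S) ∧ Submodule.span ℂ S = ⊤ := by
  obtain ⟨s, hs⟩ := hfg.out
  let Φ : Set B → Set B := fun T => T ∪ Set.image2 (· - ·) T T ∪ Set.image2 (· * ·) T T
    ∪ Set.image2 (fun a b => pb.br a b) T T
  let T : ℕ → Set B := fun n => Nat.rec (insert 1 (s : Set B)) (fun _ U => Φ U) n
  have hT0 : T 0 = insert 1 (s : Set B) := rfl
  have hT1 : ∀ n, T (n + 1) = Φ (T n) := fun n => rfl
  have hc : ∀ n, (T n).Countable := by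
    intro n
    induction n with
    | zero => exact (s.countable_toSet).insert 1
    | succ n ih =>
      exact ((ih.union (ih.image2 ih _)).union (ih.image2 ih _)).union (ih.image2 ih _)
  have hm : Monotone T := monotone_nat_of_le_succ fun n x hx =>
    Or.inl (Or.inl (Or.inl hx))
  have h2 : ∀ a ∈ ⋃ n, T n, ∀ b ∈ ⋃ n, T n, ∃ n, a ∈ T n ∧ b ∈ T n := by
    intro a ha b hb
    obtain ⟨i, hi⟩ := Set.mem_iUnion.1 ha
    obtain ⟨j, hj⟩ := Set.mem_iUnion.1 hb
    exact ⟨max i j, hm (le_max_left i j) hi, hm (le_max_right i j) hj⟩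
  have h1 : (1 : B) ∈ ⋃ n, T n := Set.mem_iUnion.2 ⟨0, Set.mem_insert _ _⟩
  have hmul : ∀ a ∈ ⋃ n, T n, ∀ b ∈ ⋃ n, T n, a * b ∈ ⋃ n, T n := by
    intro a ha b hb
    obtain ⟨n, h, h'⟩ := h2 a ha b hb
    exact Set.mem_iUnion.2 ⟨n + 1, Or.inl (Or.inr ⟨a, h, b, h', rfl⟩)⟩
  refine ⟨⋃ n, T n, Set.countable_iUnion hc, h1, ?_, hmul, ?_, ?_⟩
  · intro a ha b hb
    obtain ⟨n, h, h'⟩ := h2 a ha b hb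
    exact Set.mem_iUnion.2 ⟨n + 1, Or.inl (Or.inl (Or.inr ⟨a, h, b, h', rfl⟩))⟩
  · intro a ha b hb
    obtain ⟨n, h, h'⟩ := h2 a ha b hb
    exact Set.mem_iUnion.2 ⟨n + 1, Or.inr ⟨a, h, b, h', rfl⟩⟩
  · let N : Submonoid B := ⟨⟨⋃ n, T n, fun {a b} ha hb => hmul a ha b hb⟩, h1⟩
    have hle : Submonoid.closure (s : Set B) ≤ N := Submonoid.closure_le.2 fun x hx =>
      Set.mem_iUnion.2 ⟨0, Set.mem_insert_of_mem _ hx⟩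
    rw [eq_top_iff, ← Algebra.top_toSubmodule, ← hs, Algebra.adjoin_eq_span]
    exact Submodule.span_mono hle

theorem pr_alg_range {K : Type*} [Field K] [Algebra ℂ K] {x : K} (hx : IsAlgebraic ℂ x) :
    ∃ c : ℂ, algebraMap ℂ K c = x := by
  have := minpoly.mem_range_of_degree_eq_one ℂ x
    (IsAlgClosed.degree_eq_one_of_irreducible ℂ (minpoly.irreducible hx.isIntegral))
  simpa using this

theorem pr_field_countable {K : Type*} [Field K] [Algebra ℂ K] (S : Set K) (hS : S.Countable)
    (hspan : Submodule.span ℂ S = ⊤) (x : K) : ∃ c : ℂ, algebraMap ℂ K c = x := by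
  apply pr_alg_range
  by_contra hx
  have h2 := (show Transcendental ℂ x from hx).linearIndependent_sub_inv.cardinal_lift_le_rank
  have h3 : Module.rank ℂ K ≤ Cardinal.aleph0 := by
    rw [← rank_top, ← hspan]
    exact (rank_span_le S).trans hS.le_aleph0
  have h4 := h2.trans (Cardinal.lift_le.2 h3)
  rw [Cardinal.mk_complex] at h4
  simp at h4
  exact absurd h4 (not_le.2 Cardinal.aleph0_lt_continuum)

theorem pr_max {B : Type*} [CommRing B] [IsDomain B] [Algebra ℂ B]
    (S : Set B) (hS : S.Countable) (h1 : (1 : B) ∈ S) (hmul : ∀ a ∈ S, ∀ b ∈ S, a * b ∈ S)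
    (hspan : Submodule.span ℂ S = ⊤) :
    ∃ m : Ideal B, m.IsMaximal ∧ ∀ a ∈ S, a ∈ m → a = 0 := by
  let N : Submonoid B := ⟨⟨{a | a ∈ S ∧ a ≠ 0},
    fun {a b} ha hb => ⟨hmul a ha.1 b hb.1, mul_ne_zero ha.2 hb.2⟩⟩, ⟨h1, one_ne_zero⟩⟩
  have hN0 : (0 : B) ∉ N := fun h => h.2 rfl
  have hNle : N ≤ nonZeroDivisors B := le_nonZeroDivisors_of_noZeroDivisors hN0
  have : Nontrivial (Localization N) :=
    (IsLocalization.injective (Localization N) hNle).nontrivial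
  obtain ⟨M, hM⟩ := Ideal.exists_maximal (Localization N)
  let _ : Field (Localization N ⧸ M) := Ideal.Quotient.field M
  let φ : B →ₐ[ℂ] Localization N ⧸ M :=
    (Ideal.Quotient.mkₐ ℂ M).comp (IsScalarTower.toAlgHom ℂ B (Localization N))
  have hunit : ∀ a ∈ N, φ a ≠ 0 := by
    intro a ha
    exact ((IsLocalization.map_units (Localization N) (⟨a, ha⟩ : N)).map
      (Ideal.Quotient.mk M)).ne_zero
  let U : Set (Localization N ⧸ M) := Set.image2 (fun a b => φ a * (φ b)⁻¹) S S
  have hU : Submodule.span ℂ U = ⊤ := by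
    rw [eq_top_iff]
    rintro y -
    obtain ⟨z, rfl⟩ := Ideal.Quotient.mk_surjective y
    obtain ⟨a, b, rfl⟩ := IsLocalization.exists_mk'_eq N z
    have e : Ideal.Quotient.mk M (IsLocalization.mk' (Localization N) a b) =
        φ a * (φ b)⁻¹ := by
      rw [eq_mul_inv_iff_mul_eq₀ (hunit b b.2)]
      change _ * Ideal.Quotient.mk M (algebraMap _ _ (b : B)) =
        Ideal.Quotient.mk M (algebraMap _ _ a)
      rw [← map_mul, IsLocalization.mk'_spec]
    rw [e]
    have ha : a ∈ Submodule.span ℂ S := hspan ▸ Submodule.mem_top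
    clear e
    induction ha using Submodule.span_induction with
    | mem x hx => exact Submodule.subset_span ⟨x, hx, b, b.2.1, rfl⟩
    | zero => simp
    | add x y _ _ h1 h2 =>
      rw [map_add, add_mul]
      exact Submodule.add_mem _ h1 h2

    | smul r x _ h =>
      rw [map_smul, smul_mul_assoc]
      exact Submodule.smul_mem _ _ h
  have hsurj : Function.Surjective φ := fun y => by
    obtain ⟨c, hc⟩ := pr_field_countable U (hS.image2 hS _) hU y
    exact ⟨algebraMap ℂ B c, by rw [AlgHom.commutes, hc]⟩
  have hmax : (RingHom.ker φ.toRingHom).IsMaximal :=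
    RingHom.ker_isMaximal_of_surjective φ.toRingHom hsurj
  refine ⟨RingHom.ker φ.toRingHom, hmax, ?_⟩
  intro a ha ham
  by_contra h0
  exact hunit a ⟨ha, h0⟩ ham

theorem pr_domain {B K : Type*} [CommRing B] [IsDomain B] [Field K] [Algebra ℂ B]
    [Algebra ℂ K] [Algebra B K] [IsScalarTower ℂ B K] [IsFractionRing B K]
    (hfg : Algebra.FiniteType ℂ B)
    (pb : PoissonBracket ℂ B) (pbF : PoissonBracket ℂ K) (hc : ∀ a b : B,
      pbF.br (algebraMap B K a) (algebraMap B K b) = algebraMap B K (pb.br a b))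
    (hrat : ∀ f : K, (∀ g, pbF.br f g = 0) → IsAlgebraic ℂ f) :
    ∃ m : Ideal B, m.IsMaximal ∧ ∀ I : Ideal B, pb.IsPoissonIdeal I → I ≤ m → I = ⊥ := by
  obtain ⟨S, hS, h1, hsub, hmul, hbr, hspan⟩ := pr_countable hfg pb
  obtain ⟨m, hm, hmS⟩ := pr_max S hS h1 hmul hspan
  refine ⟨m, hm, fun I hI hIm => ?_⟩
  by_contra hne
  obtain ⟨f, hfI, hf0⟩ := Submodule.exists_mem_ne_zero_of_ne_bot hne
  have hinj : Function.Injective (algebraMap B K) := IsFractionRing.injective B K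
  -- a derivation of the fraction field killing `S` vanishes
  have hcent : ∀ (F : K), (∀ x ∈ S, pbF.br F (algebraMap B K x) = 0) → ∀ g, pbF.br F g = 0 := by
    intro F hF
    let D : Derivation ℂ K K := Derivation.mk' (pbF.br F) (by
      intro x y
      rw [pbF.antisymm, pbF.leibniz, pbF.antisymm y, pbF.antisymm x]; simp; ring)
    have hD : D = 0 := by
      refine pr_der_ext (B := B) fun b => ?_
      have hb : b ∈ Submodule.span ℂ S := hspan ▸ Submodule.mem_top
      have : Submodule.span ℂ S ≤ LinearMap.ker
          ((pbF.br F).comp (IsScalarTower.toAlgHom ℂ B K).toLinearMap) :=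
        Submodule.span_le.2 fun x hx => hF x hx
      exact this hb
    intro g
    exact Derivation.congr_fun hD g
  have key : ∀ (n : ℕ) (c : Fin n → ℂ) (a : Fin n → S), (∑ i, c i • (a i : B)) ∈ I →
      (∑ i, c i • (a i : B)) ≠ 0 → False := by
    intro n
    induction n with
    | zero => intro c a _ h; simp at h
    | succ n ih =>
      intro c a hI1 h0
      set f := ∑ i, c i • (a i : B) with hf
      by_cases ha : (a 0 : B) = 0
      · rw [Fin.sum_univ_succ, ha, smul_zero, zero_add] at hf
        exact ih (fun i => c i.succ) (fun i => a i.succ) (hf ▸ hI1) (hf ▸ h0)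
      have hg : ∀ x ∈ S, (a 0 : B) * pb.br f x - f * pb.br (a 0) x = 0 := by
        intro x hx
        have e : (a 0 : B) * pb.br f x - f * pb.br (a 0) x =
            ∑ i : Fin n, c i.succ • ((a 0 : B) * pb.br (a i.succ) x
              - (a i.succ : B) * pb.br (a 0) x) := by
          rw [hf, Fin.sum_univ_succ]
          simp only [map_add, map_sum, map_smul, LinearMap.add_apply, LinearMap.sum_apply,
            LinearMap.smul_apply, smul_sub, Finset.sum_sub_distrib, mul_add, add_mul,
            Finset.mul_sum, Finset.sum_mul, mul_smul_comm, smul_mul_assoc]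
          ring
        by_contra h
        refine ih (fun i => c i.succ) (fun i => ⟨(a 0 : B) * pb.br (a i.succ) x
              - (a i.succ : B) * pb.br (a 0) x, hsub _ (hmul _ (a 0).2 _ (hbr _ (a _).2 _ hx)) _
                (hmul _ (a _).2 _ (hbr _ (a 0).2 _ hx))⟩) ?_ ?_
        · rw [← e]
          exact I.sub_mem (I.mul_mem_left _ (hI _ hI1 _)) (I.mul_mem_right _ hI1)
        · rw [← e]; exact h
      have ha' : algebraMap B K (a 0) ≠ 0 := by
        rwa [Ne, map_eq_zero_iff _ hinj]
      have hF : ∀ x ∈ S, pbF.br (algebraMap B K f / algebraMap B K (a 0)) (algebraMap B K x)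
          = 0 := by
        intro x hx
        have e1 := pbF.leibniz (algebraMap B K f / algebraMap B K (a 0)) (algebraMap B K (a 0))
          (algebraMap B K x)
        rw [div_mul_cancel₀ _ ha', hc, hc] at e1
        have e2 := congrArg (algebraMap B K) (hg x hx)
        rw [map_sub, map_mul, map_mul, map_zero] at e2
        have e3 : algebraMap B K (a 0) * (algebraMap B K (a 0) *
          pbF.br (algebraMap B K f / algebraMap B K (a 0)) (algebraMap B K x)) = 0 := by
          rw [e1] at e2
          field_simp at e2
          linear_combination e2
        simpa [ha'] using e3
      obtain ⟨l, hl⟩ := pr_alg_range (hrat _ (hcent _ hF))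
      rw [eq_div_iff ha', IsScalarTower.algebraMap_apply ℂ B K, ← map_mul] at hl
      have hl2 := hinj hl
      have hl0 : l ≠ 0 := by
        rintro rfl
        rw [map_zero, zero_mul] at hl2
        exact h0 hl2.symm
      refine ha (hmS _ (a 0).2 (hIm ?_))
      have : (a 0 : B) = algebraMap ℂ B l⁻¹ * f := by
        rw [← hl2, ← mul_assoc, ← map_mul, inv_mul_cancel₀ hl0, map_one, one_mul]
      rw [this]
      exact I.mul_mem_left _ hI1
  have hfs : f ∈ Submodule.span ℂ S := hspan ▸ Submodule.mem_top
  obtain ⟨n, c, a, rfl⟩ := Submodule.mem_span_set'.1 hfs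
  exact key n c a hfI hf0

/-- Let `A` be a complex affine Poisson algebra and `P` a Poisson prime
ideal of `A`.  If `P` is Poisson rational then `P` is Poisson primitive. -/
theorem poissonRational_implies_poissonPrimitive
    (A : Type*) [CommRing A] [IsDomain A] [Algebra ℂ A]
    (hfg : Algebra.FiniteType ℂ A) (pb : PoissonBracket ℂ A)
    (P : Ideal A) (hP : P.IsPrime) (hPoisson : pb.IsPoissonIdeal P)
    (hrat : pb.IsPoissonRational P) :
    pb.IsPoissonPrimitive P := by
  obtain ⟨pbB, hB⟩ := pr_quot_bracket pb P hPoisson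
  obtain ⟨pbF, hF⟩ := pr_frac_bracket (K := FractionRing (A ⧸ P)) pbB
  have hr := hrat pbF (fun a b => by rw [hF, hB])
  have hfgB : Algebra.FiniteType ℂ (A ⧸ P) :=
    hfg.of_surjective (Ideal.Quotient.mkₐ ℂ P) (Ideal.Quotient.mkₐ_surjective ℂ P)
  obtain ⟨m, hm, hmI⟩ := pr_domain hfgB pbB pbF hF hr
  have hs := Ideal.Quotient.mk_surjective (I := P)
  refine ⟨m.comap (Ideal.Quotient.mk P), Ideal.comap_isMaximal_of_surjective _ hs,
    hPoisson, ?_, ?_⟩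
  · intro x hx
    rw [Ideal.mem_comap, Ideal.Quotient.eq_zero_iff_mem.2 hx]
    exact m.zero_mem
  · intro I hI hIm
    have h := hmI (I.map (Ideal.Quotient.mk P)) ?_ (Ideal.map_le_iff_le_comap.2 hIm)
    · intro x hx
      have := Ideal.mem_map_of_mem (Ideal.Quotient.mk P) hx
      rw [h] at this
      exact Ideal.Quotient.eq_zero_iff_mem.1 this
    · intro y hy z
      obtain ⟨x, hx, rfl⟩ := (Ideal.mem_map_iff_of_surjective _ hs).1 hy
      obtain ⟨z, rfl⟩ := hs z
      rw [hB]
      exact Ideal.mem_map_of_mem _ (hI x hx z)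
end

section
/- For every integer d ≥ 3 there exists a complex affine algebra R (a finitely generated integral domain ℂ-algebra) of Krull dimension d, equipped with a ℂ-linear derivation δ, such that: (i) the field of constants of (Frac(R), δ) is exactly ℂ, i.e., every f ∈ Frac(R) with δ(f) = 0 lies in ℂ (where δ is extended uniquely to Frac(R)); and (ii) the intersection of all nonzero prime differential ideals of R is the zero ideal. -/
/-- A complex affine algebra `R` of Krull dimension `d` with a `ℂ`-linear derivation `δ`
such that (i) the field of constants of `(Frac R, δ)` is exactly `ℂ` (expressed via
representations `a / b` of elements of `Frac R`: if `δ(a/b) = 0`, i.e. `δ a * b = a * δ b`,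
then `a / b` lies in `ℂ`, i.e. `a = c • b` for some `c : ℂ`), and (ii) the intersection of
all nonzero prime differential ideals of `R` is zero. -/
structure DifferentialExample (d : ℕ) where
  R : Type
  [commRing : CommRing R]
  [isDomain : IsDomain R]
  [alg : Algebra ℂ R]
  finiteType : Algebra.FiniteType ℂ R
  krullDim : ringKrullDim R = d
  δ : Derivation ℂ R R
  constants_eq :
    ∀ a b : R, b ≠ 0 → δ a * b = a * δ b → ∃ c : ℂ, a = algebraMap ℂ R c * b
  inf_prime_diff_ideals :
    sInf {P : Ideal R | P ≠ ⊥ ∧ P.IsPrime ∧ ∀ x ∈ P, δ x ∈ P} = ⊥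

open Polynomial
set_option linter.unusedSectionVars false

/-- Coefficientwise derivation. -/
noncomputable def coeffD {S : Type} [CommRing S] [Algebra ℂ S] (δ : Derivation ℂ S S) :
    Derivation ℂ S[X] S[X] :=
  letI : Differential S := ⟨δ.restrictScalars ℤ⟩
  Derivation.mk'
    { toFun := fun p => Differential.mapCoeffs p
      map_add' := fun p q => map_add _ p q
      map_smul' := fun c p => by
        ext i
        simp only [RingHom.id_apply, coeff_smul]
        rw [Differential.coeff_mapCoeffs, Differential.coeff_mapCoeffs, coeff_smul]
        exact δ.map_smul c _ }
    (fun p q => by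
      change Differential.mapCoeffs (p * q) = _
      rw [Derivation.leibniz]; rfl)

lemma coeffD_coeff {S : Type} [CommRing S] [Algebra ℂ S] (δ : Derivation ℂ S S) (p : S[X])
    (i : ℕ) : (coeffD δ p).coeff i = δ (p.coeff i) := rfl

lemma coeffD_C {S : Type} [CommRing S] [Algebra ℂ S] (δ : Derivation ℂ S S) (a : S) :
    coeffD δ (C a) = C (δ a) := by
  ext i
  rw [coeffD_coeff, coeff_C, coeff_C]; split_ifs <;> simp

lemma coeffD_X {S : Type} [CommRing S] [Algebra ℂ S] (δ : Derivation ℂ S S) :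
    coeffD δ (X : S[X]) = 0 := by
  ext i
  rw [coeffD_coeff, coeff_X]; split_ifs <;> simp

/-- The polynomial derivative as a `ℂ`-derivation. -/
noncomputable def derX (S : Type) [CommRing S] [Algebra ℂ S] : Derivation ℂ S[X] S[X] :=
  (derivative' (R := S)).restrictScalars ℂ

lemma derX_apply (S : Type) [CommRing S] [Algebra ℂ S] (p : S[X]) :
    derX S p = derivative p := rfl

/-- lifting a derivation along formally etale maps -/
lemma exists_lift {S T : Type} [CommRing S] [CommRing T] [Algebra ℂ S] [Algebra ℂ T] [Algebra S T]
    [IsScalarTower ℂ S T] [Algebra.FormallyEtale S T] (d : Derivation ℂ S S) :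
    ∃ d' : Derivation ℂ T T, ∀ s, d' (algebraMap S T s) = algebraMap S T (d s) := by
  let l : Ω[S⁄ℂ] →ₗ[S] T := (Algebra.linearMap S T).comp d.liftKaehlerDifferential
  let L : Ω[T⁄ℂ] →ₗ[T] T := (l.liftBaseChange T).comp
    (KaehlerDifferential.tensorKaehlerEquivOfFormallyEtale ℂ S T).symm.toLinearMap
  refine ⟨L.compDer (KaehlerDifferential.D ℂ T), fun s => ?_⟩
  have := KaehlerDifferential.tensorKaehlerEquivOfFormallyEtale_symm_D_algebraMap ℂ S T s
  simp [L, this, l]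

abbrev LL := AlgebraicClosure (FractionRing ℂ[X])

noncomputable instance : Algebra.FormallyEtale ℂ[X] LL := by
  have : Algebra.FormallyEtale ℂ[X] (FractionRing ℂ[X]) :=
    Algebra.FormallyEtale.of_isLocalization (nonZeroDivisors ℂ[X])
  have : Algebra.FormallyEtale (FractionRing ℂ[X]) LL := Algebra.FormallyEtale.of_isSeparable _ _
  exact Algebra.FormallyEtale.comp _ (FractionRing ℂ[X]) _

noncomputable def dBase : Derivation ℂ ℂ[X] ℂ[X] := (2 * X * (1 - X) : ℂ[X]) • derX ℂ

lemma exists_dL : ∃ d : Derivation ℂ LL LL, ∀ s, d (algebraMap ℂ[X] LL s) = algebraMap ℂ[X] LL (dBase s) :=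
  exists_lift dBase

lemma LL_inj : Function.Injective (algebraMap ℂ[X] LL) := by
  rw [IsScalarTower.algebraMap_eq ℂ[X] (FractionRing ℂ[X]) LL]
  exact (algebraMap (FractionRing ℂ[X]) LL).injective.comp (IsFractionRing.injective _ _)


lemma lead_trick {T : Type} [CommRing T] [IsDomain T] [Algebra ℂ T]
    (D : Derivation ℂ T[X] T[X]) (K : Set T) (h0 : (0 : T) ∈ K)
    (hC : ∀ c ∈ K, D (C c) = 0)
    (h : ∀ A B : T[X], A ≠ 0 → B ≠ 0 → D A * B = A * D B →
      A.natDegree = B.natDegree ∧ ∃ c ∈ K, A.leadingCoeff = c * B.leadingCoeff) :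
    ∀ A B : T[X], B ≠ 0 → D A * B = A * D B → ∃ c ∈ K, A = C c * B := by
  intro A B hB hAB
  by_cases hA : A = 0
  · exact ⟨0, h0, by simp [hA]⟩
  obtain ⟨hdeg, c, hc, hl⟩ := h A B hA hB hAB
  refine ⟨c, hc, ?_⟩
  by_contra hne
  have hE : A - C c * B ≠ 0 := sub_ne_zero.mpr hne
  have hrel : D (A - C c * B) * B = (A - C c * B) * D B := by
    rw [map_sub, Derivation.leibniz, hC c hc]
    simp only [smul_eq_mul]
    linear_combination hAB
  obtain ⟨hdeg2, -⟩ := h _ B hE hB hrel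
  have hc0 : c ≠ 0 := by
    rintro rfl
    rw [zero_mul, leadingCoeff_eq_zero] at hl
    exact hA hl
  have hdB : (C c * B).degree = B.degree := degree_C_mul hc0
  have hdAB : A.degree = B.degree := by
    rw [degree_eq_natDegree hA, degree_eq_natDegree hB, hdeg]
  have hlt : (A - C c * B).degree < A.degree := by
    apply degree_sub_lt_left
    · rw [hdB, hdAB]
    · exact hA
    · rw [hl, leadingCoeff_mul, leadingCoeff_C]
  rw [hdAB, degree_eq_natDegree hE, degree_eq_natDegree hB, hdeg2] at hlt
  exact lt_irrefl _ hlt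

/-- The derivation on `S[z]` extending `δ` sending z to a z. -/
noncomputable def zD {S : Type} [CommRing S] [Algebra ℂ S] (δ : Derivation ℂ S S) (a : S) :
    Derivation ℂ S[X] S[X] := coeffD δ + (C a * X : S[X]) • derX S

lemma zD_coeff {S : Type} [CommRing S] [Algebra ℂ S] (δ : Derivation ℂ S S) (a : S) (p : S[X])
    (i : ℕ) : (zD δ a p).coeff i = δ (p.coeff i) + a * (i * p.coeff i) := by
  simp only [zD, Derivation.add_apply, Derivation.smul_apply, coeff_add, coeffD_coeff, derX_apply,
    smul_eq_mul, mul_assoc, coeff_C_mul]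
  congr 2
  cases i with
  | zero => simp
  | succ n => rw [coeff_X_mul, coeff_derivative]; push_cast; ring

lemma zD_natDegree_le {S : Type} [CommRing S] [Algebra ℂ S] (δ : Derivation ℂ S S) (a : S)
    (p : S[X]) : (zD δ a p).natDegree ≤ p.natDegree := by
  rw [natDegree_le_iff_coeff_eq_zero]
  intro i hi
  rw [zD_coeff, coeff_eq_zero_of_natDegree_lt hi]; simp

/-- the marker property -/
def Mark {S : Type} [CommRing S] [Algebra ℂ S] (δ : Derivation ℂ S S) (a : S) : Prop :=
  ∀ A B : S, A ≠ 0 → B ≠ 0 → ∀ N : ℤ, δ A * B - A * δ B = N * a * A * B → N = 0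

lemma zD_const {S : Type} [CommRing S] [IsDomain S] [Algebra ℂ S] (δ : Derivation ℂ S S) (a : S)
    (K : Set S) (h0 : (0 : S) ∈ K) (hC : ∀ c ∈ K, δ c = 0) (hN : Mark δ a)
    (hK : ∀ A B : S, B ≠ 0 → δ A * B = A * δ B → ∃ c ∈ K, A = c * B) :
    ∀ A B : S[X], B ≠ 0 → zD δ a A * B = A * zD δ a B → ∃ c ∈ K, A = C c * B := by
  apply lead_trick (zD δ a) K h0
  · intro c hc
    ext i
    rw [zD_coeff, coeff_C]
    split_ifs with h
    · simp [hC c hc, h]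
    · simp
  · intro A B hA hB h
    have hlA : A.leadingCoeff ≠ 0 := leadingCoeff_ne_zero.mpr hA
    have hlB : B.leadingCoeff ≠ 0 := leadingCoeff_ne_zero.mpr hB
    have e := congrArg (fun p => p.coeff (A.natDegree + B.natDegree)) h
    rw [coeff_mul_add_eq_of_natDegree_le (zD_natDegree_le δ a A) le_rfl,
      coeff_mul_add_eq_of_natDegree_le le_rfl (zD_natDegree_le δ a B), zD_coeff, zD_coeff] at e
    simp only [coeff_natDegree] at e
    have hN0 := hN _ _ hlA hlB ((B.natDegree : ℤ) - A.natDegree) (by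
      push_cast; linear_combination e)
    have hd : A.natDegree = B.natDegree := by omega
    refine ⟨hd, hK _ _ hlB ?_⟩
    rw [hd] at e
    linear_combination e

lemma zD_mark {S : Type} [CommRing S] [IsDomain S] [Algebra ℂ S] (δ : Derivation ℂ S S) (a : S) :
    Mark (zD δ a) (X : S[X]) := by
  intro A B hA hB N h
  by_contra hN
  have : CharZero S := charZero_of_injective_algebraMap (algebraMap ℂ S).injective
  have e := congrArg (fun p => p.coeff (A.natDegree + B.natDegree + 1)) h
  have hr : ((N : S[X]) * X * A * B) = X * (C (N : S) * (A * B)) := by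
    simp only [map_intCast]; ring
  rw [hr, coeff_X_mul, coeff_C_mul, coeff_mul_degree_add_degree, coeff_sub,
    coeff_eq_zero_of_natDegree_lt, coeff_eq_zero_of_natDegree_lt] at e
  · have hlA : A.leadingCoeff ≠ 0 := leadingCoeff_ne_zero.mpr hA
    have hlB : B.leadingCoeff ≠ 0 := leadingCoeff_ne_zero.mpr hB
    have : (N : S) ≠ 0 := by exact_mod_cast hN
    rw [sub_zero] at e
    exact mul_ne_zero this (mul_ne_zero hlA hlB) e.symm
  · exact lt_of_le_of_lt (natDegree_mul_le.trans
      (Nat.add_le_add le_rfl (zD_natDegree_le δ a B))) (Nat.lt_succ_self _)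
  · exact lt_of_le_of_lt (natDegree_mul_le.trans
      (Nat.add_le_add (zD_natDegree_le δ a A) le_rfl)) (Nat.lt_succ_self _)

/-- Wronskian lemma. -/
lemma wronskian {L : Type} [Field L] [Algebra ℂ L] (u v : L[X]) (hv : v ≠ 0)
    (h : derivative u * v = u * derivative v) : ∃ c : L, u = C c * v := by
  have : CharZero L := charZero_of_injective_algebraMap (algebraMap ℂ L).injective
  obtain ⟨c, -, hc⟩ := zD_const (0 : Derivation ℂ L L) 1 Set.univ trivial (by simp)
    (by
      intro A B hA hB N h
      simp only [Derivation.zero_apply, zero_mul, mul_zero, sub_zero, mul_one] at h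
      have := h.symm
      simpa [hA, hB] using this)
    (by
      intro A B hB _
      exact ⟨A / B, trivial, by field_simp⟩) u v hv (by
      have : coeffD (0 : Derivation ℂ L L) = 0 := by
        ext p i; simp [coeffD_coeff]
      simp only [zD, this, zero_add, Derivation.smul_apply, derX_apply, smul_eq_mul, C_1, one_mul]
      linear_combination X * h)
  exact ⟨c, hc⟩

/-- Enriched example. -/
def Good (d : ℕ) : Prop :=
  ∃ (R : Type) (_ : CommRing R) (_ : IsDomain R) (_ : Algebra ℂ R) (δ : Derivation ℂ R R) (a : R),
    Algebra.FiniteType ℂ R ∧ ringKrullDim R = d ∧ Mark δ a ∧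
    (∀ a b : R, b ≠ 0 → δ a * b = a * δ b → ∃ c : ℂ, a = algebraMap ℂ R c * b) ∧
    ∀ y : R, (∀ P : Ideal R, P ≠ ⊥ → P.IsPrime → (∀ x ∈ P, δ x ∈ P) → y ∈ P) → y = 0

lemma Good.succ {d : ℕ} (h : Good d) : Good (d + 1) := by
  obtain ⟨R, _, _, _, δ, a, hft, hkd, hm, hc, hp⟩ := h
  have hno : IsNoetherianRing R := Algebra.FiniteType.isNoetherianRing ℂ R
  refine ⟨R[X], inferInstance, inferInstance, inferInstance, zD δ a, X, ?_, ?_, zD_mark δ a, ?_, ?_⟩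
  · exact Algebra.FiniteType.trans hft inferInstance
  · rw [Polynomial.ringKrullDim_of_isNoetherianRing, hkd]; rfl
  · intro A B hB h
    obtain ⟨_, ⟨c, rfl⟩, e⟩ := zD_const δ a (Set.range (algebraMap ℂ R)) ⟨0, by simp⟩
      (by rintro _ ⟨c, rfl⟩; simp) hm (by
        intro A B hB h
        obtain ⟨c, e⟩ := hc A B hB h
        exact ⟨_, ⟨c, rfl⟩, e⟩) A B hB h
    exact ⟨c, e⟩
  · intro y hy
    ext i
    rw [coeff_zero]
    apply hp
    intro P hP0 hPp hPd
    have := hy (P.map C) (by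
        rw [Ne, Ideal.map_eq_bot_iff_of_injective C_injective]; exact hP0)
      inferInstance (by
        intro x hx
        rw [Ideal.mem_map_C_iff] at hx ⊢
        intro n
        rw [zD_coeff]
        exact P.add_mem (hPd _ (hx n)) (P.mul_mem_left _ (P.mul_mem_left _ (hx n))))
    rw [Ideal.mem_map_C_iff] at this
    exact this i


noncomputable def ff {k : Type} [CommRing k] (lam : k) : k[X] := X * (X - 1) * (X - C lam)

noncomputable def DD {k : Type} [CommRing k] [Algebra ℂ k] (d : Derivation ℂ k k) (lam : k) :
    Derivation ℂ k[X][X] k[X][X] :=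
  coeffD (coeffD d) + (C (2 * X * (1 - X)) - C (2 * ff lam) * X : k[X][X]) • coeffD (derX k)
   + (1 + C (2 * (2 * X - 1)) * X + C (derivative (ff lam)) * X ^ 2 : k[X][X]) • derX k[X]

noncomputable def D0 {k : Type} [CommRing k] [Algebra ℂ k] (d : Derivation ℂ k k) :
    Derivation ℂ k[X] k[X] := coeffD d + (2 * X * (1 - X) : k[X]) • derX k

lemma DD_coeff {k : Type} [CommRing k] [Algebra ℂ k] (d : Derivation ℂ k k) (lam : k)
    (A : k[X][X]) (i : ℕ) : (DD d lam A).coeff (i + 1) =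
      D0 d (A.coeff (i + 1)) - 2 * ff lam * derivative (A.coeff i)
      + 2 * (2 * X - 1) * ((i : k[X]) + 1) * A.coeff (i + 1)
      + derivative (ff lam) * ((i : k[X]) * A.coeff i)
      + ((i : k[X]) + 2) * A.coeff (i + 2) := by
  have e1 : (X ^ 2 * derivative A).coeff (i + 1) = i * A.coeff i := by
    cases i with
    | zero => simp [pow_two, mul_assoc]
    | succ n =>
      rw [show n + 1 + 1 = n + 2 from rfl, coeff_X_pow_mul, coeff_derivative]; push_cast; ring
  simp only [DD, D0, Derivation.add_apply, Derivation.smul_apply, coeff_add, coeffD_coeff,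
    derX_apply, smul_eq_mul, sub_mul, add_mul, coeff_sub, coeff_C_mul, mul_assoc (C _), one_mul, e1,
    coeff_X_mul, coeff_derivative]
  push_cast
  ring

lemma DD_natDegree {k : Type} [CommRing k] [Algebra ℂ k] (d : Derivation ℂ k k) (lam : k)
    (A : k[X][X]) {m : ℕ} (h : A.natDegree ≤ m) : (DD d lam A).natDegree ≤ m + 1 := by
  rw [natDegree_le_iff_coeff_eq_zero]
  intro j hj
  obtain ⟨i, rfl⟩ : ∃ i, j = i + 1 := ⟨j - 1, by omega⟩
  rw [DD_coeff, coeff_eq_zero_of_natDegree_lt (by omega : A.natDegree < i + 1),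
    coeff_eq_zero_of_natDegree_lt (by omega : A.natDegree < i + 2),
    coeff_eq_zero_of_natDegree_lt (by omega : A.natDegree < i)]
  simp

lemma coeff_mul_snd {T : Type} [CommRing T] (f g : T[X]) {m n : ℕ} (hf : f.natDegree ≤ m + 1)
    (hg : g.natDegree ≤ n + 1) :
    (f * g).coeff (m + n + 1) = f.coeff (m + 1) * g.coeff n + f.coeff m * g.coeff (n + 1) := by
  have h1 : (f - C (f.coeff (m + 1)) * X ^ (m + 1)).natDegree ≤ m := by
    rw [natDegree_le_iff_coeff_eq_zero]
    intro i hi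
    rw [coeff_sub, coeff_C_mul, coeff_X_pow]
    split_ifs with h
    · simp [h]
    · rw [coeff_eq_zero_of_natDegree_lt (by omega)]; simp
  have e : f * g = (f - C (f.coeff (m + 1)) * X ^ (m + 1)) * g
      + C (f.coeff (m + 1)) * (X ^ (m + 1) * g) := by ring
  rw [e, coeff_add, add_assoc m, coeff_mul_add_eq_of_natDegree_le h1 hg, coeff_C_mul,
    show m + (n + 1) = n + (m + 1) by ring, coeff_X_pow_mul, coeff_sub, coeff_C_mul, coeff_X_pow]
  simp; ring

/-- `X^2` is a marker for `DD`. -/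
lemma DD_mark {k : Type} [CommRing k] [IsDomain k] [Algebra ℂ k] (d : Derivation ℂ k k) (lam : k) :
    Mark (DD d lam) (X ^ 2 : k[X][X]) := by
  intro A B hA hB N h
  by_contra hN
  have : CharZero k[X] := charZero_of_injective_algebraMap (algebraMap ℂ k[X]).injective
  have e := congrArg (fun p => p.coeff (A.natDegree + B.natDegree + 2)) h
  have hr : ((N : k[X][X]) * X ^ 2 * A * B) = X ^ 2 * (C (N : k[X]) * (A * B)) := by
    simp only [map_intCast]; ring
  rw [hr, coeff_X_pow_mul, coeff_C_mul, coeff_mul_degree_add_degree, coeff_sub,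
    coeff_eq_zero_of_natDegree_lt, coeff_eq_zero_of_natDegree_lt] at e
  · have hlA : A.leadingCoeff ≠ 0 := leadingCoeff_ne_zero.mpr hA
    have hlB : B.leadingCoeff ≠ 0 := leadingCoeff_ne_zero.mpr hB
    have : (N : k[X]) ≠ 0 := by exact_mod_cast hN
    rw [sub_zero] at e
    exact mul_ne_zero this (mul_ne_zero hlA hlB) e.symm
  · have := DD_natDegree d lam B le_rfl
    exact lt_of_le_of_lt natDegree_mul_le (by omega)
  · have := DD_natDegree d lam A le_rfl
    exact lt_of_le_of_lt natDegree_mul_le (by omega)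

lemma ff_deriv {k : Type} [CommRing k] (lam : k) : derivative (ff lam) =
    3 * X ^ 2 - 2 * (1 + C lam) * X + C lam := by
  simp [ff]; ring

section field
variable {L : Type} [Field L] [Algebra ℂ L]

lemma ff_ne (lam : L) : ff lam ≠ 0 :=
  mul_ne_zero (mul_ne_zero X_ne_zero (X_sub_C_ne_zero 1)) (X_sub_C_ne_zero lam)

lemma ff_root {lam : L} (h0 : lam ≠ 0) (h1 : lam ≠ 1) (c : L) (h : (ff lam).eval c = 0) :
    (derivative (ff lam)).eval c ≠ 0 := by
  rw [ff_deriv]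
  simp only [ff, eval_mul, eval_sub, eval_X, eval_one, eval_C, mul_eq_zero] at h
  simp only [eval_add, eval_sub, eval_mul, eval_pow, eval_X, eval_C, eval_one, eval_ofNat]
  rcases h with (h | h) | h
  · simpa [h] using h0
  · have : c = 1 := by linear_combination h
    subst this
    intro e; apply h1; linear_combination -e
  · have : c = lam := by linear_combination h
    subst this
    intro e
    have : c * (c - 1) = 0 := by linear_combination e
    rcases mul_eq_zero.mp this with h | h
    · exact h0 h
    · exact h1 (by linear_combination h)

lemma ff_natDegree (lam : L) : (ff lam).natDegree ≤ 3 := by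
  unfold ff; compute_degree

lemma r_lemma [IsAlgClosed L] {lam : L} (h0 : lam ≠ 0) (h1 : lam ≠ 1) (n D : L[X]) (hD : D ≠ 0)
    (e e0 : L)
    (h : 2 * ff lam * (derivative n * D - n * derivative D) + derivative (ff lam) * n * D
      = (C e * X + C e0) * D ^ 2) : C e * X + C e0 = 0 := by
  classical
  have : CharZero L := charZero_of_injective_algebraMap (algebraMap ℂ L).injective
  set l : L[X] := C e * X + C e0 with hl
  obtain ⟨n, D, hD, hcop, h⟩ : ∃ n D : L[X], D ≠ 0 ∧ IsCoprime n D ∧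
      2 * ff lam * (derivative n * D - n * derivative D) + derivative (ff lam) * n * D = l * D ^ 2 := by
    set g := EuclideanDomain.gcd n D
    have hg : g ≠ 0 := fun hg => hD (EuclideanDomain.gcd_eq_zero_iff.mp hg).2
    obtain ⟨n', hn'⟩ := EuclideanDomain.gcd_dvd_left n D
    obtain ⟨D', hD'⟩ := EuclideanDomain.gcd_dvd_right n D
    change n = g * n' at hn'
    change D = g * D' at hD'
    refine ⟨n', D', ?_, ?_, ?_⟩
    · rintro rfl; simp at hD'; exact hD hD'
    · have hb := EuclideanDomain.gcd_eq_gcd_ab n D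
      change g = _ at hb
      refine ⟨EuclideanDomain.gcdA n D, EuclideanDomain.gcdB n D, ?_⟩
      apply mul_left_cancel₀ hg
      rw [mul_one]
      conv_rhs => rw [hb]
      nth_rw 3 [hn']
      nth_rw 4 [hD']
      ring
    · apply mul_left_cancel₀ (pow_ne_zero 2 hg)
      rw [hn', hD', derivative_mul, derivative_mul] at h
      linear_combination h
  have hroot : ∀ c, D.eval c ≠ 0 := by
    intro c hc
    have hnc : n.eval c ≠ 0 := by
      intro hnc
      obtain ⟨a, b, hab⟩ := hcop
      have := congrArg (eval c) hab
      simp [hc, hnc] at this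
    obtain ⟨E, hE, hEc⟩ := exists_eq_pow_rootMultiplicity_mul_and_not_dvd D hD c
    have hm : 0 < D.rootMultiplicity c := (rootMultiplicity_pos hD).mpr hc
    obtain ⟨m, hm'⟩ : ∃ m, D.rootMultiplicity c = m + 1 := ⟨_, (Nat.succ_pred_eq_of_pos hm).symm⟩
    rw [hm'] at hE
    have hEc : E.eval c ≠ 0 := fun h => hEc (dvd_iff_isRoot.mpr h)
    have hX : (X - C c) ≠ 0 := X_sub_C_ne_zero c
    have hD' : derivative D = (X - C c) ^ m * (((m : L[X]) + 1) * E + (X - C c) * derivative E) := by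
      rw [hE, derivative_mul, derivative_pow]; simp; ring
    have k1 : 2 * ff lam * (derivative n * (X - C c) * E
        - n * (((m : L[X]) + 1) * E + (X - C c) * derivative E))
        + derivative (ff lam) * n * (X - C c) * E = l * (X - C c) ^ (m + 2) * E ^ 2 := by
      apply mul_left_cancel₀ (pow_ne_zero m hX)
      rw [hD', hE] at h
      linear_combination h
    have k2 := congrArg (eval c) k1
    simp only [eval_add, eval_sub, eval_mul, eval_pow, eval_X, eval_C, eval_one, eval_ofNat,
      eval_natCast, sub_self] at k2
    have hmne : (m : L) + 1 ≠ 0 := by exact_mod_cast Nat.succ_ne_zero m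
    have hfc : (ff lam).eval c = 0 := by
      have : (ff lam).eval c * (2 * (n.eval c * (((m : L) + 1) * E.eval c))) = 0 := by
        linear_combination -k2
      rcases mul_eq_zero.mp this with h | h
      · exact h
      · exact absurd h (mul_ne_zero two_ne_zero (mul_ne_zero hnc (mul_ne_zero hmne hEc)))
    obtain ⟨f1, hf1⟩ := dvd_iff_isRoot.mpr hfc
    have hdf : derivative (ff lam) = f1 + (X - C c) * derivative f1 := by
      rw [hf1, derivative_mul]; simp
    have hf1c : f1.eval c ≠ 0 := by
      have := ff_root h0 h1 c hfc
      rw [hdf] at this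
      simpa using this
    have k3 : 2 * f1 * (derivative n * (X - C c) * E
        - n * (((m : L[X]) + 1) * E + (X - C c) * derivative E))
        + (f1 + (X - C c) * derivative f1) * n * E = l * (X - C c) ^ (m + 1) * E ^ 2 := by
      apply mul_left_cancel₀ hX
      rw [hdf, hf1] at k1
      linear_combination k1
    have k4 := congrArg (eval c) k3
    simp only [eval_add, eval_sub, eval_mul, eval_pow, eval_X, eval_C, eval_one, eval_ofNat,
      eval_natCast, sub_self] at k4
    have : (2 * (m : L) + 1) * (f1.eval c * n.eval c * E.eval c) = 0 := by
      linear_combination -k4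
    have h2 : 2 * (m : L) + 1 ≠ 0 := by exact_mod_cast Nat.succ_ne_zero (2 * m)
    exact mul_ne_zero h2 (mul_ne_zero (mul_ne_zero hf1c hnc) hEc) this
  obtain ⟨u, hu⟩ : ∃ u, D = C u := by
    by_contra hne
    obtain ⟨c, hc⟩ := IsAlgClosed.exists_root D (by
      intro hdeg
      exact hne ⟨_, eq_C_of_degree_eq_zero hdeg⟩)
    exact hroot c hc
  have hu0 : u ≠ 0 := by rintro rfl; simp at hu; exact hD hu
  have hCu : (C u : L[X]) ≠ 0 := C_ne_zero.mpr hu0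
  have k : 2 * ff lam * derivative n + derivative (ff lam) * n = l * C u := by
    apply mul_left_cancel₀ hCu
    rw [hu] at h
    simp only [derivative_C] at h
    linear_combination h
  by_cases hn : n = 0
  · rw [hn] at k
    simp at k
    rcases k with k | k
    · exact k
    · exact absurd k hu0
  · exfalso
    have hlX : (X * (l * C u)).coeff (3 + n.natDegree) = 0 := by
      rw [show 3 + n.natDegree = (2 + n.natDegree) + 1 by ring, coeff_X_mul, coeff_mul_C,
        coeff_eq_zero_of_natDegree_lt, zero_mul]
      have : l.natDegree ≤ 1 := by rw [hl]; compute_degree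
      omega
    rw [← k, show X * (2 * ff lam * derivative n + derivative (ff lam) * n) =
      C 2 * (ff lam * (X * derivative n)) + (X * derivative (ff lam)) * n by
        simp only [map_ofNat]; ring, coeff_add, coeff_C_mul,
      coeff_mul_add_eq_of_natDegree_le (ff_natDegree lam) (by
        by_cases hz : n.natDegree = 0
        · rw [derivative_of_natDegree_zero hz]; simp
        · refine natDegree_mul_le.trans ?_
          rw [natDegree_X]
          have := natDegree_derivative_lt hz
          omega),
      coeff_mul_add_eq_of_natDegree_le (by rw [ff_deriv]; compute_degree) le_rfl] at hlX
    have c1 : (X * derivative n).coeff n.natDegree = n.natDegree * n.leadingCoeff := by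
      rcases Nat.eq_zero_or_eq_succ_pred n.natDegree with hz | hz
      · rw [hz]; simp
      · rw [leadingCoeff]
        set m := n.natDegree.pred
        rw [hz, coeff_X_mul, coeff_derivative]; push_cast; ring
    have c3 : (ff lam).coeff 3 = 1 := by
      rw [show ff lam = X ^ 3 - C (1 + lam) * X ^ 2 + C lam * X by simp [ff]; ring]
      simp only [coeff_add, coeff_sub, coeff_C_mul, coeff_X_pow, coeff_X]; norm_num
    have c2 : (X * derivative (ff lam)).coeff 3 = 3 := by
      rw [coeff_X_mul, coeff_derivative, c3]; norm_num
    rw [c1, c2, c3, coeff_natDegree] at hlX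
    have : (2 * (n.natDegree : L) + 3) * n.leadingCoeff = 0 := by linear_combination hlX
    have h2 : 2 * (n.natDegree : L) + 3 ≠ 0 := by exact_mod_cast Nat.succ_ne_zero (2 * n.natDegree + 2)
    exact mul_ne_zero h2 (leadingCoeff_ne_zero.mpr hn) this
end field

section field
variable {L : Type} [Field L] [Algebra ℂ L]

lemma D0_C (d : Derivation ℂ L L) (c : L) : D0 d (C c) = C (d c) := by
  simp [D0, coeffD_C, derX_apply]

lemma D0_ff (d : Derivation ℂ L L) {lam : L} (hd : d lam = 2 * lam * (1 - lam)) :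
    D0 d (ff lam) = 2 * (2 - 3 * X - C lam) * ff lam := by
  have h1 : D0 d (X : L[X]) = 2 * X * (1 - X) := by
    simp [D0, coeffD_X, derX_apply]
  have h2 : D0 d (X - 1 : L[X]) = 2 * X * (1 - X) := by
    rw [map_sub, h1]; simp
  have h3 : D0 d (X - C lam : L[X]) = 2 * X * (1 - X) - C (2 * lam * (1 - lam)) := by
    rw [map_sub, h1, D0_C, hd]
  unfold ff
  rw [Derivation.leibniz, Derivation.leibniz, h1, h2, h3]
  have : (C 2 : L[X]) = 2 := rfl
  simp only [smul_eq_mul, C_mul, C_sub, C_1, this]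
  ring

lemma der_pow {S : Type} [CommRing S] [Algebra ℂ S] (D : Derivation ℂ S S) (f g : S)
    (h : D f = g * f) (n : ℕ) : D (f ^ n) = n * g * f ^ n := by
  induction n with
  | zero => simp
  | succ n ih =>
    rw [pow_succ, Derivation.leibniz, ih, h]; simp; ring

lemma der_pow2 {S : Type} [CommRing S] [Algebra ℂ S] (D : Derivation ℂ S S) (f : S)
    (n : ℕ) : f * D (f ^ n) = n * D f * f ^ n := by
  induction n with
  | zero => simp
  | succ n ih =>
    rw [pow_succ, Derivation.leibniz]; simp only [smul_eq_mul]; push_cast; linear_combination f * ih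

lemma DD_C (d : Derivation ℂ L L) (lam : L) (c : L) :
    DD d lam (C (C c)) = C (C (d c)) := by
  simp [DD, coeffD_C, derX_apply]

lemma const_L [IsAlgClosed L] (d : Derivation ℂ L L) {lam : L} (h0 : lam ≠ 0) (h1 : lam ≠ 1)
    (hd : d lam = 2 * lam * (1 - lam)) (A B : L[X][X]) (hB : B ≠ 0)
    (h : DD d lam A * B = A * DD d lam B) : ∃ c : L, d c = 0 ∧ A = C (C c) * B := by
  have hch : CharZero L := charZero_of_injective_algebraMap (algebraMap ℂ L).injective
  suffices H : ∃ c ∈ {x : L[X] | ∃ c : L, d c = 0 ∧ x = C c}, A = C c * B by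
    obtain ⟨_, ⟨c, hc, rfl⟩, e⟩ := H
    exact ⟨c, hc, e⟩
  revert A B
  apply lead_trick
  · exact ⟨0, by simp, by simp⟩
  · rintro _ ⟨c, hc, rfl⟩
    rw [DD_C, hc]; simp
  intro A B hA hB h
  have hrel : DD d lam (X * A) * (X * B) = (X * A) * DD d lam (X * B) := by
    rw [Derivation.leibniz, Derivation.leibniz]
    simp only [smul_eq_mul]
    linear_combination X ^ 2 * h
  set a := A.natDegree
  set b := B.natDegree
  have hα : (X * A).coeff (a + 1) = A.leadingCoeff := by rw [coeff_X_mul]; rfl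
  have hβ : (X * B).coeff (b + 1) = B.leadingCoeff := by rw [coeff_X_mul]; rfl
  have hα0 : A.leadingCoeff ≠ 0 := leadingCoeff_ne_zero.mpr hA
  have hβ0 : B.leadingCoeff ≠ 0 := leadingCoeff_ne_zero.mpr hB
  have hda : (X * A).natDegree ≤ a + 1 := by
    refine natDegree_mul_le.trans ?_; rw [natDegree_X]; omega
  have hdb : (X * B).natDegree ≤ b + 1 := by
    refine natDegree_mul_le.trans ?_; rw [natDegree_X]; omega
  have hDa := DD_natDegree d lam _ hda
  have hDb := DD_natDegree d lam _ hdb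
  set α := A.leadingCoeff
  set β := B.leadingCoeff
  set α₁ := (X * A).coeff a with hα₁
  set β₁ := (X * B).coeff b with hβ₁
  have za : (X * A).coeff (a + 2) = 0 := coeff_eq_zero_of_natDegree_lt (by omega)
  have za2 : (X * A).coeff (a + 3) = 0 := coeff_eq_zero_of_natDegree_lt (by omega)
  have zb : (X * B).coeff (b + 2) = 0 := coeff_eq_zero_of_natDegree_lt (by omega)
  have zb2 : (X * B).coeff (b + 3) = 0 := coeff_eq_zero_of_natDegree_lt (by omega)
  have cA2 : (DD d lam (X * A)).coeff (a + 2) =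
      - 2 * ff lam * derivative α + derivative (ff lam) * (((a : L[X]) + 1) * α) := by
    rw [DD_coeff, show a + 1 + 1 = a + 2 from rfl, show a + 1 + 2 = a + 3 from rfl, za, za2, hα]
    simp
  have cB2 : (DD d lam (X * B)).coeff (b + 2) =
      - 2 * ff lam * derivative β + derivative (ff lam) * (((b : L[X]) + 1) * β) := by
    rw [DD_coeff, show b + 1 + 1 = b + 2 from rfl, show b + 1 + 2 = b + 3 from rfl, zb, zb2, hβ]
    simp
  have cA1 : (DD d lam (X * A)).coeff (a + 1) =
      D0 d α - 2 * ff lam * derivative α₁ + 2 * (2 * X - 1) * ((a : L[X]) + 1) * α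
      + derivative (ff lam) * ((a : L[X]) * α₁) := by
    rw [DD_coeff, za, hα]; simp [α₁]
  have cB1 : (DD d lam (X * B)).coeff (b + 1) =
      D0 d β - 2 * ff lam * derivative β₁ + 2 * (2 * X - 1) * ((b : L[X]) + 1) * β
      + derivative (ff lam) * ((b : L[X]) * β₁) := by
    rw [DD_coeff, zb, hβ]; simp [β₁]
  have E1 := congrArg (fun p => p.coeff ((a + 1 + 1) + (b + 1))) hrel
  beta_reduce at E1
  rw [coeff_mul_add_eq_of_natDegree_le hDa hdb,
    show (a + 1 + 1) + (b + 1) = (a + 1) + (b + 1 + 1) by ring,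
    coeff_mul_add_eq_of_natDegree_le hda hDb, hα, hβ] at E1
  have E2 := congrArg (fun p => p.coeff ((a + 1) + b + 1)) hrel
  beta_reduce at E2
  rw [coeff_mul_snd _ _ hDa hdb, show a + 1 + b + 1 = a + (b + 1) + 1 by ring,
    coeff_mul_snd _ _ hda hDb, hα, hβ] at E2
  rw [show a + 1 + 1 = a + 2 from rfl, show b + 1 + 1 = b + 2 from rfl, cA2, cB2] at E1 E2
  rw [cA1, cB1, ← hα₁, ← hβ₁] at E2
  clear cA1 cA2 cB1 cB2
  have hf := ff_ne lam
  have E1' : 2 * ff lam * (derivative α * β - α * derivative β) =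
      ((a : L[X]) - b) * derivative (ff lam) * α * β := by linear_combination -E1
  obtain ⟨γ, hγ⟩ := wronskian (α ^ 2 * ff lam ^ b) (β ^ 2 * ff lam ^ a)
    (mul_ne_zero (pow_ne_zero _ hβ0) (pow_ne_zero _ hf)) (by
      apply mul_left_cancel₀ hf
      have pa := der_pow2 (derX L) (ff lam) a
      have pb := der_pow2 (derX L) (ff lam) b
      simp only [derX_apply] at pa pb
      rw [derivative_mul, derivative_mul, pow_two, pow_two, derivative_mul, derivative_mul]
      linear_combination α * β * ff lam ^ a * ff lam ^ b * E1' +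
        α ^ 2 * β ^ 2 * ff lam ^ a * pb - α ^ 2 * β ^ 2 * ff lam ^ b * pa)
  have hγ0 : γ ≠ 0 := by
    rintro rfl
    rw [C_0, zero_mul] at hγ
    exact mul_ne_zero (pow_ne_zero _ hα0) (pow_ne_zero _ hf) hγ
  have hCγ : (C γ : L[X]) ≠ 0 := C_ne_zero.mpr hγ0
  have hD0 := congrArg (D0 d) hγ
  have hg := D0_ff d hd
  have ga := der_pow (D0 d) _ _ hg a
  have gb := der_pow (D0 d) _ _ hg b
  rw [Derivation.leibniz, Derivation.leibniz, Derivation.leibniz, D0_C, ga, gb, pow_two, pow_two,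
    Derivation.leibniz, Derivation.leibniz] at hD0
  simp only [smul_eq_mul] at hD0
  set g : L[X] := 2 * (2 - 3 * X - C lam) with hgdef
  have hrel2 : C γ * (2 * (D0 d α * β - α * D0 d β) - ((a : L[X]) - b) * g * α * β) =
      C (d γ) * α * β := by
    apply mul_left_cancel₀ (mul_ne_zero hα0 (pow_ne_zero b hf))
    linear_combination C γ * β * hD0 + (- C (d γ) * β - C γ * (2 * D0 d β + a * g * β)) * hγ
  have hrel3 : 2 * (D0 d α * β - α * D0 d β) = ((a : L[X]) - b) * g * α * β
      + C (d γ / γ) * α * β := by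
    apply mul_left_cancel₀ hCγ
    have : C γ * C (d γ / γ) = C (d γ) := by rw [← C_mul]; congr 1; field_simp
    linear_combination hrel2 - α * β * this
  have hhalf : (2 : L[X]) * C (d γ / γ / 2) = C (d γ / γ) := by
    rw [show (2 : L[X]) = C 2 from rfl, ← C_mul]; congr 1; field_simp
  have hell := r_lemma h0 h1 (α₁ * β - α * β₁) (α * β) (mul_ne_zero hα0 hβ0)
    ((a : L) - b) (d γ / γ / 2 - ((a : L) - b) * lam) (by
      simp only [C_sub, C_mul, C_eq_natCast, derivative_sub, derivative_mul]
      have h2 : (2 : L[X]) ≠ 0 := two_ne_zero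
      apply mul_left_cancel₀ h2
      linear_combination -2 * α * β * E2 + α * β * hrel3 - (2 * (α₁ * β + α * β₁)) * E1'
       - α ^ 2 * β ^ 2 * hhalf)
  have hl1 := congrArg (fun p => p.coeff 1) hell
  have hl0 := congrArg (fun p => p.coeff 0) hell
  simp [coeff_C] at hl1
  have hab : (a : L) = b := by linear_combination hl1
  have hab' : a = b := by exact_mod_cast hab
  simp [hab] at hl0
  have hdγ : d γ = 0 := by
    rcases hl0 with h | h
    · exact h
    · exact absurd h hγ0
  refine ⟨hab', ?_⟩
  obtain ⟨c, hc⟩ := wronskian α β hβ0 (by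
    apply mul_left_cancel₀ (mul_ne_zero (two_ne_zero (α := L[X])) hf)
    rw [hab'] at E1'
    linear_combination E1')
  refine ⟨C c, ⟨c, ?_, rfl⟩, hc⟩
  rw [hdγ, hab', hc, Derivation.leibniz, D0_C] at hrel3
  simp at hrel3
  have : (C (d c) : L[X]) * β ^ 2 = 0 := by linear_combination hrel3
  rcases mul_eq_zero.mp this with h | h
  · exact C_eq_zero.mp h
  · exact absurd h (pow_ne_zero _ hβ0)
end field


lemma mem_sub_step {S R : Type} [CommRing S] [CommRing R] [Algebra ℂ S] [Algebra ℂ R]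
    (ψ : S[X] →ₐ[ℂ] R) (Q : Subalgebra ℂ R) (hC : ∀ s, ψ (C s) ∈ Q) (hX : ψ X ∈ Q) (p : S[X]) :
    ψ p ∈ Q := by
  induction p using Polynomial.induction_on with
  | C a => exact hC a
  | add p q hp hq => rw [map_add]; exact Q.add_mem hp hq
  | monomial n a h => rw [pow_succ, ← mul_assoc, map_mul]; exact Q.mul_mem h hX

section gen
variable {k : Type} [CommRing k] [Algebra ℂ k] (d : Derivation ℂ k k) (lam : k)

lemma DD_CC (s : k) : DD d lam (C (C s)) = C (C (d s)) := by
  simp [DD, coeffD_C, derX_apply]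

lemma DD_CX : DD d lam (C X) = C (2 * X * (1 - X)) - C (2 * ff lam) * X := by
  simp only [DD, coeffD_C, coeffD_X, derX_apply, Derivation.add_apply, Derivation.smul_apply,
    derivative_C, derivative_X, smul_eq_mul]
  simp

lemma DD_X : DD d lam X = 1 + C (2 * (2 * X - 1)) * X + C (derivative (ff lam)) * X ^ 2 := by
  simp only [DD, coeffD_X, derX_apply, Derivation.add_apply, Derivation.smul_apply,
    derivative_X, smul_eq_mul]
  simp

lemma DD_hom {T : Type} [CommRing T] [Algebra ℂ T] (D2 : Derivation ℂ T T) (φ : k[X][X] →ₐ[ℂ] T)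
    (hs : ∀ s, φ (C (C (d s))) = D2 (φ (C (C s))))
    (hx : φ (C (2 * X * (1 - X)) - C (2 * ff lam) * X) = D2 (φ (C X)))
    (hu : φ (1 + C (2 * (2 * X - 1)) * X + C (derivative (ff lam)) * X ^ 2) = D2 (φ X))
    (p : k[X][X]) : φ (DD d lam p) = D2 (φ p) := by
  let Q : Subalgebra ℂ k[X][X] :=
    { carrier := {p | φ (DD d lam p) = D2 (φ p)}
      mul_mem' := by
        intro p q hp hq
        simp only [Set.mem_ofPred_eq] at *
        rw [Derivation.leibniz, map_mul, Derivation.leibniz, ← hp, ← hq]; simp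
      add_mem' := by
        intro p q hp hq
        simp only [Set.mem_ofPred_eq] at *
        rw [map_add, map_add, map_add, map_add, hp, hq]
      algebraMap_mem' := by
        intro r
        simp only [Set.mem_ofPred_eq]
        rw [Derivation.map_algebraMap, AlgHom.commutes, Derivation.map_algebraMap, map_zero] }
  change p ∈ Q
  refine mem_sub_step (AlgHom.id ℂ k[X][X]) Q ?_ ?_ p
  · intro s
    refine mem_sub_step (CAlgHom (R := ℂ) (A := k[X])) Q ?_ ?_ s
    · intro s
      change φ _ = _
      have := hs s
      rw [← DD_CC d lam] at this
      exact this
    · change φ _ = _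
      rw [← DD_CX d lam] at hx
      exact hx
  · change φ _ = _
    rw [← DD_X d lam] at hu
    exact hu
end gen

/-- evaluation on the plane -/
noncomputable def evA {L : Type} [CommRing L] [Algebra ℂ L] (x u : L) : L[X][X] →ₐ[ℂ] L :=
  { evalEvalRingHom x u with
    commutes' := fun r => by
      change evalEval x u (C (C (algebraMap ℂ L r))) = _
      simp }

lemma evA_apply {L : Type} [CommRing L] [Algebra ℂ L] (x u : L) (p : L[X][X]) :
    evA x u p = evalEval x u p := rfl

lemma evA_DD {L : Type} [CommRing L] [Algebra ℂ L] (d : Derivation ℂ L L) (lam x u : L)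
    (hx : d x = 2 * x * (1 - x) - 2 * (ff lam).eval x * u)
    (hu : d u = 1 + 2 * (2 * x - 1) * u + (derivative (ff lam)).eval x * u ^ 2) (p : L[X][X]) :
    evA x u (DD d lam p) = d (evA x u p) := by
  apply DD_hom
  · intro s; simp [evA_apply]
  · simp [evA_apply, hx, evalEval]
  · simp [evA_apply, hu, evalEval]

noncomputable def iot : ℂ[X] →ₐ[ℂ] LL := IsScalarTower.toAlgHom ℂ ℂ[X] LL

noncomputable def liftP : ℂ[X][X][X] →ₐ[ℂ] LL[X][X] := mapAlgHom (mapAlgHom iot)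

lemma liftP_coeff (p : ℂ[X][X][X]) (i j : ℕ) :
    ((liftP p).coeff i).coeff j = iot ((p.coeff i).coeff j) := by
  simp [liftP]

lemma iot_inj : Function.Injective iot := LL_inj

lemma liftP_inj : Function.Injective liftP := by
  intro p q h
  ext1 i; ext1 j
  apply iot_inj
  rw [← liftP_coeff, ← liftP_coeff, h]

noncomputable def lamL : LL := iot X

lemma lam_ne0 : lamL ≠ 0 := by
  intro h
  exact X_ne_zero (iot_inj (h.trans (map_zero _).symm))

lemma lam_ne1 : lamL ≠ 1 := by
  intro h
  exact X_ne_C (1 : ℂ) (iot_inj (h.trans (map_one _).symm))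

noncomputable def dL : Derivation ℂ LL LL := exists_dL.choose

lemma dL_iot (s : ℂ[X]) : dL (iot s) = iot (dBase s) := exists_dL.choose_spec s

lemma dL_lam : dL lamL = 2 * lamL * (1 - lamL) := by
  have : iot 2 = 2 := map_ofNat iot 2
  rw [lamL, dL_iot]; simp [dBase, derX_apply, this]

noncomputable abbrev DR : Derivation ℂ ℂ[X][X][X] ℂ[X][X][X] := DD dBase X

lemma liftP_DR (p : ℂ[X][X][X]) : liftP (DR p) = DD dL lamL (liftP p) := by
  have hff : (ff (X : ℂ[X])).map (iot : ℂ[X] →+* LL) = ff lamL := by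
    simp [ff, lamL]
  apply DD_hom
  · intro s
    have : ∀ s, liftP (C (C s)) = C (C (iot s)) := by intro s; simp [liftP]
    rw [this, this, DD_CC, dL_iot]
  · have : liftP (C X) = C X := by simp [liftP]
    rw [this, DD_CX]
    simp [liftP, hff]
  · have : liftP X = X := by simp [liftP]
    rw [this, DD_X, ← hff, derivative_map]
    simp [liftP]

lemma const_R (A B : ℂ[X][X][X]) (hB : B ≠ 0) (h : DR A * B = A * DR B) :
    ∃ c : ℂ, A = algebraMap ℂ _ c * B := by
  obtain ⟨c, hc, e⟩ := const_L dL lam_ne0 lam_ne1 dL_lam (liftP A) (liftP B)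
    (fun h => hB (liftP_inj (h.trans (map_zero _).symm)))
    (by rw [← liftP_DR, ← liftP_DR, ← map_mul, ← map_mul, h])
  have key : ∀ i j, iot ((A.coeff i).coeff j) = c * iot ((B.coeff i).coeff j) := by
    intro i j
    rw [← liftP_coeff, ← liftP_coeff, e, coeff_C_mul, coeff_C_mul]
  obtain ⟨i, j, hij⟩ : ∃ i j, (B.coeff i).coeff j ≠ 0 := by
    by_contra! hne
    apply hB
    ext1 i; ext1 j
    rw [hne]; simp
  set p := (A.coeff i).coeff j with hp
  set q := (B.coeff i).coeff j with hq
  have hd : derivative p * q = p * derivative q := by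
    have h1 := key i j
    rw [← hp, ← hq] at h1
    have h2 := congrArg dL h1
    rw [Derivation.leibniz, hc, smul_zero, add_zero, dL_iot, dL_iot, smul_eq_mul] at h2
    have h3 : dBase p * q = p * dBase q := by
      apply iot_inj
      rw [map_mul, map_mul, h1, h2]; ring
    simp only [dBase, Derivation.smul_apply, derX_apply, smul_eq_mul] at h3
    have hne : (2 * X * (1 - X) : ℂ[X]) ≠ 0 := by
      refine mul_ne_zero (mul_ne_zero two_ne_zero X_ne_zero) ?_
      rw [sub_ne_zero]
      exact fun h => X_ne_C (1 : ℂ) h.symm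
    apply mul_left_cancel₀ hne
    linear_combination h3
  obtain ⟨c0, hc0⟩ := wronskian p q hij hd
  have hcc : c = iot (C c0) := by
    have h1 := key i j
    rw [← hp, ← hq, hc0, map_mul] at h1
    have hq0 : iot q ≠ 0 := fun h => hij (iot_inj (h.trans (map_zero _).symm))
    exact (mul_right_cancel₀ hq0 h1).symm
  refine ⟨c0, ?_⟩
  apply liftP_inj
  rw [e, map_mul, AlgHom.commutes, hcc]
  congr 1


section chain
variable {L : Type} [Field L] [Algebra ℂ L]

def fe (lam t : L) : L := t * (t - 1) * (t - lam)
def fe' (lam t : L) : L := 3 * t ^ 2 - 2 * (1 + lam) * t + lam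
def N6 (lam t : L) : L := (t ^ 2 - lam) * (t ^ 2 - 2 * t + lam) * (t ^ 2 - 2 * lam * t + lam)

lemma ff_eval (lam t : L) : (ff lam).eval t = fe lam t := by simp [ff, fe]
lemma ff'_eval (lam t : L) : (derivative (ff lam)).eval t = fe' lam t := by
  rw [ff_deriv]; simp [fe']

def GoodPt (d : Derivation ℂ L L) (lam : L) (p : L × L) : Prop :=
  fe lam p.1 ≠ 0 ∧ d p.1 = 2 * p.1 * (1 - p.1) - 2 * fe lam p.1 * p.2 ∧
  d p.2 = 1 + 2 * (2 * p.1 - 1) * p.2 + fe' lam p.1 * p.2 ^ 2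

def Step (lam : L) (p q : L × L) : Prop :=
  (q.1 ^ 2 - lam) ^ 2 = 4 * fe lam q.1 * p.1 ∧
  p.2 * N6 lam q.1 = 16 * fe lam q.1 ^ 2 * q.2 + 4 * fe lam q.1 * fe' lam q.1

/-- the three factorizations -/
lemma X2_facts {lam x t : L} (h : (t ^ 2 - lam) ^ 2 = 4 * fe lam t * x) :
    (t ^ 2 - 2 * t + lam) ^ 2 = 4 * fe lam t * (x - 1) ∧
    (t ^ 2 - 2 * lam * t + lam) ^ 2 = 4 * fe lam t * (x - lam) := by
  unfold fe at *
  constructor <;> linear_combination h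

lemma N6_ne {lam x t : L} (h2 : (2 : L) ≠ 0) (h : (t ^ 2 - lam) ^ 2 = 4 * fe lam t * x) (ht : fe lam t ≠ 0)
    (hx : fe lam x ≠ 0) : N6 lam t ≠ 0 := by
  obtain ⟨e1, e2⟩ := X2_facts h
  have h4 : (4 : L) ≠ 0 := by
    rw [show (4 : L) = 2 * 2 by norm_num]; exact mul_ne_zero h2 h2
  intro hN
  have : N6 lam t ^ 2 = (4 * fe lam t) ^ 3 * fe lam x := by
    unfold N6
    rw [mul_pow, mul_pow, h, e1, e2]; simp only [fe]; ring
  rw [hN] at this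
  exact mul_ne_zero (pow_ne_zero 3 (mul_ne_zero h4 ht)) hx (by rw [← this]; simp)

lemma fe_ne_of_step {lam x t : L} (h0 : lam ≠ 0) (h1 : lam ≠ 1)
    (h : (t ^ 2 - lam) ^ 2 = 4 * fe lam t * x) : fe lam t ≠ 0 := by
  intro hf
  rw [hf] at h
  have h' : t ^ 2 = lam := by
    have : (t ^ 2 - lam) ^ 2 = 0 := by rw [h]; ring
    linear_combination pow_eq_zero_iff (two_ne_zero) |>.mp this
  unfold fe at hf
  rcases mul_eq_zero.mp hf with hf | hf
  · rcases mul_eq_zero.mp hf with hf | hf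
    · rw [hf] at h'; exact h0 (by rw [← h']; ring)
    · have : t = 1 := by linear_combination hf
      rw [this] at h'; exact h1 (by rw [← h']; ring)
  · have : t = lam := by linear_combination hf
    rw [this] at h'
    have : lam * (lam - 1) = 0 := by linear_combination h'
    rcases mul_eq_zero.mp this with h | h
    · exact h0 h
    · exact h1 (by linear_combination h)

lemma X2_surj [IsAlgClosed L] (lam x : L) : ∃ t, (t ^ 2 - lam) ^ 2 = 4 * fe lam t * x := by
  obtain ⟨t, ht⟩ := IsAlgClosed.exists_root ((X ^ 2 - C lam) ^ 2 - C (4 * x) * ff lam) (by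
    have h4 : ((X ^ 2 - C lam) ^ 2 : L[X]).degree = 4 := by
      rw [degree_pow, degree_X_pow_sub_C (by norm_num)]; rfl
    rw [degree_sub_eq_left_of_degree_lt]
    · rw [h4]; decide
    · rw [h4]
      have h3 : (C (4 * x) * ff lam).natDegree ≤ 3 :=
        (natDegree_C_mul_le _ _).trans (ff_natDegree lam)
      exact lt_of_le_of_lt (degree_le_of_natDegree_le h3) (by norm_num))
  refine ⟨t, ?_⟩
  simp only [IsRoot, eval_sub, eval_mul, eval_pow, eval_X, eval_C, ff_eval] at ht
  linear_combination ht

set_option maxHeartbeats 1600000 in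
lemma exists_step [IsAlgClosed L] (d : Derivation ℂ L L) {lam : L} (h0 : lam ≠ 0) (h1 : lam ≠ 1)
    (hd : d lam = 2 * lam * (1 - lam)) (p : L × L) (hp : GoodPt d lam p) :
    ∃ q, GoodPt d lam q ∧ Step lam p q := by
  have hch : CharZero L := charZero_of_injective_algebraMap (algebraMap ℂ L).injective
  obtain ⟨x, u⟩ := p
  obtain ⟨hfx, hdx, hdu⟩ := hp
  simp only at hfx hdx hdu
  obtain ⟨t, ht⟩ := X2_surj lam x
  have hft := fe_ne_of_step h0 h1 ht
  have hN := N6_ne two_ne_zero ht hft hfx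
  have hx : x = (t ^ 2 - lam) ^ 2 / (4 * fe lam t) := by
    field_simp; linear_combination -ht
  obtain ⟨v, hv⟩ : ∃ v, v = (u * N6 lam t - 4 * fe lam t * fe' lam t) / (16 * fe lam t ^ 2) :=
    ⟨_, rfl⟩
  have hstep : u * N6 lam t = 16 * fe lam t ^ 2 * v + 4 * fe lam t * fe' lam t := by
    rw [hv]; field_simp; ring
  have ht0 : t ≠ 0 := by intro h; apply hft; simp [fe, h]
  have ht1 : t - 1 ≠ 0 := by intro h; apply hft; simp [fe, h]
  have htl : t - lam ≠ 0 := by intro h; apply hft; simp [fe, h]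
  have d2 : d 2 = 0 := by exact_mod_cast d.map_natCast 2
  have d3 : d 3 = 0 := by exact_mod_cast d.map_natCast 3
  have d4 : d 4 = 0 := by exact_mod_cast d.map_natCast 4
  have d16 : d 16 = 0 := by exact_mod_cast d.map_natCast 16
  have hdt : d t = 2 * t * (1 - t) - 2 * fe lam t * v := by
    have e := congrArg d ht
    simp only [fe, Derivation.leibniz, Derivation.leibniz_pow, map_sub, map_add, smul_eq_mul, d4,
      Derivation.map_one_eq_zero, hd, hdx, nsmul_eq_mul] at e
    have hα : fe lam t * (4 * t * (t ^ 2 - lam) - 4 * x * fe' lam t) = N6 lam t := by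
      rw [hx]; field_simp; simp only [fe, fe', N6]; ring
    have hα0 : 4 * t * (t ^ 2 - lam) - 4 * x * fe' lam t ≠ 0 := by
      intro h; apply hN; rw [← hα, h, mul_zero]
    apply mul_left_cancel₀ hα0
    have key : (4 * t * (t ^ 2 - lam) - 4 * x * fe' lam t) * (2 * t * (1 - t) - 2 * fe lam t * v)
       = 2 * (t ^ 2 - lam) * (2 * lam * (1 - lam)) + 4 * fe lam t *
        (2 * x * (1 - x) - 2 * fe lam x * u) + 4 * x * (- t * (t - 1)) * (2 * lam * (1 - lam)) := by
      rw [hv, hx]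
      simp only [fe, fe', N6]
      field_simp
      ring
    rw [key]
    simp only [fe, fe'] at *
    push_cast at e
    linear_combination e
  refine ⟨(t, v), ⟨hft, hdt, ?_⟩, ht, hstep⟩
  have e := congrArg d hstep
  simp only [fe, fe', N6, Derivation.leibniz, Derivation.leibniz_pow, map_sub, map_add, smul_eq_mul,
    d4, d16, d2, d3,
      Derivation.map_one_eq_zero, hd, hdu, nsmul_eq_mul, hdt] at e
  have h16 : 16 * fe lam t ^ 2 ≠ 0 := mul_ne_zero (by norm_num) (pow_ne_zero 2 hft)
  apply mul_left_cancel₀ h16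
  simp only
  generalize d v = dv at *
  have key : ∀ w dl : L, w = 2 * t * (1 - t) - 2 * fe lam t * v → dl = 2 * lam * (1 - lam) →
      (1 + 2 * (2 * x - 1) * u + fe' lam x * u ^ 2) * N6 lam t + u * (
        (2 * t * w - dl) * (t ^ 2 - 2 * t + lam) * (t ^ 2 - 2 * lam * t + lam)
        + (t ^ 2 - lam) * (2 * t * w - 2 * w + dl) * (t ^ 2 - 2 * lam * t + lam)
        + (t ^ 2 - lam) * (t ^ 2 - 2 * t + lam) * (2 * t * w - 2 * lam * w - 2 * dl * t + dl))
      = 16 * fe lam t ^ 2 * (1 + 2 * (2 * t - 1) * v + fe' lam t * v ^ 2)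
      + (32 * fe lam t * v + 4 * fe' lam t) * (fe' lam t * w - t * (t - 1) * dl)
      + 4 * fe lam t * ((6 * t - 2 * (1 + lam)) * w + (1 - 2 * t) * dl) := by
    rintro w dl rfl rfl
    rw [hv, hx]
    simp only [fe, fe', N6]
    field_simp
    ring
  have key' := key _ _ rfl rfl
  clear key
  simp only [fe, fe', N6] at *
  push_cast at e
  linear_combination key' - e
end chain


section dens
variable {L : Type} [Field L] [Algebra ℂ L]

lemma poly_eq_off {lam : L} (p q : L[X]) (h : ∀ t, fe lam t ≠ 0 → p.eval t = q.eval t) : p = q := by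
  have hch : CharZero L := charZero_of_injective_algebraMap (algebraMap ℂ L).injective
  apply mul_left_cancel₀ (ff_ne lam)
  apply Polynomial.funext
  intro t
  rw [eval_mul, eval_mul, ff_eval]
  by_cases ht : fe lam t = 0
  · rw [ht]; ring
  · rw [h t ht]

noncomputable def ap (lam : L) : L[X] := (X ^ 2 - C lam) ^ 2
noncomputable def bp (lam : L) : L[X] := 4 * ff lam
noncomputable def pp (lam : L) : L[X] := 16 * ff lam ^ 2
noncomputable def qp (lam : L) : L[X] := 4 * ff lam * derivative (ff lam)
noncomputable def sp (lam : L) : L[X] :=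
  (X ^ 2 - C lam) * (X ^ 2 - 2 * X + C lam) * (X ^ 2 - 2 * C lam * X + C lam)

lemma ap_eval (lam t : L) : (ap lam).eval t = (t ^ 2 - lam) ^ 2 := by simp [ap]
lemma bp_eval (lam t : L) : (bp lam).eval t = 4 * fe lam t := by simp [bp, ff_eval]
lemma pp_eval (lam t : L) : (pp lam).eval t = 16 * fe lam t ^ 2 := by simp [pp, ff_eval]
lemma qp_eval (lam t : L) : (qp lam).eval t = 4 * fe lam t * fe' lam t := by
  simp [qp, ff_eval, ff'_eval]
lemma sp_eval (lam t : L) : (sp lam).eval t = N6 lam t := by simp [sp, N6]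

noncomputable def star' (lam : L) (N : ℕ) (P : L[X]) : L[X] :=
  ∑ i ∈ Finset.range (N + 1), C (P.coeff i) * ap lam ^ i * bp lam ^ (N - i)

lemma star_eval {lam : L} {N : ℕ} {P : L[X]} (hP : P.natDegree ≤ N) {t x : L}
    (h : (t ^ 2 - lam) ^ 2 = 4 * fe lam t * x) :
    (star' lam N P).eval t = (4 * fe lam t) ^ N * P.eval x := by
  rw [star', eval_finsetSum, eval_eq_sum_range' (Nat.lt_succ_of_le hP), Finset.mul_sum]
  apply Finset.sum_congr rfl
  intro i hi
  have hi : i ≤ N := by simpa [Nat.lt_succ_iff] using hi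
  simp only [eval_mul, eval_pow, eval_C, ap_eval, bp_eval, h]
  rw [mul_pow, ← Nat.sub_add_cancel hi, pow_add, Nat.add_sub_cancel]
  ring

lemma star_ne [IsAlgClosed L] {lam : L} (h0 : lam ≠ 0) (h1 : lam ≠ 1) {N : ℕ} {P : L[X]}
    (hP : P.natDegree ≤ N) (hne : P ≠ 0) : star' lam N P ≠ 0 := by
  have hch : CharZero L := charZero_of_injective_algebraMap (algebraMap ℂ L).injective
  intro hz
  apply hne
  apply Polynomial.funext
  intro x
  obtain ⟨t, ht⟩ := X2_surj lam x
  have hf := fe_ne_of_step h0 h1 ht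
  have := star_eval hP ht
  rw [hz, eval_zero] at this
  have h4 : (4 * fe lam t) ^ N ≠ 0 := pow_ne_zero _ (mul_ne_zero (by norm_num) hf)
  rcases mul_eq_zero.mp this.symm with h | h
  · exact absurd h h4
  · simpa using h

/-- pointwise functional equation -/
def FE (lam : L) (m : L) (Q P : L[X]) : Prop := ∀ t x, fe lam t ≠ 0 →
  (t ^ 2 - lam) ^ 2 = 4 * fe lam t * x →
  Q.eval t * (m * (4 * fe lam t * fe' lam t) * Q.eval x + N6 lam t * P.eval x) =
    Q.eval x * (16 * fe lam t ^ 2) * P.eval t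

lemma FE_coprime [IsAlgClosed L] {lam : L} (h0 : lam ≠ 0) (h1 : lam ≠ 1) (m : L) (h Q P : L[X])
    (hh : h ≠ 0) (H : FE lam m (h * Q) (h * P)) : FE lam m Q P := by
  have hch : CharZero L := charZero_of_injective_algebraMap (algebraMap ℂ L).injective
  set N := max h.natDegree (max Q.natDegree P.natDegree) with hN
  have n1 : h.natDegree ≤ N := by omega
  have n2 : Q.natDegree ≤ N := by omega
  have n3 : P.natDegree ≤ N := by omega
  have key : Q * (C m * qp lam * star' lam N Q + sp lam * star' lam N P)
      = star' lam N Q * pp lam * P := by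
    apply mul_left_cancel₀ (mul_ne_zero hh (star_ne h0 h1 n1 hh))
    apply poly_eq_off (lam := lam)
    intro t ht
    have hx : (t ^ 2 - lam) ^ 2 = 4 * fe lam t * ((t ^ 2 - lam) ^ 2 / (4 * fe lam t)) := by
      field_simp
    have e := H _ _ ht hx
    simp only [eval_mul, eval_add, eval_C, qp_eval, sp_eval, pp_eval, star_eval n1 hx,
      star_eval n2 hx, star_eval n3 hx] at e ⊢
    linear_combination ((4 * fe lam t) ^ N * (4 * fe lam t) ^ N) * e
  intro t x ht hx
  have e := congrArg (eval t) key
  simp only [eval_mul, eval_add, eval_C, qp_eval, sp_eval, pp_eval,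
      star_eval n2 hx, star_eval n3 hx] at e
  have h4 : (4 * fe lam t) ^ N ≠ 0 := pow_ne_zero _ (mul_ne_zero (by norm_num) ht)
  apply mul_left_cancel₀ h4
  linear_combination e

lemma FE_stepA [IsAlgClosed L] {lam : L} (h0 : lam ≠ 0) (h1 : lam ≠ 1) (m : L) (Q P : L[X])
    (hQ : Q ≠ 0) (hcop : ∀ c, Q.eval c = 0 → P.eval c ≠ 0) (H : FE lam m Q P) :
    ∀ c, Q.eval c = 0 → fe lam c = 0 := by
  classical
  have hch : CharZero L := charZero_of_injective_algebraMap (algebraMap ℂ L).injective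
  have back : ∀ c t, Q.eval c = 0 → fe lam c ≠ 0 → (t ^ 2 - lam) ^ 2 = 4 * fe lam t * c →
      Q.eval t = 0 ∧ fe lam t ≠ 0 := by
    intro c t hc hfc ht
    have hft := fe_ne_of_step h0 h1 ht
    refine ⟨?_, hft⟩
    have e := H t c hft ht
    rw [hc] at e
    have e' : Q.eval t * (N6 lam t * P.eval c) = 0 := by linear_combination e
    rcases mul_eq_zero.mp e' with h | h
    · exact h
    · exact absurd h (mul_ne_zero (N6_ne two_ne_zero ht hft hfc) (hcop c hc))
  let S : Finset L := Q.roots.toFinset.filter (fun c => fe lam c ≠ 0)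
  have hS : ∀ c, c ∈ S ↔ Q.eval c = 0 ∧ fe lam c ≠ 0 := by
    intro c; simp [S, hQ]
  choose g hg using X2_surj lam
  have hmaps : ∀ c ∈ S, g c ∈ S := by
    intro c hc
    rw [hS] at hc ⊢
    exact back c _ hc.1 hc.2 (hg c)
  have huniq : ∀ t c c', fe lam t ≠ 0 → (t ^ 2 - lam) ^ 2 = 4 * fe lam t * c →
      (t ^ 2 - lam) ^ 2 = 4 * fe lam t * c' → c = c' := by
    intro t c c' ht e1 e2
    exact mul_left_cancel₀ (mul_ne_zero (by norm_num : (4 : L) ≠ 0) ht) (e1.symm.trans e2)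
  have hinj : Set.InjOn g S := by
    intro c hc c' hc' e
    have h2 := hg c'
    rw [← e] at h2
    exact huniq (g c) c c' ((hS _).mp (hmaps c hc)).2 (hg c) h2
  have hsurj : Set.SurjOn g S S := Finset.surjOn_of_injOn_of_card_le g hmaps hinj le_rfl
  intro c hc
  by_contra hfc
  have hcS : c ∈ S := (hS c).mpr ⟨hc, hfc⟩
  have ht := ((hS _).mp (hmaps c hcS)).2
  have ht0 : g c ≠ 0 := by intro h; apply ht; simp [fe, h]
  have e2 : ((lam / g c) ^ 2 - lam) ^ 2 = 4 * fe lam (lam / g c) * c := by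
    have := hg c
    unfold fe at *
    field_simp
    linear_combination this
  have h2S : lam / g c ∈ S := by
    rw [hS]; exact back c _ hc hfc e2
  obtain ⟨c2, hc2, e3⟩ := hsurj h2S
  have hcc : c2 = c := by
    have h3 := hg c2
    rw [e3] at h3
    exact huniq _ _ _ ((hS _).mp h2S).2 h3 e2
  rw [hcc] at e3
  have hsq : g c ^ 2 = lam := by
    field_simp at e3; exact e3
  have e4 := hg c
  rw [hsq, sub_self] at e4
  have : c = 0 := by
    have : (4 * fe lam (g c)) * c = 0 := by rw [← e4]; ring
    rcases mul_eq_zero.mp this with h | h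
    · exact absurd h (mul_ne_zero (by norm_num) ht)
    · exact h
  apply hfc; simp [fe, this]

lemma FE_stepB [IsAlgClosed L] {lam : L} (h0 : lam ≠ 0) (h1 : lam ≠ 1) (m : L) (Q P : L[X])
    (hcop : ∀ c, Q.eval c = 0 → P.eval c ≠ 0) (H : FE lam m Q P)
    (hA : ∀ c, Q.eval c = 0 → fe lam c = 0) (e : L) (se te : L[X])
    (hse0 : se ≠ 0) (hs : sp lam = se * te)
    (hse : ∀ t x, (t ^ 2 - lam) ^ 2 = 4 * fe lam t * x → se.eval t ^ 2 = 4 * fe lam t * (x - e))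
    (hte : ∀ t, (t ^ 2 - lam) ^ 2 = 4 * fe lam t * e → fe lam t ≠ 0 → te.eval t ≠ 0) :
    Q.eval e ≠ 0 := by
  have hch : CharZero L := charZero_of_injective_algebraMap (algebraMap ℂ L).injective
  intro hQe
  obtain ⟨Q0, hQ0⟩ := dvd_iff_isRoot.mpr hQe
  set N := max Q0.natDegree P.natDegree with hN
  have n2 : Q0.natDegree ≤ N := by omega
  have n3 : P.natDegree ≤ N := by omega
  have key : Q * (C m * qp lam * se * star' lam N Q0 + te * bp lam * star' lam N P)
      = se * star' lam N Q0 * pp lam * P := by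
    apply mul_left_cancel₀ hse0
    apply poly_eq_off (lam := lam)
    intro t ht
    have hx : (t ^ 2 - lam) ^ 2 = 4 * fe lam t * ((t ^ 2 - lam) ^ 2 / (4 * fe lam t)) := by
      field_simp
    have E := H _ _ ht hx
    have hs' := congrArg (eval t) hs
    rw [sp_eval, eval_mul] at hs'
    have hse' := hse _ _ hx
    have hQx : Q.eval ((t ^ 2 - lam) ^ 2 / (4 * fe lam t)) =
      ((t ^ 2 - lam) ^ 2 / (4 * fe lam t) - e) * Q0.eval ((t ^ 2 - lam) ^ 2 / (4 * fe lam t)) := by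
      conv_lhs => rw [hQ0]
      simp
    rw [hQx, hs'] at E
    simp only [eval_mul, eval_add, eval_C, qp_eval, pp_eval, bp_eval, star_eval n2 hx,
      star_eval n3 hx]
    generalize (t ^ 2 - lam) ^ 2 / (4 * fe lam t) = x at *
    linear_combination ((4 * fe lam t) ^ N * (4 * fe lam t)) * E +
      (4 * fe lam t) ^ N * Q0.eval x * (m * (4 * fe lam t * fe' lam t) * Q.eval t
        - 16 * fe lam t ^ 2 * P.eval t) * hse'
  obtain ⟨t, ht⟩ := X2_surj lam e
  have hft := fe_ne_of_step h0 h1 ht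
  have hset : se.eval t = 0 := by
    have := hse t e ht
    rw [sub_self, mul_zero] at this
    exact pow_eq_zero_iff two_ne_zero |>.mp this
  have E := congrArg (eval t) key
  simp only [eval_mul, eval_add, eval_C, hset, bp_eval, star_eval n3 ht, mul_zero, zero_mul,
    zero_add] at E
  have hb : 4 * fe lam t ≠ 0 := mul_ne_zero (by norm_num) hft
  have hQt : Q.eval t = 0 := by
    rcases mul_eq_zero.mp E with h | h
    · exact h
    · exact absurd h (mul_ne_zero (mul_ne_zero (hte t ht hft) hb)
        (mul_ne_zero (pow_ne_zero _ hb) (hcop e hQe)))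
  exact hft (hA t hQt)

lemma FE_false [IsAlgClosed L] {lam : L} (h0 : lam ≠ 0) (h1 : lam ≠ 1) (m : L) (hm : m ≠ 0)
    (α α₁ : L[X]) (hα : α ≠ 0) (H : FE lam m α α₁) : False := by
  classical
  have hch : CharZero L := charZero_of_injective_algebraMap (algebraMap ℂ L).injective
  obtain ⟨Q, P, hQ, hcop, H⟩ : ∃ Q P : L[X], Q ≠ 0 ∧ IsCoprime Q P ∧ FE lam m Q P := by
    set g := EuclideanDomain.gcd α α₁
    have hg : g ≠ 0 := fun hg => hα (EuclideanDomain.gcd_eq_zero_iff.mp hg).1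
    obtain ⟨n', hn'⟩ := EuclideanDomain.gcd_dvd_left α α₁
    obtain ⟨D', hD'⟩ := EuclideanDomain.gcd_dvd_right α α₁
    change α = g * n' at hn'
    change α₁ = g * D' at hD'
    refine ⟨n', D', ?_, ?_, ?_⟩
    · rintro rfl; simp at hn'; exact hα hn'
    · have hb := EuclideanDomain.gcd_eq_gcd_ab α α₁
      change g = _ at hb
      refine ⟨EuclideanDomain.gcdA α α₁, EuclideanDomain.gcdB α α₁, ?_⟩
      apply mul_left_cancel₀ hg
      rw [mul_one]
      conv_rhs => rw [hb]
      nth_rw 3 [hn']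
      nth_rw 4 [hD']
      ring
    · apply FE_coprime h0 h1 m g _ _ hg
      rw [← hn', ← hD']; exact H
  have hcop : ∀ c, Q.eval c = 0 → P.eval c ≠ 0 := by
    intro c hc hPc
    obtain ⟨a, b, hab⟩ := hcop
    have := congrArg (eval c) hab
    simp [hc, hPc] at this
  have hA := FE_stepA h0 h1 m Q P hQ hcop H
  have h4 : (4 : L) ≠ 0 := by norm_num
  have m1 : (X ^ 2 - C lam : L[X]) ≠ 0 := X_pow_sub_C_ne_zero (by norm_num) _
  have m2 : (X ^ 2 - 2 * X + C lam : L[X]) ≠ 0 := by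
    intro h; have := congrArg (eval 0) h; simp at this; exact h0 this
  have m3 : (X ^ 2 - 2 * C lam * X + C lam : L[X]) ≠ 0 := by
    intro h; have := congrArg (eval 0) h; simp at this; exact h0 this
  have ne_of_sq : ∀ y z : L, y ^ 2 = z → z ≠ 0 → y ≠ 0 := by
    rintro y z rfl hz rfl; exact hz (by ring)
  have b0 : Q.eval 0 ≠ 0 := by
    apply FE_stepB h0 h1 m Q P hcop H hA 0 (X ^ 2 - C lam)
      ((X ^ 2 - 2 * X + C lam) * (X ^ 2 - 2 * C lam * X + C lam)) m1 (by simp only [sp]; ring)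
    · intro t x h; simpa using h
    · intro t h hf
      obtain ⟨e1, e2⟩ := X2_facts h
      simp only [eval_mul, eval_add, eval_sub, eval_pow, eval_X, eval_C, eval_ofNat]
      refine mul_ne_zero (ne_of_sq _ _ e1 ?_) (ne_of_sq _ _ e2 ?_)
      · exact mul_ne_zero (mul_ne_zero h4 hf) (by simp)
      · exact mul_ne_zero (mul_ne_zero h4 hf) (by simpa using h0)
  have b1 : Q.eval 1 ≠ 0 := by
    apply FE_stepB h0 h1 m Q P hcop H hA 1 (X ^ 2 - 2 * X + C lam)
      ((X ^ 2 - C lam) * (X ^ 2 - 2 * C lam * X + C lam)) m2 (by simp only [sp]; ring)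
    · intro t x h; simpa using (X2_facts h).1
    · intro t h hf
      obtain ⟨e1, e2⟩ := X2_facts h
      simp only [eval_mul, eval_add, eval_sub, eval_pow, eval_X, eval_C, eval_ofNat]
      refine mul_ne_zero (ne_of_sq _ _ h ?_) (ne_of_sq _ _ e2 ?_)
      · exact mul_ne_zero (mul_ne_zero h4 hf) (by simp)
      · exact mul_ne_zero (mul_ne_zero h4 hf) (sub_ne_zero.mpr h1.symm)
  have bl : Q.eval lam ≠ 0 := by
    apply FE_stepB h0 h1 m Q P hcop H hA lam (X ^ 2 - 2 * C lam * X + C lam)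
      ((X ^ 2 - C lam) * (X ^ 2 - 2 * X + C lam)) m3 (by simp only [sp]; ring)
    · intro t x h; simpa using (X2_facts h).2
    · intro t h hf
      obtain ⟨e1, e2⟩ := X2_facts h
      simp only [eval_mul, eval_add, eval_sub, eval_pow, eval_X, eval_C, eval_ofNat]
      refine mul_ne_zero (ne_of_sq _ _ h ?_) (ne_of_sq _ _ e1 ?_)
      · exact mul_ne_zero (mul_ne_zero h4 hf) h0
      · exact mul_ne_zero (mul_ne_zero h4 hf) (sub_ne_zero.mpr h1)
  have hroot : ∀ c, Q.eval c ≠ 0 := by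
    intro c hc
    have hf := hA c hc
    unfold fe at hf
    rcases mul_eq_zero.mp hf with hf | hf
    · rcases mul_eq_zero.mp hf with hf | hf
      · rw [hf] at hc; exact b0 hc
      · rw [sub_eq_zero.mp hf] at hc; exact b1 hc
    · rw [sub_eq_zero.mp hf] at hc; exact bl hc
  obtain ⟨κ, hκ⟩ : ∃ u, Q = C u := by
    by_contra hne
    obtain ⟨c, hc⟩ := IsAlgClosed.exists_root Q (by
      intro hdeg
      exact hne ⟨_, eq_C_of_degree_eq_zero hdeg⟩)
    exact hroot c hc
  have hκ0 : κ ≠ 0 := by rintro rfl; simp at hκ; exact hQ hκ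
  have key : C m * qp lam * C κ * bp lam ^ P.natDegree + sp lam * star' lam P.natDegree P
      = bp lam ^ P.natDegree * pp lam * P := by
    apply poly_eq_off (lam := lam)
    intro t ht
    have hx : (t ^ 2 - lam) ^ 2 = 4 * fe lam t * ((t ^ 2 - lam) ^ 2 / (4 * fe lam t)) := by
      field_simp
    have E := H _ _ ht hx
    rw [hκ] at E
    simp only [eval_mul, eval_add, eval_pow, eval_C, qp_eval, sp_eval, pp_eval, bp_eval,
      star_eval le_rfl hx] at E ⊢
    apply mul_left_cancel₀ hκ0
    linear_combination (4 * fe lam t) ^ P.natDegree * E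
  have hP : P = 0 := by
    by_contra hP
    have E := congrArg (eval 0) key
    have hst : (star' lam P.natDegree P).eval 0 = P.leadingCoeff * (lam ^ 2) ^ P.natDegree := by
      rw [star', eval_finsetSum, Finset.sum_range_succ, Finset.sum_eq_zero]
      · simp [ap_eval]
      · intro i hi
        have : P.natDegree - i ≠ 0 := by
          have := Finset.mem_range.mp hi; omega
        simp [bp_eval, fe, this]
    simp only [eval_mul, eval_add, eval_pow, eval_C, qp_eval, sp_eval, pp_eval, hst] at E
    simp [fe, N6, h0, hP] at E
  rw [hP] at key
  have E : star' lam (natDegree (0 : L[X])) 0 = 0 := by simp [star']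
  rw [E] at key
  simp only [natDegree_zero, pow_zero, mul_one, mul_zero, add_zero] at key
  have hq : qp lam ≠ 0 := by
    intro hq
    have hd : derivative (ff lam) = 0 := by
      rcases mul_eq_zero.mp hq with h | h
      · exact absurd h (mul_ne_zero (by norm_num) (ff_ne lam))
      · exact h
    have := congrArg (eval 0) hd
    rw [ff'_eval] at this
    simp [fe'] at this
    exact h0 this
  exact mul_ne_zero (mul_ne_zero (C_ne_zero.mpr hm) hq) (C_ne_zero.mpr hκ0) key
end dens


section dens2
variable {L : Type} [Field L] [Algebra ℂ L]

lemma lin_natDegree {T : Type} [CommRing T] (p q : T) (n : ℕ) :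
    ((C p * X + C q : T[X]) ^ n).natDegree ≤ n := by
  have h1 : (C p * X + C q : T[X]).natDegree ≤ 1 := by compute_degree
  have := natDegree_pow_le_of_le n h1
  omega

lemma lin_coeff_top {T : Type} [CommRing T] (p q : T) (n : ℕ) :
    ((C p * X + C q : T[X]) ^ n).coeff n = p ^ n := by
  have h1 : (C p * X + C q : T[X]).natDegree ≤ 1 := by compute_degree
  have := coeff_pow_of_natDegree_le h1 (m := n)
  rw [mul_one] at this
  rw [this]; simp

lemma lin_coeff_snd {T : Type} [CommRing T] (p q : T) (n : ℕ) :
    ((C p * X + C q : T[X]) ^ (n + 1)).coeff n = (n + 1) * p ^ n * q := by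
  induction n with
  | zero => simp
  | succ n ih =>
    have h1 : (C p * X + C q : T[X]).natDegree ≤ 0 + 1 := by compute_degree
    have := coeff_mul_snd _ _ (lin_natDegree p q (n + 1)) h1
    rw [add_zero] at this
    rw [pow_succ, this, lin_coeff_top, ih]
    simp
    ring

/-- transformed polynomial -/
noncomputable def tF (lam : L) (N m : ℕ) (F : L[X][X]) : L[X][X] :=
  ∑ i ∈ Finset.range (m + 1),
    C (star' lam N (F.coeff i) * sp lam ^ (m - i)) * (C (pp lam) * X + C (qp lam)) ^ i

lemma tF_natDegree (lam : L) (N m : ℕ) (F : L[X][X]) : (tF lam N m F).natDegree ≤ m := by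
  apply natDegree_sum_le_of_forall_le
  intro i hi
  refine (natDegree_C_mul_le _ _).trans ((lin_natDegree _ _ _).trans ?_)
  simpa [Nat.lt_succ_iff] using hi

lemma tF_top (lam : L) (N m : ℕ) (F : L[X][X]) :
    (tF lam N m F).coeff m = star' lam N (F.coeff m) * pp lam ^ m := by
  rw [tF, finsetSum_coeff, Finset.sum_range_succ, Finset.sum_eq_zero]
  · rw [coeff_C_mul, lin_coeff_top]; simp
  · intro i hi
    have := Finset.mem_range.mp hi
    rw [coeff_C_mul, coeff_eq_zero_of_natDegree_lt (lt_of_le_of_lt (lin_natDegree _ _ _) this),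
      mul_zero]

lemma tF_snd (lam : L) (N m : ℕ) (F : L[X][X]) :
    (tF lam N (m + 1) F).coeff m = star' lam N (F.coeff (m + 1)) * ((m + 1) * pp lam ^ m * qp lam)
     + star' lam N (F.coeff m) * sp lam * pp lam ^ m := by
  rw [tF, finsetSum_coeff, Finset.sum_range_succ, Finset.sum_range_succ, Finset.sum_eq_zero]
  · rw [coeff_C_mul, lin_coeff_top, coeff_C_mul, lin_coeff_snd]; simp; ring
  · intro i hi
    have := Finset.mem_range.mp hi
    rw [coeff_C_mul, coeff_eq_zero_of_natDegree_lt (lt_of_le_of_lt (lin_natDegree _ _ _) this),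
      mul_zero]

lemma evalEval_sum (x u : L) (F : L[X][X]) {m : ℕ} (hm : F.natDegree ≤ m) :
    evalEval x u F = ∑ i ∈ Finset.range (m + 1), (F.coeff i).eval x * u ^ i := by
  rw [evalEval, eval_eq_sum_range' (Nat.lt_succ_of_le hm), eval_finsetSum]
  simp

lemma evRH (x u : L) (p : L[X][X]) : evalEval x u p = evalEvalRingHom x u p := rfl

lemma tF_eval {lam : L} {N m : ℕ} {F : L[X][X]} (hm : F.natDegree ≤ m)
    (hN : ∀ i, (F.coeff i).natDegree ≤ N) {p q : L × L} (h : Step lam p q) :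
    evalEval q.1 q.2 (tF lam N m F) =
      (4 * fe lam q.1) ^ N * N6 lam q.1 ^ m * evalEval p.1 p.2 F := by
  obtain ⟨h1, h2⟩ := h
  rw [evalEval_sum _ _ _ hm, tF, evRH, map_sum, Finset.mul_sum]
  apply Finset.sum_congr rfl
  intro i hi
  have hi : i ≤ m := by simpa [Nat.lt_succ_iff] using hi
  simp only [map_mul, map_pow, map_add, ← evRH, evalEval_C, evalEval_X,
    star_eval (hN i) h1, sp_eval, pp_eval, qp_eval]
  rw [← h2, mul_pow]
  obtain ⟨j, rfl⟩ := Nat.exists_eq_add_of_le hi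
  rw [Nat.add_sub_cancel_left, pow_add]
  ring

lemma density [IsAlgClosed L] {lam : L} (h0 : lam ≠ 0) (h1 : lam ≠ 1) (s : ℕ → L × L)
    (hinj : Function.Injective fun n => (s n).1)
    (hstep : ∀ n, Step lam (s n) (s (n + 1))) :
    ∀ (m : ℕ) (F : L[X][X]), F.natDegree ≤ m → (∀ n, evalEval (s n).1 (s n).2 F = 0) → F = 0 := by
  have hch : CharZero L := charZero_of_injective_algebraMap (algebraMap ℂ L).injective
  intro m
  induction m with
  | zero =>
    intro F hF hv
    rw [eq_C_of_natDegree_le_zero hF] at hv ⊢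
    simp only [evalEval_C] at hv
    rw [C_eq_zero]
    apply eq_zero_of_infinite_isRoot
    exact (Set.infinite_range_of_injective hinj).mono (by rintro _ ⟨n, rfl⟩; exact hv n)
  | succ m ih =>
    intro F hF hv
    by_contra hne
    have hdeg : F.natDegree = m + 1 := by
      by_contra hlt
      exact hne (ih F (by omega) hv)
    have hα : F.coeff (m + 1) ≠ 0 := by
      rw [← hdeg]; exact leadingCoeff_ne_zero.mpr hne
    set α := F.coeff (m + 1) with hαdef
    set α₁ := F.coeff m with hα₁def
    obtain ⟨N, hN⟩ : ∃ N, ∀ i, (F.coeff i).natDegree ≤ N := by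
      refine ⟨F.support.sup fun i => (F.coeff i).natDegree, fun i => ?_⟩
      by_cases hi : i ∈ F.support
      · exact Finset.le_sup (f := fun i => (F.coeff i).natDegree) hi
      · rw [notMem_support_iff.mp hi]; simp
    set w : L[X] := X - C (s 0).1
    have hw : w ≠ 0 := X_sub_C_ne_zero _
    have hpp : pp lam ≠ 0 := mul_ne_zero (by norm_num) (pow_ne_zero 2 (ff_ne lam))
    set H : L[X][X] := C (α * w) * tF lam N (m + 1) F
      - C (w * star' lam N α * pp lam ^ (m + 1)) * F with hH
    have hH0 : H = 0 := by
      apply ih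
      · rw [natDegree_le_iff_coeff_eq_zero]
        intro i hi
        rcases Nat.lt_or_ge (m + 1) i with h | h
        · rw [hH, coeff_sub, coeff_C_mul, coeff_C_mul,
            coeff_eq_zero_of_natDegree_lt (lt_of_le_of_lt (tF_natDegree _ _ _ _) h),
            coeff_eq_zero_of_natDegree_lt (lt_of_le_of_lt hF h)]
          simp
        · obtain rfl : i = m + 1 := by omega
          rw [hH, coeff_sub, coeff_C_mul, coeff_C_mul, tF_top, ← hαdef]
          ring
      · intro n
        rw [hH, evalEval_sub, evalEval_mul, evalEval_mul, hv n, mul_zero, sub_zero, evalEval_C]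
        cases n with
        | zero => simp [w]
        | succ n => rw [tF_eval hF hN (hstep n), hv]; simp
    have hc := congrArg (fun p => p.coeff m) hH0
    beta_reduce at hc
    rw [hH, coeff_sub, coeff_C_mul, coeff_C_mul, tF_snd, coeff_zero, ← hαdef, ← hα₁def] at hc
    have key : α * (((m : L[X]) + 1) * qp lam * star' lam N α + sp lam * star' lam N α₁)
        = star' lam N α * pp lam * α₁ := by
      apply mul_left_cancel₀ (mul_ne_zero hw (pow_ne_zero m hpp))
      linear_combination hc
    refine FE_false h0 h1 ((m : L) + 1) (by exact_mod_cast Nat.succ_ne_zero m) α α₁ hα ?_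
    intro t x ht hx
    have e := congrArg (eval t) key
    simp only [eval_mul, eval_add, eval_natCast, eval_one, qp_eval, sp_eval, pp_eval,
      star_eval (hN (m + 1)) hx, star_eval (hN m) hx, α, α₁] at e ⊢
    apply mul_left_cancel₀ (pow_ne_zero N (mul_ne_zero (by norm_num : (4 : L) ≠ 0) ht))
    linear_combination e

lemma exists_chain [IsAlgClosed L] (d : Derivation ℂ L L) {lam : L} (h0 : lam ≠ 0) (h1 : lam ≠ 1)
    (hd : d lam = 2 * lam * (1 - lam)) :
    ∃ s : ℕ → L × L, (s 0).1 ^ 2 = lam ∧ (∀ n, GoodPt d lam (s n)) ∧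
      ∀ n, Step lam (s n) (s (n + 1)) := by
  have hch : CharZero L := charZero_of_injective_algebraMap (algebraMap ℂ L).injective
  obtain ⟨μ, hμ⟩ := IsAlgClosed.exists_pow_nat_eq lam (n := 2) (by norm_num)
  have hμ0 : μ ≠ 0 := by rintro rfl; apply h0; rw [← hμ]; ring
  have hdμ : d μ = μ * (1 - μ ^ 2) := by
    have e := congrArg d hμ
    rw [Derivation.leibniz_pow, hd, ← hμ] at e
    simp at e
    apply mul_left_cancel₀ (mul_ne_zero (two_ne_zero (α := L)) hμ0)
    linear_combination e
  have hgood : GoodPt d lam (μ, -(2 * μ)⁻¹) := by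
    refine ⟨?_, ?_, ?_⟩
    · exact fe_ne_of_step h0 h1 (x := 0) (by simp [hμ])
    · simp only
      rw [hdμ, fe, ← hμ]; field_simp; ring
    · simp only
      have d2 : d 2 = 0 := by exact_mod_cast d.map_natCast 2
      rw [map_neg, Derivation.leibniz_inv, Derivation.leibniz, hdμ, d2, fe', ← hμ]
      simp only [smul_eq_mul]
      field_simp; ring
  choose g hg1 hg2 using exists_step d h0 h1 hd
  let s : ℕ → {p // GoodPt d lam p} := fun n => Nat.rec ⟨_, hgood⟩ (fun _ p => ⟨g p.1 p.2, hg1 _ _⟩) n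
  refine ⟨fun n => (s n).1, hμ, fun n => (s n).2, fun n => ?_⟩
  exact hg2 (s n).1 (s n).2

lemma chain_inj [CharZero L] (d : Derivation ℂ L L) {lam : L} 
    (s : ℕ → L × L) (hs0 : (s 0).1 ^ 2 = lam) (hgood : ∀ n, GoodPt d lam (s n))
    (hstep : ∀ n, Step lam (s n) (s (n + 1))) : Function.Injective fun n => (s n).1 := by
  have key : ∀ k a, (s a).1 = (s (a + k + 1)).1 → False := by
    intro k a
    induction a with
    | zero =>
      intro h
      have := (hstep k).1
      rw [show k + 1 = 0 + k + 1 by ring, ← h, hs0, sub_self] at this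
      have hk := (hgood k).1
      have h0 := (hgood 0).1
      have hz : (s k).1 = 0 := by
        have : 4 * fe lam (s 0).1 * (s k).1 = 0 := by rw [← this]; ring
        rcases mul_eq_zero.mp this with h | h
        · exact absurd h (mul_ne_zero (by norm_num) h0)
        · exact h
      apply hk; simp [fe, hz]
    | succ a ih =>
      intro h
      apply ih
      have e1 := (hstep a).1
      have e2 := (hstep (a + k + 1)).1
      rw [show a + k + 1 + 1 = a + 1 + k + 1 by ring, ← h] at e2
      exact mul_left_cancel₀ (mul_ne_zero (by norm_num : (4 : L) ≠ 0) (hgood (a + 1)).1)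
        (e1.symm.trans e2)
  intro a b h
  simp only at h
  rcases lt_trichotomy a b with hab | hab | hab
  · obtain ⟨k, rfl⟩ := Nat.exists_eq_add_of_lt hab
    exact (key k a h).elim
  · exact hab
  · obtain ⟨k, rfl⟩ := Nat.exists_eq_add_of_lt hab
    exact (key k b h.symm).elim
end dens2

lemma exists_poly_root (x : LL) : ∃ p : ℂ[X][X], p ≠ 0 ∧ eval₂ (iot : ℂ[X] →+* LL) x p = 0 := by
  have h1 : IsAlgebraic (FractionRing ℂ[X]) x := Algebra.IsAlgebraic.isAlgebraic x
  have h2 : IsAlgebraic ℂ[X] x := (IsFractionRing.isAlgebraic_iff ℂ[X] (FractionRing ℂ[X]) LL).mpr h1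
  obtain ⟨p, hp, e⟩ := h2
  exact ⟨p, hp, e⟩

lemma good3 : Good 3 := by
  obtain ⟨s, hs0, hgood, hstep⟩ := exists_chain dL lam_ne0 lam_ne1 dL_lam
  have hch : CharZero LL := charZero_of_injective_algebraMap (algebraMap ℂ LL).injective
  have hinj := chain_inj dL s hs0 hgood hstep
  refine ⟨ℂ[X][X][X], inferInstance, inferInstance, inferInstance, DR, X ^ 2, ?_, ?_,
    DD_mark _ _, const_R, ?_⟩
  · have f1 : Algebra.FiniteType ℂ ℂ[X] := inferInstance
    have f2 : Algebra.FiniteType ℂ ℂ[X][X] := Algebra.FiniteType.trans f1 inferInstance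
    exact Algebra.FiniteType.trans f2 inferInstance
  · rw [Polynomial.ringKrullDim_of_isNoetherianRing, Polynomial.ringKrullDim_of_isNoetherianRing,
      Polynomial.ringKrullDim_of_isNoetherianRing, ringKrullDim_eq_zero_of_field]
    rfl
  · intro y hy
    apply liftP_inj
    rw [map_zero]
    apply density lam_ne0 lam_ne1 s hinj hstep _ _ le_rfl
    intro n
    let φ : ℂ[X][X][X] →ₐ[ℂ] LL := (evA (s n).1 (s n).2).comp liftP
    have hφ : ∀ z, φ (DR z) = dL (φ z) := by
      intro z
      change evA _ _ (liftP (DR z)) = dL (evA _ _ (liftP z))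
      rw [liftP_DR, evA_DD]
      · rw [ff_eval]; exact (hgood n).2.1
      · rw [ff'_eval]; exact (hgood n).2.2
    have := hy (RingHom.ker φ) (by
        obtain ⟨p, hp, e⟩ := exists_poly_root (s n).1
        intro hbot
        have hmem : C p ∈ RingHom.ker φ := by
          rw [RingHom.mem_ker]
          change evalEval _ _ (liftP (C p)) = 0
          simp only [liftP, coe_mapAlgHom, map_C, evalEval_C]
          simpa [eval_map] using e
        rw [hbot] at hmem
        exact hp (C_eq_zero.mp hmem)) (RingHom.ker_isPrime _) (by
        intro z hz
        rw [RingHom.mem_ker] at hz ⊢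
        rw [hφ, hz, map_zero])
    exact this

lemma good_all (d : ℕ) (hd : 3 ≤ d) : Good d := by
  induction d, hd using Nat.le_induction with
  | base => exact good3
  | succ n _ ih => exact ih.succ


/-- For every `d ≥ 3` there is a complex affine algebra of Krull
dimension `d` with a derivation `δ` such that the constants of `(Frac R, δ)` are exactly
`ℂ` and the intersection of all nonzero prime differential ideals of `R` is zero. -/
theorem exists_differential_example (d : ℕ) (hd : 3 ≤ d) :
    Nonempty (DifferentialExample d) := by
  obtain ⟨R, _, _, _, δ, a, hft, hkd, _, hc, hp⟩ := good_all d hd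
  refine ⟨{ R := R, finiteType := hft, krullDim := hkd, δ := δ, constants_eq := hc,
            inf_prime_diff_ideals := ?_ }⟩
  rw [eq_bot_iff]
  intro y hy
  rw [Ideal.mem_bot]
  exact hp y (fun P h1 h2 h3 => (Ideal.mem_sInf.mp hy) ⟨h1, h2, h3⟩)
end

section
/- For every integer d ≥ 4 there exists a complex affine Poisson algebra (a finitely generated integral domain ℂ-algebra with a Poisson bracket) of Krull dimension d in which the zero ideal (0) is Poisson rational but not Poisson locally closed; in particular, the Poisson Dixmier-Moeglin equivalence fails for this algebra. -/
/-- `P` is Poisson locally closed if the intersection of all Poisson prime ideals strictly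
containing `P` is strictly larger than `P`. -/
def PoissonBracket.IsPoissonLocallyClosed {k A : Type*} [CommRing k] [CommRing A] [Algebra k A]
    (pb : PoissonBracket k A) (P : Ideal A) : Prop :=
  P < sInf {Q : Ideal A | Q.IsPrime ∧ pb.IsPoissonIdeal Q ∧ P < Q}

/-- A complex affine Poisson algebra of Krull dimension `d` in which the zero ideal is
Poisson rational but not Poisson locally closed (so that the Poisson Dixmier-Moeglin
equivalence fails). -/
structure PoissonCounterexample (d : ℕ) where
  A : Type
  [commRing : CommRing A]
  [isDomain : IsDomain A]
  [alg : Algebra ℂ A]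
  finiteType : Algebra.FiniteType ℂ A
  pb : PoissonBracket ℂ A
  krullDim : ringKrullDim A = d
  rational : pb.IsPoissonRational ⊥
  not_locallyClosed : ¬ pb.IsPoissonLocallyClosed ⊥

namespace PoissonCE

open MvPolynomial

/-- The index set of the variables: four basic variables and `r` auxiliary ones. -/
abbrev Idx (r : ℕ) := Fin 4 ⊕ Fin r

/-- The polynomial algebra. -/
abbrev Alg (r : ℕ) := MvPolynomial (Idx r) ℂ

/-- A transcendental complex number. -/
noncomputable def tau : ℂ := ((liouvilleNumber (2 : ℕ) : ℝ) : ℂ)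

lemma tau_transcendental : Transcendental ℤ tau := by
  have h := transcendental_liouvilleNumber (m := 2) le_rfl
  have := (transcendental_algebraMap_iff (R := ℤ) (S := ℝ) (A := ℂ)
    (a := liouvilleNumber (2 : ℕ)) (algebraMap ℝ ℂ).injective).2 h
  simpa [tau] using this

/-- Weights of the variables. -/
noncomputable def wt (r : ℕ) : Idx r → ℂ := Sum.elim (fun _ => 1) (fun j => tau ^ (j.val + 1))

/-- Weight of an exponent. -/
noncomputable def mwt {r : ℕ} (m : Idx r →₀ ℕ) : ℂ := ∑ i, (m i : ℂ) * wt r i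

/-- The degree of an exponent in the four basic variables. -/
def mdeg {r : ℕ} (m : Idx r →₀ ℕ) : ℕ := ∑ i : Fin 4, m (Sum.inl i)

lemma mwt_eq {r : ℕ} (m : Idx r →₀ ℕ) :
    mwt m = (mdeg m : ℂ) + ∑ j : Fin r, (m (Sum.inr j) : ℂ) * tau ^ (j.val + 1) := by
  simp [mwt, mdeg, wt, Fintype.sum_sum_type]

lemma mwt_inj {r : ℕ} {m m' : Idx r →₀ ℕ} (h : mwt m = mwt m') :
    mdeg m = mdeg m' ∧ ∀ j, m (Sum.inr j) = m' (Sum.inr j) := by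
  classical
  let p : (Idx r →₀ ℕ) → Polynomial ℤ := fun m =>
    Polynomial.C (mdeg m : ℤ) +
      ∑ j : Fin r, Polynomial.C (m (Sum.inr j) : ℤ) * Polynomial.X ^ (j.val + 1)
  have hp : ∀ m, Polynomial.aeval tau (p m) = mwt m := by
    intro m
    simp [p, mwt_eq]
  have h0 : p m - p m' = 0 := by
    apply transcendental_iff.1 tau_transcendental
    rw [map_sub, hp, hp, h, sub_self]
  have h1 : p m = p m' := sub_eq_zero.1 h0
  have hc0 : ∀ m, (p m).coeff 0 = (mdeg m : ℤ) := by
    intro m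
    simp [p, Polynomial.finsetSum_coeff, Polynomial.coeff_X_pow]
  have hcj : ∀ m (j : Fin r), (p m).coeff (j.val + 1) = (m (Sum.inr j) : ℤ) := by
    intro m j
    simp only [p, Polynomial.coeff_add, Polynomial.finsetSum_coeff, Polynomial.coeff_C_mul,
      Polynomial.coeff_X_pow]
    rw [Polynomial.coeff_C, if_neg (by omega), zero_add, Finset.sum_eq_single j]
    · simp
    · intro b _ hb
      have : ¬ (j.val + 1 = b.val + 1) := by
        intro hh
        exact hb (Fin.ext (by omega))
      rw [if_neg this, mul_zero]
    · simp
  constructor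
  · have := hc0 m
    rw [h1, hc0] at this
    exact_mod_cast this.symm
  · intro j
    have := hcj m j
    rw [h1, hcj] at this
    exact_mod_cast this.symm

/-- The weighted Euler derivation. -/
noncomputable def E (r : ℕ) : Derivation ℂ (Alg r) (Alg r) :=
  mkDerivation ℂ (fun i => C (wt r i) * X i)

/-- Variables. -/
noncomputable abbrev x (r : ℕ) (i : Fin 4) : Alg r := X (Sum.inl i)

/-- The main derivation on the generators. -/
noncomputable def Dgen (r : ℕ) : Idx r → Alg r :=
  Sum.elim (![x r 0 * (x r 1 ^ 2 + x r 2 ^ 2) - x r 3 * (x r 1 * x r 2),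
    x r 1 * (x r 0 ^ 2 + x r 2 ^ 2) - x r 3 * (x r 0 * x r 2),
    x r 2 * (x r 0 ^ 2 + x r 1 ^ 2) - x r 3 * (x r 0 * x r 1),
    x r 0 * x r 1 * x r 2]) (fun _ => 0)

/-- The main derivation. -/
noncomputable def D (r : ℕ) : Derivation ℂ (Alg r) (Alg r) := mkDerivation ℂ (Dgen r)

lemma E_x (r : ℕ) (i : Fin 4) : E r (x r i) = x r i := by
  simp [E, wt, mkDerivation_X]

lemma E_X (r : ℕ) (i : Idx r) : E r (X i) = C (wt r i) * X i := by
  simp [E, mkDerivation_X]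

lemma E_w (r : ℕ) (j : Fin r) :
    E r (X (Sum.inr j)) = C (tau ^ (j.val + 1)) * X (Sum.inr j) := by
  rw [E_X]; simp [wt]

lemma D_0 (r : ℕ) : D r (x r 0) = x r 0 * (x r 1 ^ 2 + x r 2 ^ 2) - x r 3 * (x r 1 * x r 2) := by
  simp [D, mkDerivation_X, Dgen]
lemma D_1 (r : ℕ) : D r (x r 1) = x r 1 * (x r 0 ^ 2 + x r 2 ^ 2) - x r 3 * (x r 0 * x r 2) := by
  simp [D, mkDerivation_X, Dgen]
lemma D_2 (r : ℕ) : D r (x r 2) = x r 2 * (x r 0 ^ 2 + x r 1 ^ 2) - x r 3 * (x r 0 * x r 1) := by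
  simp [D, mkDerivation_X, Dgen]
lemma D_3 (r : ℕ) : D r (x r 3) = x r 0 * x r 1 * x r 2 := by
  simp [D, mkDerivation_X, Dgen]
lemma D_w (r : ℕ) (j : Fin r) : D r (X (Sum.inr j)) = 0 := by
  simp [D, mkDerivation_X, Dgen]

/-- Identities between derivations along a homomorphism are checked on generators. -/
lemma tw {σ : Type} (φ : MvPolynomial σ ℂ →ₐ[ℂ] MvPolynomial σ ℂ)
    (D₁ D₂ D₃ : Derivation ℂ (MvPolynomial σ ℂ) (MvPolynomial σ ℂ)) (a b c : MvPolynomial σ ℂ)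
    (h : ∀ i, a * D₁ (φ (X i)) = b * φ (D₂ (X i)) + c * φ (D₃ (X i))) (f : MvPolynomial σ ℂ) :
    a * D₁ (φ f) = b * φ (D₂ f) + c * φ (D₃ f) := by
  induction f using MvPolynomial.induction_on with
  | C t =>
    have h0 : ∀ d : Derivation ℂ (MvPolynomial σ ℂ) (MvPolynomial σ ℂ),
        d (C t) = 0 := fun d => d.map_algebraMap t
    have h1 : φ (C t) = C t := φ.commutes t
    rw [h1, h0, h0, h0]; simp
  | add p q hp hq =>
    simp only [map_add]
    linear_combination hp + hq
  | mul_X p i hp =>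
    simp only [map_mul, Derivation.leibniz, smul_eq_mul, map_add]
    linear_combination (φ (X i)) * hp + (φ p) * h i

lemma ED (r : ℕ) (f : Alg r) : E r (D r f) = D r (E r f) + 2 * D r f := by
  induction f using MvPolynomial.induction_on with
  | C t =>
    have h0 : ∀ d : Derivation ℂ (Alg r) (Alg r), d (C t) = 0 := fun d => d.map_algebraMap t
    simp [h0]
  | add p q hp hq =>
    simp only [map_add]
    linear_combination hp + hq
  | mul_X p i hp =>
    have h0 : ∀ (d : Derivation ℂ (Alg r) (Alg r)) t, d (C t) = 0 := fun d t => d.map_algebraMap t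
    have key : E r (D r (X i)) = D r (E r (X i)) + 2 * D r (X i) := by
      rcases i with i | j
      · rw [E_x]
        fin_cases i
        · simp only [Fin.zero_eta, D_0, map_sub, map_add, Derivation.leibniz, smul_eq_mul,
            Derivation.leibniz_pow, E_x]
          simp; ring
        · simp only [Fin.mk_one, D_1, map_sub, map_add, Derivation.leibniz, smul_eq_mul,
            Derivation.leibniz_pow, E_x]
          simp; ring
        · simp only [Fin.reduceFinMk, D_2, map_sub, map_add, Derivation.leibniz, smul_eq_mul,
            Derivation.leibniz_pow, E_x]
          simp; ring
        · simp only [Fin.reduceFinMk, D_3, map_sub, map_add, Derivation.leibniz, smul_eq_mul,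
            Derivation.leibniz_pow, E_x]
          ring
      · rw [E_w, D_w]; simp [D_w, h0]
    simp only [Derivation.leibniz, smul_eq_mul, map_add]
    rw [key, hp]
    ring

/-- The Poisson bracket `E ∧ D`. -/
noncomputable def pb (r : ℕ) : PoissonBracket ℂ (Alg r) where
  br := LinearMap.mk₂ ℂ (fun f g => E r f * D r g - D r f * E r g)
    (by intros; simp only [map_add]; ring)
    (by intros; simp only [Derivation.map_smul, smul_mul_assoc, smul_sub])
    (by intros; simp only [map_add]; ring)
    (by intros; simp only [Derivation.map_smul, mul_smul_comm, smul_sub])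
  antisymm := by intro a b; simp only [LinearMap.mk₂_apply]; ring
  jacobi := by
    intro a b c
    simp only [LinearMap.mk₂_apply, map_sub, Derivation.leibniz, smul_eq_mul, ED]
    ring
  leibniz := by
    intro a b c
    simp only [LinearMap.mk₂_apply, Derivation.leibniz, smul_eq_mul]
    ring

lemma pb_apply (r : ℕ) (f g : Alg r) : (pb r).br f g = E r f * D r g - D r f * E r g := rfl

/-- A diagonal derivation. -/
noncomputable def Eg {r : ℕ} (v : Idx r → ℂ) : Derivation ℂ (Alg r) (Alg r) :=
  mkDerivation ℂ (fun i => C (v i) * X i)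

lemma Eg_monomial {r : ℕ} (v : Idx r → ℂ) (m : Idx r →₀ ℕ) :
    Eg v (monomial m 1) = C (∑ i, (m i : ℂ) * v i) * monomial m 1 := by
  induction m using Finsupp.induction_linear with
  | zero =>
    have : (monomial 0 1 : Alg r) = 1 := rfl
    rw [this]; simp
  | add m n hm hn =>
    have : (monomial (m + n) 1 : Alg r) = monomial m 1 * monomial n 1 := by
      rw [monomial_mul, one_mul]
    rw [this, Derivation.leibniz, hm, hn]
    simp only [Finsupp.add_apply, Nat.cast_add, add_mul, Finset.sum_add_distrib, C_add, smul_eq_mul]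
    ring
  | single a n =>
    rw [← X_pow_eq_monomial, Derivation.leibniz_pow, Finset.sum_eq_single a]
    · rcases n with _ | n
      · simp
      · simp [Eg, mkDerivation_X, pow_succ]; ring
    · intro b _ hb
      rw [Finsupp.single_eq_of_ne hb]; simp
    · simp

lemma coeff_Eg {r : ℕ} (v : Idx r → ℂ) (f : Alg r) (m : Idx r →₀ ℕ) :
    coeff m (Eg v f) = (∑ i, (m i : ℂ) * v i) * coeff m f := by
  induction f using MvPolynomial.induction_on' with
  | monomial u a =>
    have h : (monomial u a : Alg r) = a • monomial u 1 := by simp [smul_monomial]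
    rw [h, Derivation.map_smul, Eg_monomial, coeff_smul, coeff_smul, coeff_C_mul]
    by_cases hu : u = m
    · subst hu; simp; ring
    · simp [coeff_monomial, hu]
  | add p q hp hq => rw [map_add, coeff_add, hp, hq, coeff_add]; ring

lemma coeff_E {r : ℕ} (f : Alg r) (m : Idx r →₀ ℕ) :
    coeff m (E r f) = mwt m * coeff m f := coeff_Eg (wt r) f m

lemma mwt_of_E {r : ℕ} {f : Alg r} {e : ℂ} (h : E r f = C e * f) {m : Idx r →₀ ℕ}
    (hm : coeff m f ≠ 0) : mwt m = e := by
  have := coeff_E f m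
  rw [h, coeff_C_mul] at this
  exact (mul_right_cancel₀ hm this).symm

/-- Degree in the fourth variable. -/
lemma degreeOf_D {r : ℕ} (f : Alg r) :
    degreeOf (Sum.inl 3) (D r f) ≤ degreeOf (Sum.inl 3) f + 1 := by
  have hx : ∀ i : Fin 4, i ≠ 3 → degreeOf (Sum.inl 3) (x r i) ≤ 0 := by
    intro i hi
    rw [degreeOf_X, if_neg]
    intro h; exact hi (Sum.inl.inj h).symm
  have hx3 : degreeOf (Sum.inl 3) (x r 3) ≤ 1 := by
    rw [degreeOf_X_self]
  have h0 := hx 0 (by decide)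
  have h1 := hx 1 (by decide)
  have h2 := hx 2 (by decide)
  have hmul : ∀ (p q : Alg r) (a b : ℕ), degreeOf (Sum.inl 3) p ≤ a → degreeOf (Sum.inl 3) q ≤ b →
      degreeOf (Sum.inl 3) (p * q) ≤ a + b := fun p q a b hp hq =>
    (degreeOf_mul_le _ _ _).trans (add_le_add hp hq)
  have hadd : ∀ (p q : Alg r) (a b : ℕ), degreeOf (Sum.inl 3) p ≤ a → degreeOf (Sum.inl 3) q ≤ b →
      degreeOf (Sum.inl 3) (p + q) ≤ max a b := fun p q a b hp hq =>
    (degreeOf_add_le _ _ _).trans (max_le_max hp hq)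
  have hsub : ∀ (p q : Alg r) (a b : ℕ), degreeOf (Sum.inl 3) p ≤ a → degreeOf (Sum.inl 3) q ≤ b →
      degreeOf (Sum.inl 3) (p - q) ≤ max a b := fun p q a b hp hq =>
    (degreeOf_sub_le _ _ _).trans (max_le_max hp hq)
  have hform : ∀ a b c : Alg r, degreeOf (Sum.inl 3) a ≤ 0 → degreeOf (Sum.inl 3) b ≤ 0 →
      degreeOf (Sum.inl 3) c ≤ 0 →
      degreeOf (Sum.inl 3) (a * (b ^ 2 + c ^ 2) - x r 3 * (b * c)) ≤ 1 := by
    intro a b c ha hb hc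
    have hb2 := hmul _ _ _ _ hb hb
    have hc2 := hmul _ _ _ _ hc hc
    rw [sq, sq]
    exact (hsub _ _ _ _ (hmul _ _ _ _ ha (hadd _ _ _ _ hb2 hc2))
      (hmul _ _ _ _ hx3 (hmul _ _ _ _ hb hc))).trans (by decide)
  have hg : ∀ l, degreeOf (Sum.inl 3) (Dgen r l) ≤ 1 := by
    rintro (l | l)
    · fin_cases l
      · exact hform _ _ _ h0 h1 h2
      · exact hform _ _ _ h1 h0 h2
      · exact hform _ _ _ h2 h0 h1
      · exact (hmul _ _ _ _ (hmul _ _ _ _ h0 h1) h2).trans (by decide)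
    · simp [Dgen]
  conv_lhs => rw [f.as_sum, map_sum]
  refine (degreeOf_sum_le _ _ _).trans (Finset.sup_le ?_)
  intro m hm
  have hmz : m (Sum.inl 3) ≤ degreeOf (Sum.inl 3) f := le_degreeOf_of_mem_support _ hm
  rw [D, mkDerivation_monomial, Finsupp.smul_sum]
  refine (degreeOf_sum_le _ _ _).trans (Finset.sup_le ?_)
  intro l _
  change degreeOf (Sum.inl 3) (coeff m f • ((monomial (m - Finsupp.single l 1)) (m l : ℂ) * Dgen r l)) ≤ _
  rw [smul_eq_C_mul]
  refine (degreeOf_C_mul_le _ _ _).trans ?_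
  refine hmul _ _ _ _ ?_ (hg l)
  by_cases hl : (m l : ℂ) = 0
  · rw [hl]; simp
  · rw [degreeOf_monomial_eq _ _ hl]
    refine le_trans ?_ hmz
    simp

/-- Exponents of degree two in the basic variables. -/
lemma deg_two {r : ℕ} {m : Idx r →₀ ℕ} (h : mdeg m = 2) (hw : ∀ j, m (Sum.inr j) = 0) :
    ∃ a b : Idx r, m = Finsupp.single a 1 + Finsupp.single b 1 := by
  have hstep : ∀ (k : ℕ) (m : Idx r →₀ ℕ), mdeg m = k + 1 → (∀ j, m (Sum.inr j) = 0) →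
      ∃ (a : Idx r) (m' : Idx r →₀ ℕ), m = Finsupp.single a 1 + m' ∧ mdeg m' = k ∧
        ∀ j, m' (Sum.inr j) = 0 := by
    intro k m h hw
    obtain ⟨i, -, hi⟩ : ∃ i ∈ (Finset.univ : Finset (Fin 4)), m (Sum.inl i) ≠ 0 := by
      apply Finset.exists_ne_zero_of_sum_ne_zero
      change mdeg m ≠ 0
      omega
    have hle : Finsupp.single (Sum.inl i) 1 ≤ m := by
      rw [Finsupp.single_le_iff]; omega
    obtain ⟨m', rfl⟩ := exists_add_of_le hle
    refine ⟨Sum.inl i, m', rfl, ?_, ?_⟩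
    · have : mdeg (Finsupp.single (Sum.inl i) 1 + m') = 1 + mdeg m' := by
        simp only [mdeg, Finsupp.add_apply, Finset.sum_add_distrib]
        congr 1
        rw [Finset.sum_eq_single i]
        · simp
        · intro b _ hb
          rw [Finsupp.single_eq_of_ne]
          intro hh; exact hb (Sum.inl.inj hh)
        · simp
      omega
    · intro j
      have := hw j
      simpa using this
  obtain ⟨a, m', rfl, h', hw'⟩ := hstep 1 m h hw
  obtain ⟨b, m'', rfl, h'', hw''⟩ := hstep 0 m' h' hw'
  refine ⟨a, b, ?_⟩
  have : m'' = 0 := by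
    ext i
    rcases i with i | j
    · exact (Finset.sum_eq_zero_iff.1 h'') i (Finset.mem_univ _)
    · exact hw'' j
  rw [this, add_zero]

/-- Parallelogram law for quadratic forms. -/
lemma parallelogram {r : ℕ} (c : Alg r)
    (hc : ∀ m, coeff m c ≠ 0 → mdeg m = 2 ∧ ∀ j, m (Sum.inr j) = 0) (u v : Idx r → ℂ) :
    eval (u + v) c + eval (u - v) c = 2 * eval u c + 2 * eval v c := by
  rw [c.as_sum]
  simp only [map_sum]
  rw [← Finset.sum_add_distrib, Finset.mul_sum, Finset.mul_sum, ← Finset.sum_add_distrib]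
  refine Finset.sum_congr rfl fun m hm => ?_
  obtain ⟨h1, h2⟩ := hc m (mem_support_iff.1 hm)
  obtain ⟨a, b, hab⟩ := deg_two h1 h2
  have : (monomial m (coeff m c) : Alg r) = C (coeff m c) * (X a * X b) := by
    rw [hab, X, X, monomial_mul, C_mul_monomial]; simp
  rw [this]
  simp only [map_mul, eval_C, eval_X, Pi.add_apply, Pi.sub_apply]
  ring

lemma sub_mem_of_gen {r : ℕ} (I : Ideal (Alg r)) (g : Alg r →ₐ[ℂ] Alg r)
    (h : ∀ l, g (X l) - X l ∈ I) (f : Alg r) : g f - f ∈ I := by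
  have : (Ideal.Quotient.mkₐ ℂ I).comp g = Ideal.Quotient.mkₐ ℂ I := by
    apply MvPolynomial.algHom_ext
    intro l
    exact Ideal.Quotient.eq.2 (h l)
  exact Ideal.Quotient.eq.1 (DFunLike.congr_fun this f)

/-- Points with prescribed basic coordinates. -/
def pt4 (r : ℕ) (v : Fin 4 → ℂ) : Idx r → ℂ := Sum.elim v (fun _ => 0)

lemma restrict {r : ℕ} (i j k : Fin 4) (hij : i ≠ j) (hik : i ≠ k) (hjk : j ≠ k)
    (hi3 : i ≠ 3) (hj3 : j ≠ 3) (hk3 : k ≠ 3) (hall : ∀ l, l = i ∨ l = j ∨ l = k ∨ l = 3)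
    (hDi : D r (x r i) = x r i * (x r j ^ 2 + x r k ^ 2) - x r 3 * (x r j * x r k))
    (hDj : D r (x r j) = x r j * (x r i ^ 2 + x r k ^ 2) - x r 3 * (x r i * x r k))
    (hDk : D r (x r k) = x r k * (x r i ^ 2 + x r j ^ 2) - x r 3 * (x r i * x r j))
    (hD3 : D r (x r 3) = x r i * x r j * x r k)
    (ε : ℂ) (hε : ε ^ 2 = 1) (f c : Alg r) (N : ℂ)
    (hE : Eg (Sum.elim (fun _ => 1) (fun _ => 0)) f = C N * f) (hD : D r f = c * f)
    (hL : ¬ (x r j - C ε * x r i ∣ f)) (v : Fin 4 → ℂ) (hvj : v j = ε * v i)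
    (hv3 : v 3 = ε * v k) : eval (pt4 r v) c = N * v i ^ 2 := by
  classical
  let ψ : Alg r →ₐ[ℂ] Alg r := aeval (Sum.elim (fun l => if l = j then C ε * x r i else
    if l = 3 then C ε * x r k - x r 3 else x r l) (fun l => X (Sum.inr l)))
  let χ : Alg r →ₐ[ℂ] Alg r := aeval (Sum.elim (fun l => 
    if l = 3 then C ε * x r k - x r 3 else x r l) (fun l => X (Sum.inr l)))
  let nab : Derivation ℂ (Alg r) (Alg r) := mkDerivation ℂ (Sum.elim
    (fun l => if l = i then C ε * x r k else if l = k then C ε * x r i else 0) (fun _ => 0))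
  have hC : (C ε : Alg r) ^ 2 = 1 := by rw [← C_pow, hε, C_1]
  have ψC : ∀ a, ψ (C a) = C a := fun a => ψ.commutes a
  have χC : ∀ a, χ (C a) = C a := fun a => χ.commutes a
  have nabC : ∀ a, nab (C a) = 0 := fun a => nab.map_algebraMap a
  have ψi : ψ (x r i) = x r i := by simp [ψ, x, hij, hi3]
  have ψj : ψ (x r j) = C ε * x r i := by simp [ψ, x]
  have ψk : ψ (x r k) = x r k := by simp [ψ, x, hjk.symm, hk3]
  have ψ3 : ψ (x r 3) = C ε * x r k - x r 3 := by simp [ψ, x, hj3.symm]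
  have ψw : ∀ l, ψ (X (Sum.inr l)) = X (Sum.inr l) := by simp [ψ]
  have χi : χ (x r i) = x r i := by simp [χ, x, hi3]
  have χj : χ (x r j) = x r j := by simp [χ, x, hj3]
  have χk : χ (x r k) = x r k := by simp [χ, x, hk3]
  have χ3 : χ (x r 3) = C ε * x r k - x r 3 := by simp [χ, x]
  have χw : ∀ l, χ (X (Sum.inr l)) = X (Sum.inr l) := by simp [χ]
  have ni : nab (x r i) = C ε * x r k := by simp [nab, x, mkDerivation_X]
  have nk : nab (x r k) = C ε * x r i := by simp [nab, x, mkDerivation_X, hik.symm]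
  have n3 : nab (x r 3) = 0 := by simp [nab, x, mkDerivation_X, hi3.symm, hk3.symm]
  have nw : ∀ l, nab (X (Sum.inr l)) = 0 := by simp [nab, mkDerivation_X]
  have Ex : ∀ l, Eg (r := r) (Sum.elim (fun _ => 1) (fun _ => 0)) (x r l) = x r l := by
    intro l; simp [Eg, mkDerivation_X]
  have Ew : ∀ l, Eg (r := r) (Sum.elim (fun _ => 1) (fun _ => 0)) (X (Sum.inr l)) = 0 := by
    intro l; simp [Eg, mkDerivation_X]
  -- nonvanishing
  have hψf : ψ f ≠ 0 := by
    intro h0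
    apply hL
    rw [← Ideal.mem_span_singleton]
    have := sub_mem_of_gen (Ideal.span {x r j - C ε * x r i}) (χ.comp ψ) ?_ f
    · rw [AlgHom.comp_apply, h0, map_zero, zero_sub] at this
      exact neg_mem_iff.1 this
    · rintro (l | l)
      · rcases hall l with rfl | rfl | rfl | rfl
        · simp [ψi, χi]
        · rw [AlgHom.comp_apply, ψj, map_mul, χC, χi]
          rw [← neg_mem_iff, neg_sub]
          exact Ideal.mem_span_singleton_self _
        · simp [ψk, χk]
        · rw [AlgHom.comp_apply, ψ3, map_sub, map_mul, χC, χk, χ3]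
          simp
      · simp [ψw, χw]
  -- main identity
  have key := tw ψ nab (D r) (Eg (Sum.elim (fun _ => 1) (fun _ => 0))) (x r 3 * x r i) 1
    (- x r i ^ 2) (by
      rintro (l | l)
      · rcases hall l with rfl | rfl | rfl | rfl
        · rw [Ex, hDi]
          simp only [map_sub, map_mul, map_add, map_pow, ψi, ψj, ψk, ψ3, ni]
          linear_combination (-(x r l) ^ 3 + x r l * x r k ^ 2) * hC
        · rw [Ex, hDj]
          simp only [map_sub, map_mul, map_add, map_pow, ψi, ψj, ψk, ψ3, Derivation.leibniz,
            smul_eq_mul, nabC, ni]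
          linear_combination (x r 3 * x r i * x r k) * hC
        · rw [Ex, hDk]
          simp only [map_sub, map_mul, map_add, map_pow, ψi, ψj, ψk, ψ3, nk]
          linear_combination (0 : Alg r) * hC
        · rw [Ex, hD3]
          simp only [map_sub, map_mul, map_add, map_pow, ψi, ψj, ψk, ψ3, Derivation.leibniz,
            smul_eq_mul, nabC, nk, n3]
          linear_combination (x r 3 * x r i ^ 2) * hC
      · rw [Ew, D_w, ψw, nw]; simp) f
  rw [hE, hD, map_mul, map_mul, ψC] at key
  have hprime : Prime (x r 3) := MvPolynomial.X_prime
  obtain ⟨h, hh, hhd⟩ :=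
    (FiniteMultiplicity.of_prime_left hprime hψf).exists_eq_pow_mul_and_not_dvd
  set b := multiplicity (x r 3) (ψ f)
  have hnab : nab (ψ f) = x r 3 ^ b * nab h := by
    rw [hh, Derivation.leibniz, Derivation.leibniz_pow, n3]; simp
  have key2 : x r 3 * (x r i * nab h) = (ψ c - C N * x r i ^ 2) * h := by
    have hb : x r 3 ^ b ≠ 0 := pow_ne_zero _ hprime.ne_zero
    apply mul_left_cancel₀ hb
    rw [hnab, hh] at key
    linear_combination key
  have hdvd : x r 3 ∣ ψ c - C N * x r i ^ 2 :=
    (hprime.dvd_or_dvd (Dvd.intro _ key2)).resolve_right hhd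
  -- evaluation
  let v' : Fin 4 → ℂ := fun l => if l = 3 then 0 else v l
  obtain ⟨q, hq⟩ := hdvd
  have h1 := congrArg (eval (pt4 r v')) hq
  have h2 : eval (pt4 r v') (ψ c) = eval (pt4 r v) c := by
    have : ((aeval (pt4 r v') : Alg r →ₐ[ℂ] ℂ)).comp ψ = aeval (pt4 r v) := by
      apply MvPolynomial.algHom_ext
      rintro (l | l)
      · rcases hall l with rfl | rfl | rfl | rfl
        · rw [AlgHom.comp_apply, ψi]; simp [pt4, v', hi3]
        · rw [AlgHom.comp_apply, ψj]; simp [pt4, v', hi3, hvj]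
        · rw [AlgHom.comp_apply, ψk]; simp [pt4, v', hk3]
        · rw [AlgHom.comp_apply, ψ3]; simp [pt4, v', hk3, hv3]
      · rw [AlgHom.comp_apply, ψw]; simp [pt4]
    exact DFunLike.congr_fun this c
  have h3 : v' 3 = 0 := by simp [v']
  have h4 : v' i = v i := by simp [v', hi3]
  rw [map_sub, h2] at h1
  simp only [map_mul, map_pow, eval_C, eval_X] at h1
  simp only [pt4, Sum.elim_inl, h3, h4, zero_mul] at h1
  exact sub_eq_zero.1 h1

/-- Index of the first variable of a linear form. -/
def LI : Fin 3 → Fin 4 := ![0, 1, 0]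
/-- Index of the second variable of a linear form. -/
def LJ : Fin 3 → Fin 4 := ![1, 2, 2]
/-- Index of the remaining variable. -/
def LK : Fin 3 → Fin 4 := ![2, 0, 1]
/-- A sign. -/
noncomputable def sgn (s : Bool) : ℂ := if s then 1 else -1

lemma sgn_sq (s : Bool) : sgn s ^ 2 = 1 := by cases s <;> simp [sgn]

/-- The six linear forms. -/
noncomputable def Lf (r : ℕ) (t : Fin 3 × Bool) : Alg r :=
  x r (LJ t.1) - C (sgn t.2) * x r (LI t.1)

lemma restrict' {r : ℕ} (t : Fin 3) (s : Bool) (f c : Alg r) (N : ℂ)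
    (hE : Eg (Sum.elim (fun _ => 1) (fun _ => 0)) f = C N * f) (hD : D r f = c * f)
    (hL : ¬ (Lf r (t, s) ∣ f)) (v : Fin 4 → ℂ) (hvj : v (LJ t) = sgn s * v (LI t))
    (hv3 : v 3 = sgn s * v (LK t)) : eval (pt4 r v) c = N * v (LI t) ^ 2 := by
  have h0 := D_0 r
  have h1 := D_1 r
  have h2 := D_2 r
  have h3 := D_3 r
  refine restrict (LI t) (LJ t) (LK t) ?_ ?_ ?_ ?_ ?_ ?_ ?_ ?_ ?_ ?_ ?_ (sgn s) (sgn_sq s) f c N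
    hE hD hL v hvj hv3
  · clear hL hvj hv3; revert t; decide
  · clear hL hvj hv3; revert t; decide
  · clear hL hvj hv3; revert t; decide
  · clear hL hvj hv3; revert t; decide
  · clear hL hvj hv3; revert t; decide
  · clear hL hvj hv3; revert t; decide
  · clear hL hvj hv3; revert t; decide
  all_goals
    clear hE hD hL hvj hv3
    fin_cases t <;> simp only [LI, LJ, LK] <;> simp [h0, h1, h2, h3] <;> ring

lemma darboux {r : ℕ} (f c : Alg r) (e : ℂ) (hf : f ≠ 0) (hE : E r f = C e * f)
    (hD : D r f = c * f) :
    (∃ j, X (Sum.inr j) ∣ f) ∨ (∃ t, Lf r t ∣ f) ∨ ∃ a, f = C a := by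
  obtain ⟨m0, hm0⟩ := ne_zero_iff.1 hf
  have hall : ∀ m, coeff m f ≠ 0 → mdeg m = mdeg m0 ∧ ∀ j, m (Sum.inr j) = m0 (Sum.inr j) :=
    fun m hm => mwt_inj ((mwt_of_E hE hm).trans (mwt_of_E hE hm0).symm)
  by_cases hw : ∃ j, m0 (Sum.inr j) ≠ 0
  · obtain ⟨j, hj⟩ := hw
    left
    refine ⟨j, ?_⟩
    rw [f.as_sum]
    refine Finset.dvd_sum fun m hm => ?_
    rw [X_dvd_monomial]
    right
    rw [(hall m (mem_support_iff.1 hm)).2]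
    exact hj
  right
  push Not at hw
  by_contra hcon
  push Not at hcon
  obtain ⟨hL, hconst⟩ := hcon
  have hE4 : Eg (Sum.elim (fun _ => 1) (fun _ => 0)) f = C (mdeg m0 : ℂ) * f := by
    ext m
    rw [coeff_Eg, coeff_C_mul]
    by_cases hm : coeff m f = 0
    · rw [hm, mul_zero, mul_zero]
    · congr 1
      rw [← (hall m hm).1]
      simp [Fintype.sum_sum_type, mdeg]
  have hEc : E r c = C 2 * c := by
    have h := ED r f
    rw [hE, hD, Derivation.leibniz, Derivation.leibniz, hE, hD] at h
    have h0 : D r (C e) = 0 := (D r).map_algebraMap e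
    have h2 : (C 2 : Alg r) = 2 := rfl
    rw [h2]
    rw [h0] at h
    simp only [smul_eq_mul] at h
    apply mul_right_cancel₀ hf
    linear_combination h
  have hc : ∀ m, coeff m c ≠ 0 → mdeg m = 2 ∧ ∀ j, m (Sum.inr j) = 0 := by
    intro m hm
    have h1 := mwt_of_E hEc hm
    have h2 : mwt (Finsupp.single (Sum.inl 0) 2 : Idx r →₀ ℕ) = 2 := by
      rw [mwt_eq]; simp [mdeg, Fin.sum_univ_four]
    have := mwt_inj (h1.trans h2.symm)
    simpa [mdeg, Fin.sum_univ_four] using this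
  let e4 : Fin 4 → Idx r → ℂ := fun i => pt4 r (Pi.single i 1)
  have hadd : ∀ u v, pt4 r (u + v) = pt4 r u + pt4 r v := by
    intro u v; ext (i | i) <;> simp [pt4]
  have hsub : ∀ u v, pt4 r (u - v) = pt4 r u - pt4 r v := by
    intro u v; ext (i | i) <;> simp [pt4]
  have hpar : ∀ i j, eval (pt4 r (Pi.single i 1 + Pi.single j 1)) c +
      eval (pt4 r (Pi.single i 1 - Pi.single j 1)) c = 2 * eval (e4 i) c + 2 * eval (e4 j) c := by
    intro i j
    rw [hadd, hsub]; exact parallelogram c hc _ _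
  have hA : ∀ t, eval (e4 (LI t)) c + eval (e4 (LJ t)) c = mdeg m0 := by
    intro t
    have hne : LI t ≠ LJ t ∧ LI t ≠ LK t ∧ LJ t ≠ LK t ∧ LI t ≠ 3 ∧ LJ t ≠ 3 ∧ LK t ≠ 3 := by
      revert t; decide
    obtain ⟨n1, n2, n3, n4, n5, n6⟩ := hne
    have h1 := restrict' t true f c _ hE4 hD (hL _) (Pi.single (LI t) 1 + Pi.single (LJ t) 1)
      (by simp [sgn, n1, n1.symm]) (by simp [sgn, n2.symm, n3.symm, n4.symm, n5.symm])
    have h2 := restrict' t false f c _ hE4 hD (hL _) (Pi.single (LI t) 1 - Pi.single (LJ t) 1)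
      (by simp [sgn, n1, n1.symm]) (by simp [sgn, n2.symm, n3.symm, n4.symm, n5.symm])
    have h3 := hpar (LI t) (LJ t)
    rw [h1, h2] at h3
    simp [n1] at h3
    linear_combination -h3 / 2
  have hB : ∀ t, eval (e4 (LK t)) c + eval (e4 3) c = 0 := by
    intro t
    have hne : LI t ≠ LJ t ∧ LI t ≠ LK t ∧ LJ t ≠ LK t ∧ LI t ≠ 3 ∧ LJ t ≠ 3 ∧ LK t ≠ 3 := by
      revert t; decide
    obtain ⟨n1, n2, n3, n4, n5, n6⟩ := hne
    have h1 := restrict' t true f c _ hE4 hD (hL _) (Pi.single (LK t) 1 + Pi.single 3 1)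
      (by simp [sgn, n2, n3, n4, n5]) (by simp [sgn, n6, n6.symm])
    have h2 := restrict' t false f c _ hE4 hD (hL _) (Pi.single (LK t) 1 - Pi.single 3 1)
      (by simp [sgn, n2, n3, n4, n5]) (by simp [sgn, n6, n6.symm])
    have h3 := hpar (LK t) 3
    rw [h1, h2] at h3
    simp [n2, n4] at h3
    linear_combination -h3 / 2
  have hz : eval (e4 3) c = 0 := by
    rw [eval_eq']
    refine Finset.sum_eq_zero fun m hm => ?_
    have hcm := mem_support_iff.1 hm
    have hc0 : c ≠ 0 := by rintro rfl; simp at hcm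
    have hdeg : m (Sum.inl 3) ≤ 1 := by
      have h1 := degreeOf_D f
      rw [hD, degreeOf_mul_eq hc0 hf] at h1
      have h2 := le_degreeOf_of_mem_support (Sum.inl 3) hm
      omega
    obtain ⟨h2, -⟩ := hc m hcm
    obtain ⟨i, hi, hi3⟩ : ∃ i : Fin 4, m (Sum.inl i) ≠ 0 ∧ i ≠ 3 := by
      by_contra hno
      push Not at hno
      have k0 : m (Sum.inl 0) = 0 := by by_contra h; exact absurd (hno 0 h) (by decide)
      have k1 : m (Sum.inl 1) = 0 := by by_contra h; exact absurd (hno 1 h) (by decide)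
      have k2 : m (Sum.inl 2) = 0 := by by_contra h; exact absurd (hno 2 h) (by decide)
      rw [mdeg, Fin.sum_univ_four] at h2
      omega
    rw [Finset.prod_eq_zero (Finset.mem_univ (Sum.inl i)), mul_zero]
    simp [e4, pt4, hi3, hi]
  have hN : (mdeg m0 : ℂ) = 0 := by
    have a := hA 0
    have b := hB 1
    have d := hB 2
    simp only [LI, LJ, LK] at a b d
    simp at a b d
    rw [hz, add_zero] at b d
    rw [← a, b, d, add_zero]
  have hN' : mdeg m0 = 0 := by exact_mod_cast hN
  apply hconst (coeff 0 f)
  ext m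
  rw [coeff_C]
  split_ifs with h
  · rw [h]
  · by_contra hm
    apply h
    obtain ⟨h1, h2⟩ := hall m hm
    ext i
    rcases i with i | j
    · rw [hN'] at h1
      exact ((Finset.sum_eq_zero_iff.1 h1) i (Finset.mem_univ _)).symm
    · rw [h2, hw]; rfl

lemma E_cofactor {r : ℕ} {f e' : Alg r} (hf : f ≠ 0) (h : E r f = e' * f) : ∃ e, e' = C e := by
  by_cases he : e' = 0
  · exact ⟨0, by simp [he]⟩
  have h1 : (E r f).totalDegree ≤ f.totalDegree := by
    apply totalDegree_le_of_support_subset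
    intro m hm
    rw [mem_support_iff] at hm ⊢
    rw [coeff_E] at hm
    exact right_ne_zero_of_mul hm
  rw [h, totalDegree_mul_of_isDomain he hf] at h1
  exact ⟨_, totalDegree_eq_zero_iff_eq_C.1 (by omega)⟩

lemma Lf_ne_zero (r : ℕ) (t : Fin 3 × Bool) : Lf r t ≠ 0 := by
  intro h
  have := congrArg (eval (pt4 r (Pi.single (LJ t.1) 1))) h
  have hne : LI t.1 ≠ LJ t.1 := by generalize t.1 = u; revert u; decide
  simp [Lf, pt4, hne] at this

lemma not_isUnit_of_eval {r : ℕ} {g : Alg r} (v : Idx r → ℂ) (h : eval v g = 0) : ¬ IsUnit g := by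
  intro hu
  have := hu.map (eval v)
  rw [h] at this
  exact not_isUnit_zero this

lemma Lf_not_isUnit (r : ℕ) (t : Fin 3 × Bool) : ¬ IsUnit (Lf r t) :=
  not_isUnit_of_eval 0 (by simp [Lf])

lemma X_not_isUnit {r : ℕ} (i : Idx r) : ¬ IsUnit (X i : Alg r) :=
  not_isUnit_of_eval 0 (by simp)

/-- Core of the rationality statement. -/
lemma rational_core {r : ℕ} (a b : Alg r) (hb : b ≠ 0) (hab : IsRelPrime a b)
    (h : ∀ g, b * (pb r).br a g = a * (pb r).br b g) : ∃ s t : ℂ, t ≠ 0 ∧ C t * a = C s * b := by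
  classical
  simp only [pb_apply] at h
  by_cases ha : a = 0
  · exact ⟨0, 1, one_ne_zero, by simp [ha]⟩
  have hUV : ∀ g, (b * E r a - a * E r b) * D r g = (b * D r a - a * D r b) * E r g := by
    intro g; linear_combination h g
  have hU : b * E r a - a * E r b = 0 := by
    have h0 := hUV (x r 0)
    have h1 := hUV (x r 1)
    rw [E_x] at h0 h1
    have h2 : (b * E r a - a * E r b) * (x r 1 * D r (x r 0) - x r 0 * D r (x r 1)) = 0 := by
      linear_combination x r 1 * h0 - x r 0 * h1
    refine (mul_eq_zero.1 h2).resolve_right fun h3 => ?_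
    rw [D_0, D_1] at h3
    have := congrArg (eval (pt4 r ![2, 1, 1, 0])) h3
    simp [pt4] at this
    norm_num at this
  have hV : b * D r a - a * D r b = 0 := by
    have h0 := hUV (x r 0)
    rw [hU, zero_mul, E_x] at h0
    exact (mul_eq_zero.1 h0.symm).resolve_right X_prime.ne_zero
  obtain ⟨e', he'⟩ : a ∣ E r a := hab.dvd_of_dvd_mul_left ⟨E r b, by linear_combination hU⟩
  obtain ⟨c, hc⟩ : a ∣ D r a := hab.dvd_of_dvd_mul_left ⟨D r b, by linear_combination hV⟩
  have hEb : E r b = e' * b := by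
    apply mul_left_cancel₀ ha
    rw [he'] at hU; linear_combination -hU
  have hDb : D r b = c * b := by
    apply mul_left_cancel₀ ha
    rw [hc] at hV; linear_combination -hV
  obtain ⟨e, rfl⟩ := E_cofactor hb hEb
  by_contra hcon
  push Not at hcon
  have hne : ∀ t : ℂ, a - C t * b ≠ 0 := by
    intro t ht
    exact hcon t 1 one_ne_zero (by rw [C_1, one_mul]; exact sub_eq_zero.1 ht)
  have hC : ∀ (d : Derivation ℂ (Alg r) (Alg r)) t, d (C t) = 0 := fun d t => d.map_algebraMap t
  have hdar : ∀ t : ℂ, ∃ o : Option (Fin r ⊕ (Fin 3 × Bool)),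
      match o with
      | some (Sum.inl j) => (X (Sum.inr j) : Alg r) ∣ a - C t * b
      | some (Sum.inr u) => Lf r u ∣ a - C t * b
      | none => ∃ s, a - C t * b = C s := by
    intro t
    rcases darboux (a - C t * b) c e (hne t)
      (by rw [map_sub, Derivation.leibniz, hC, he', hEb]; simp only [smul_eq_mul]; ring)
      (by rw [map_sub, Derivation.leibniz, hC, hc, hDb]; simp only [smul_eq_mul]; ring) with
      ⟨j, hj⟩ | ⟨u, hu⟩ | hs
    · exact ⟨some (Sum.inl j), hj⟩
    · exact ⟨some (Sum.inr u), hu⟩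
    · exact ⟨none, hs⟩
  choose o ho using hdar
  obtain ⟨t1, t2, ht, heq⟩ := Finite.exists_ne_map_eq_of_infinite o
  have hdiv : ∀ q : Alg r, q ∣ a - C t1 * b → q ∣ a - C t2 * b → q ∣ a ∧ q ∣ b := by
    intro q h1 h2
    have hqb : q ∣ b := by
      have h3 : q ∣ C (t2 - t1) * b := by
        have := dvd_sub h1 h2
        rw [C_sub]
        convert this using 1; ring
      have hu : IsUnit (C (t2 - t1) : Alg r) :=
        (IsUnit.mk0 _ (sub_ne_zero.2 ht.symm)).map C
      exact (hu.dvd_mul_left).1 h3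
    refine ⟨?_, hqb⟩
    have := dvd_add h1 (hqb.mul_left (C t1))
    simpa using this
  have h1 := ho t1
  have h2 := ho t2
  rw [← heq] at h2
  rcases hot : o t1 with _ | j | u
  · rw [hot] at h1 h2
    obtain ⟨s1, hs1⟩ := h1
    obtain ⟨s2, hs2⟩ := h2
    have hb' : C (t2 - t1) * b = C (s1 - s2) := by
      rw [C_sub, C_sub]; linear_combination hs1 - hs2
    have ha' : C (t2 - t1) * a = C (t2 * s1 - t1 * s2) := by
      simp only [C_sub, C_mul]; linear_combination C t2 * hs1 - C t1 * hs2
    have hs : s1 - s2 ≠ 0 := by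
      intro h0
      rw [h0, C_0] at hb'
      rcases mul_eq_zero.1 hb' with h3 | h3
      · rw [C_eq_zero] at h3
        exact ht (sub_eq_zero.1 h3).symm
      · exact hb h3
    apply hcon ((t2 - t1) * (t2 * s1 - t1 * s2)) ((s1 - s2) * (t2 - t1))
      (mul_ne_zero hs (sub_ne_zero.2 ht.symm))
    rw [C_mul, C_mul, mul_assoc, ha', mul_comm (C (t2 - t1)), mul_assoc, hb', mul_comm]
  · rw [hot] at h1 h2
    obtain ⟨k1, k2⟩ := hdiv _ h1 h2
    exact X_not_isUnit _ (hab k1 k2)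
  · rw [hot] at h1 h2
    obtain ⟨k1, k2⟩ := hdiv _ h1 h2
    exact Lf_not_isUnit _ _ (hab k1 k2)

lemma rational (r : ℕ) : (pb r).IsPoissonRational ⊥ := by
  intro pbF hF f hf
  set ι : Alg r → FractionRing (Alg r ⧸ (⊥ : Ideal (Alg r))) := fun a =>
    algebraMap (Alg r ⧸ (⊥ : Ideal (Alg r))) (FractionRing (Alg r ⧸ (⊥ : Ideal (Alg r))))
      (Ideal.Quotient.mk ⊥ a) with hι
  have hmul : ∀ a b, ι (a * b) = ι a * ι b := by intro a b; simp [hι]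
  have hinj : ∀ a b, ι a = ι b → a = b := by
    intro a b h
    have h1 := IsFractionRing.injective (Alg r ⧸ (⊥ : Ideal (Alg r)))
      (FractionRing (Alg r ⧸ (⊥ : Ideal (Alg r)))) h
    have h2 := Ideal.Quotient.eq.1 h1
    exact sub_eq_zero.1 h2
  have h0 : ι 0 = 0 := by simp [hι]
  have hιC : ∀ t : ℂ, ι (C t) = algebraMap ℂ _ t := by
    intro t
    rw [IsScalarTower.algebraMap_apply ℂ (Alg r ⧸ (⊥ : Ideal (Alg r)))
      (FractionRing (Alg r ⧸ (⊥ : Ideal (Alg r))))]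
    rfl
  obtain ⟨a', b', hb', hab'⟩ := IsFractionRing.div_surjective (A := Alg r ⧸ (⊥ : Ideal (Alg r))) f
  obtain ⟨a1, rfl⟩ := Ideal.Quotient.mk_surjective a'
  obtain ⟨b1, rfl⟩ := Ideal.Quotient.mk_surjective b'
  have hb1 : b1 ≠ 0 := by
    rintro rfl
    exact nonZeroDivisors.ne_zero hb' (map_zero _)
  obtain ⟨a, b, d, hab, hda, hdb⟩ := UniqueFactorizationMonoid.exists_reduced_factors' a1 b1 hb1
  have hd : d ≠ 0 := by rintro rfl; exact hb1 (by rw [← hdb, zero_mul])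
  have hb : b ≠ 0 := by rintro rfl; exact hb1 (by rw [← hdb, mul_zero])
  have hne : ∀ a, a ≠ 0 → ι a ≠ 0 := fun a ha h => ha (hinj a 0 (h.trans h0.symm))
  have hfab : f * ι b = ι a := by
    have h1 : f * ι b1 = ι a1 := by
      rw [← hab']
      exact div_mul_cancel₀ _ (hne b1 hb1)
    rw [← hda, ← hdb, hmul, hmul] at h1
    apply mul_left_cancel₀ (hne d hd)
    linear_combination h1
  have hcore : ∀ g, b * (pb r).br a g = a * (pb r).br b g := by
    intro g
    apply hinj
    have h1 := pbF.leibniz f (ι b) (ι g)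
    rw [hf, mul_zero, add_zero, hfab, hF, hF] at h1
    change ι _ = f * ι _ at h1
    rw [hmul, hmul, h1, ← hfab]; ring
  obtain ⟨s, t, ht, hst⟩ := rational_core a b hb hab hcore
  have : f = algebraMap ℂ _ (s / t) := by
    have h1 := congrArg ι hst
    rw [hmul, hmul, ← hfab, hιC, hιC] at h1
    have ht' : algebraMap ℂ (FractionRing (Alg r ⧸ (⊥ : Ideal (Alg r)))) t ≠ 0 := by
      rw [← hιC]; apply hne; simpa using ht
    rw [map_div₀, eq_div_iff ht']
    apply mul_right_cancel₀ (hne b hb)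
    linear_combination h1
  rw [this]
  exact isAlgebraic_algebraMap _

/-- Minimal primes of a stable ideal are stable. -/
lemma minimalPrime_stable {r : ℕ} (δ : Derivation ℂ (Alg r) (Alg r)) (I P : Ideal (Alg r))
    (hI : ∀ a ∈ I, δ a ∈ I) (hP : P ∈ I.minimalPrimes) : ∀ a ∈ P, δ a ∈ P := by
  intro a ha
  have hprime : P.IsPrime := hP.1.1
  obtain ⟨s, hs, n, hn⟩ : ∃ s ∉ P, ∃ n, s * a ^ n ∈ I := by
    by_contra hno
    push Not at hno
    have hdis : Disjoint (I : Set (Alg r)) (P.primeCompl ⊔ Submonoid.powers a : Submonoid (Alg r)) := by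
      rw [Set.disjoint_left]
      intro y hy hy'
      obtain ⟨s, hs, z, ⟨n, rfl⟩, rfl⟩ := Submonoid.mem_sup.1 hy'
      exact hno s hs n hy
    obtain ⟨q, hq, hIq, hqd⟩ := Ideal.exists_le_prime_disjoint I _ hdis
    rw [Set.disjoint_left] at hqd
    have hqP : q ≤ P := by
      intro y hy
      by_contra hyP
      exact hqd hy (Submonoid.mem_sup_left hyP)
    have hPq : P ≤ q := hP.2 ⟨hq, hIq⟩ hqP
    exact hqd (hPq ha) (Submonoid.mem_sup_right (Submonoid.mem_powers a))
  have main : ∀ (k l : ℕ) (s : Alg r), s ∉ P → s * a ^ k * (δ a) ^ l ∈ I → δ a ∈ P := by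
    intro k
    induction k with
    | zero =>
      intro l s hs h
      have h1 := hP.1.2 h
      rw [pow_zero, mul_one] at h1
      exact hprime.mem_of_pow_mem _ ((hprime.mem_or_mem h1).resolve_left hs)
    | succ k ih =>
      intro l s hs h
      refine ih (l + 2) (((k : Alg r) + 1) * s ^ 2) ?_ ?_
      · intro h1
        rcases hprime.mem_or_mem h1 with h2 | h2
        · apply hprime.ne_top
          apply Ideal.eq_top_of_isUnit_mem _ h2
          have : ((k : Alg r) + 1) = C ((k : ℂ) + 1) := by simp
          rw [this]
          exact (IsUnit.mk0 _ (Nat.cast_add_one_ne_zero k)).map C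
        · exact hs (hprime.mem_of_pow_mem _ h2)
      · have h1 := I.mul_mem_left (s * δ a) (hI _ h)
        have h2 : s * δ a * δ (s * a ^ (k + 1) * δ a ^ l) =
            ((k : Alg r) + 1) * s ^ 2 * a ^ k * δ a ^ (l + 2) +
            (δ a * δ s + l * s * δ (δ a)) * (s * a ^ (k + 1) * δ a ^ l) := by
          simp only [Derivation.leibniz, Derivation.leibniz_pow, smul_eq_mul, nsmul_eq_mul,
            Nat.add_sub_cancel, Nat.cast_add, Nat.cast_one]
          rcases l with _ | l
          · simp; ring
          · simp; ring
        rw [h2] at h1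
        exact (Submodule.add_mem_iff_left _ (I.mul_mem_left _ h)).1 h1
  exact main n 0 s hs (by simpa using hn)

lemma span_stable {r : ℕ} (δ : Derivation ℂ (Alg r) (Alg r)) (S : Set (Alg r))
    (h : ∀ s ∈ S, δ s ∈ Ideal.span S) : ∀ a ∈ Ideal.span S, δ a ∈ Ideal.span S := by
  intro a ha
  induction ha using Submodule.span_induction with
  | mem y hy => exact h y hy
  | zero => rw [map_zero]; exact zero_mem _
  | add y z _ _ hy hz => rw [map_add]; exact add_mem hy hz
  | smul t y hy hy' =>
    rw [smul_eq_mul, Derivation.leibniz]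
    exact add_mem (Ideal.mul_mem_left _ _ hy') (by
      rw [smul_eq_mul]; exact Ideal.mul_mem_right _ _ hy)

/-- The self-map. -/
noncomputable def phi (r : ℕ) : Alg r →ₐ[ℂ] Alg r := aeval (Sum.elim
  ![(x r 0 * x r 2) ^ 2 + (x r 0 * x r 1) ^ 2 - (x r 1 * x r 2) ^ 2,
    (x r 1 * x r 2) ^ 2 + (x r 0 * x r 1) ^ 2 - (x r 0 * x r 2) ^ 2,
    (x r 1 * x r 2) ^ 2 + (x r 0 * x r 2) ^ 2 - (x r 0 * x r 1) ^ 2,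
    4 * x r 3 * (x r 0 * x r 1 * x r 2) -
      ((x r 1 * x r 2) ^ 2 + (x r 0 * x r 2) ^ 2 + (x r 0 * x r 1) ^ 2)] (fun _ => 0))

lemma phi_0 (r : ℕ) : phi r (x r 0) =
    (x r 0 * x r 2) ^ 2 + (x r 0 * x r 1) ^ 2 - (x r 1 * x r 2) ^ 2 := by simp [phi]
lemma phi_1 (r : ℕ) : phi r (x r 1) =
    (x r 1 * x r 2) ^ 2 + (x r 0 * x r 1) ^ 2 - (x r 0 * x r 2) ^ 2 := by simp [phi]
lemma phi_2 (r : ℕ) : phi r (x r 2) =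
    (x r 1 * x r 2) ^ 2 + (x r 0 * x r 2) ^ 2 - (x r 0 * x r 1) ^ 2 := by simp [phi]
lemma phi_3 (r : ℕ) : phi r (x r 3) = 4 * x r 3 * (x r 0 * x r 1 * x r 2) -
      ((x r 1 * x r 2) ^ 2 + (x r 0 * x r 2) ^ 2 + (x r 0 * x r 1) ^ 2) := by simp [phi]
lemma phi_w (r : ℕ) (j : Fin r) : phi r (X (Sum.inr j)) = 0 := by simp [phi]

/-- The product of the first three variables. -/
noncomputable def ss (r : ℕ) : Alg r := x r 0 * x r 1 * x r 2

lemma four_derivation {r : ℕ} (d : Derivation ℂ (Alg r) (Alg r)) : d 4 = 0 :=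
  d.map_algebraMap (4 : ℂ)

lemma E_phi (r : ℕ) (f : Alg r) : E r (phi r f) = 4 * phi r (E r f) := by
  have := tw (phi r) (E r) (E r) (E r) 1 4 0 (by
    rintro (l | l)
    · rw [E_x]
      fin_cases l
      · simp only [Fin.zero_eta, phi_0, map_sub, map_add, Derivation.leibniz, smul_eq_mul,
          Derivation.leibniz_pow, E_x]
        simp; ring
      · simp only [Fin.mk_one, phi_1, map_sub, map_add, Derivation.leibniz, smul_eq_mul,
          Derivation.leibniz_pow, E_x]
        simp; ring
      · simp only [Fin.reduceFinMk, phi_2, map_sub, map_add, Derivation.leibniz, smul_eq_mul,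
          Derivation.leibniz_pow, E_x]
        simp; ring
      · simp only [Fin.reduceFinMk, phi_3, map_sub, map_add, Derivation.leibniz, smul_eq_mul,
          Derivation.leibniz_pow, E_x, four_derivation]
        simp; ring
    · rw [E_w, map_mul, phi_w]; simp) f
  linear_combination this

/-- The correction term. -/
noncomputable def bet (r : ℕ) : Alg r :=
  4 * ss r * D r (ss r) + 2 * ((x r 1 * x r 2) ^ 2 * (x r 0 * x r 2) ^ 2 +
    (x r 0 * x r 2) ^ 2 * (x r 0 * x r 1) ^ 2 + (x r 1 * x r 2) ^ 2 * (x r 0 * x r 1) ^ 2) -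
    ((x r 1 * x r 2) ^ 4 + (x r 0 * x r 2) ^ 4 + (x r 0 * x r 1) ^ 4)

lemma D_phi (r : ℕ) (f : Alg r) :
    4 * ss r ^ 2 * D r (phi r f) = phi r (D r f) + bet r * phi r (E r f) := by
  have := tw (phi r) (D r) (D r) (E r) (4 * ss r ^ 2) 1 (bet r) (by
    rintro (l | l)
    · rw [E_x]
      fin_cases l
      · simp only [Fin.zero_eta, phi_0, phi_1, phi_2, phi_3, D_0, D_1, D_2, D_3, map_sub, map_add,
          Derivation.leibniz, smul_eq_mul, Derivation.leibniz_pow, bet, ss, map_mul, map_pow]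
        simp; ring
      · simp only [Fin.mk_one, phi_0, phi_1, phi_2, phi_3, D_0, D_1, D_2, D_3, map_sub, map_add,
          Derivation.leibniz, smul_eq_mul, Derivation.leibniz_pow, bet, ss, map_mul, map_pow]
        simp; ring
      · simp only [Fin.reduceFinMk, phi_0, phi_1, phi_2, phi_3, D_0, D_1, D_2, D_3, map_sub, map_add,
          Derivation.leibniz, smul_eq_mul, Derivation.leibniz_pow, bet, ss, map_mul, map_pow]
        simp; ring
      · simp only [Fin.reduceFinMk, phi_0, phi_1, phi_2, phi_3, D_0, D_1, D_2, D_3, map_sub, map_add,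
          Derivation.leibniz, smul_eq_mul, Derivation.leibniz_pow, bet, ss, map_mul, map_pow,
          four_derivation]
        simp; ring
    · rw [E_w, map_mul, phi_w, D_w]; simp) f
  linear_combination this

/-- Denominators of the iterates. -/
noncomputable def W (r : ℕ) : ℕ → Alg r
  | 0 => 1
  | n + 1 => 4 * ss r ^ 2 * phi r (W r n)

lemma E_iter (r n : ℕ) (f : Alg r) : E r ((phi r)^[n] f) = 4 ^ n * (phi r)^[n] (E r f) := by
  induction n with
  | zero => simp
  | succ n ih =>
    rw [Function.iterate_succ_apply', E_phi, ih, Function.iterate_succ_apply', map_mul, map_pow,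
      map_ofNat]
    ring

lemma D_iter (r n : ℕ) : ∃ β : Alg r, ∀ f,
    W r n * D r ((phi r)^[n] f) = (phi r)^[n] (D r f) + β * (phi r)^[n] (E r f) := by
  induction n with
  | zero => exact ⟨0, by simp [W]⟩
  | succ n ih =>
    obtain ⟨β, hβ⟩ := ih
    refine ⟨phi r β + bet r * phi r (W r n) * 4 ^ n, fun f => ?_⟩
    have h1 := D_phi r ((phi r)^[n] f)
    have h2 := congrArg (phi r) (hβ f)
    have h3 := congrArg (phi r) (E_iter r n f)
    simp only [map_mul, map_add, map_pow, map_ofNat] at h2 h3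
    simp only [Function.iterate_succ_apply', W]
    linear_combination phi r (W r n) * h1 + h2 + bet r * phi r (W r n) * h3

/-- The ideals. -/
noncomputable def J (r n : ℕ) : Ideal (Alg r) :=
  Ideal.span {(phi r)^[n] (x r 0), (phi r)^[n] (x r 3)}

lemma J_E (r n : ℕ) : ∀ a ∈ J r n, E r a ∈ J r n := by
  apply span_stable
  rintro s (rfl | rfl)
  · rw [E_iter, E_x]; exact Ideal.mul_mem_left _ _ (Ideal.subset_span (by simp))
  · rw [E_iter, E_x]; exact Ideal.mul_mem_left _ _ (Ideal.subset_span (by simp))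

lemma iter_hom (r n : ℕ) : ∃ g : Alg r →ₐ[ℂ] Alg r, ∀ f, (phi r)^[n] f = g f := by
  induction n with
  | zero => exact ⟨AlgHom.id ℂ _, by simp⟩
  | succ n ih =>
    obtain ⟨g, hg⟩ := ih
    exact ⟨(phi r).comp g, fun f => by rw [Function.iterate_succ_apply', hg]; rfl⟩

lemma J_D (r n : ℕ) : ∀ a ∈ J r n, (W r n • D r) a ∈ J r n := by
  obtain ⟨β, hβ⟩ := D_iter r n
  obtain ⟨g, hg⟩ := iter_hom r n
  have m0 : g (x r 0) ∈ J r n := by rw [← hg]; exact Ideal.subset_span (by simp)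
  have m3 : g (x r 3) ∈ J r n := by rw [← hg]; exact Ideal.subset_span (by simp)
  apply span_stable
  change ∀ s ∈ _, _ ∈ J r n
  rintro s (rfl | rfl)
  · rw [Derivation.smul_apply, smul_eq_mul, hβ, E_x, D_0, hg, hg, map_sub, map_mul, map_mul]
    exact add_mem (sub_mem (Ideal.mul_mem_right _ _ m0) (Ideal.mul_mem_right _ _ m3))
      (Ideal.mul_mem_left _ _ m0)
  · rw [Derivation.smul_apply, smul_eq_mul, hβ, E_x, D_3, hg, hg, map_mul, map_mul]
    exact add_mem (Ideal.mul_mem_right _ _ (Ideal.mul_mem_right _ _ m0))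
      (Ideal.mul_mem_left _ _ m3)

/-- The self-map on points. -/
def F (v : Fin 4 → ℂ) : Fin 4 → ℂ :=
  ![(v 0 * v 2) ^ 2 + (v 0 * v 1) ^ 2 - (v 1 * v 2) ^ 2,
    (v 1 * v 2) ^ 2 + (v 0 * v 1) ^ 2 - (v 0 * v 2) ^ 2,
    (v 1 * v 2) ^ 2 + (v 0 * v 2) ^ 2 - (v 0 * v 1) ^ 2,
    4 * v 3 * (v 0 * v 1 * v 2) - ((v 1 * v 2) ^ 2 + (v 0 * v 2) ^ 2 + (v 0 * v 1) ^ 2)]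

lemma eval_phi {r : ℕ} (v : Fin 4 → ℂ) (u : Fin r → ℂ) (f : Alg r) :
    eval (Sum.elim v u) (phi r f) = eval (pt4 r (F v)) f := by
  have : ((aeval (Sum.elim v u) : Alg r →ₐ[ℂ] ℂ)).comp (phi r) = aeval (pt4 r (F v)) := by
    apply MvPolynomial.algHom_ext
    rintro (l | l)
    · rw [AlgHom.comp_apply]
      fin_cases l
      · simp only [Fin.zero_eta, phi_0]; simp [pt4, F]
      · simp only [Fin.mk_one, phi_1]; simp [pt4, F]
      · simp only [Fin.reduceFinMk, phi_2]; simp [pt4, F]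
      · simp only [Fin.reduceFinMk, phi_3]; simp [pt4, F]
    · rw [AlgHom.comp_apply, phi_w]; simp [pt4]
  exact DFunLike.congr_fun this f

lemma eval_iter {r : ℕ} (n : ℕ) (v : Fin 4 → ℂ) (u : Fin r → ℂ) (i : Fin 4) :
    eval (Sum.elim v u) ((phi r)^[n] (x r i)) = F^[n] v i := by
  induction n generalizing v u with
  | zero => simp
  | succ n ih =>
    rw [Function.iterate_succ_apply', eval_phi, Function.iterate_succ_apply]
    exact ih (F v) _

lemma eval_W {r : ℕ} (n : ℕ) (v : Fin 4 → ℂ) (u : Fin r → ℂ)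
    (h : ∀ j < n, F^[j] v 0 * F^[j] v 1 * F^[j] v 2 ≠ 0) : eval (Sum.elim v u) (W r n) ≠ 0 := by
  induction n generalizing v u with
  | zero => simp [W]
  | succ n ih =>
    rw [W, map_mul, eval_phi]
    refine mul_ne_zero ?_ (ih (F v) _ fun j hj => ?_)
    · have := h 0 (by omega)
      rw [map_mul, map_pow]
      refine mul_ne_zero (by simp) (pow_ne_zero _ ?_)
      simpa [ss] using this
    · have := h (j + 1) (by omega)
      rwa [Function.iterate_succ_apply] at this

/-- Points off the six hyperplanes. -/
def Good (v : Fin 4 → ℂ) : Prop := v 0 ^ 2 ≠ v 1 ^ 2 ∧ v 1 ^ 2 ≠ v 2 ^ 2 ∧ v 0 ^ 2 ≠ v 2 ^ 2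

lemma F_surj (P : Fin 4 → ℂ) (hP : Good P) :
    ∃ v, Good v ∧ F v = P ∧ v 0 * v 1 * v 2 ≠ 0 := by
  have hsq : ∀ y : ℂ, ∃ z, z ^ 2 = y := fun y => IsAlgClosed.exists_pow_nat_eq y (by norm_num)
  have hne : ∀ y z : ℂ, y ^ 2 ≠ z ^ 2 → (y + z) / 2 ≠ 0 := by
    intro y z h h0
    apply h
    have : y = -z := by linear_combination 2 * h0
    rw [this]; ring
  obtain ⟨h01, h12, h02⟩ := hP
  obtain ⟨a, ha⟩ := hsq ((P 1 + P 2) / 2)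
  obtain ⟨b, hb⟩ := hsq ((P 0 + P 2) / 2)
  obtain ⟨c, hc⟩ := hsq ((P 0 + P 1) / 2)
  have ha0 : a ≠ 0 := by rintro rfl; exact hne _ _ h12 (by rw [← ha]; norm_num)
  have hb0 : b ≠ 0 := by rintro rfl; exact hne _ _ h02 (by rw [← hb]; norm_num)
  have hc0 : c ≠ 0 := by rintro rfl; exact hne _ _ h01 (by rw [← hc]; norm_num)
  obtain ⟨p, hp⟩ := hsq (b * c / a)
  have hp0 : p ≠ 0 := by
    rintro rfl
    have : b * c / a ≠ 0 := div_ne_zero (mul_ne_zero hb0 hc0) ha0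
    exact this (by rw [← hp]; norm_num)
  have e1 : p * (c / p) = c := by field_simp
  have e2 : p * (b / p) = b := by field_simp
  have e3 : c / p * (b / p) = a := by
    have h1 : p ^ 2 * a = b * c := by rw [hp]; field_simp
    rw [div_mul_div_comm, div_eq_iff (mul_ne_zero hp0 hp0)]
    linear_combination -h1
  have hs : p * (c / p) * (b / p) ≠ 0 :=
    mul_ne_zero (mul_ne_zero hp0 (div_ne_zero hc0 hp0)) (div_ne_zero hb0 hp0)
  have hF : F ![p, c / p, b / p, (P 3 + a ^ 2 + b ^ 2 + c ^ 2) / (4 * (p * (c / p) * (b / p)))] = P := by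
    ext l
    fin_cases l
    · simp only [F, Matrix.cons_val, e1, e2, e3, ha, hb, hc]; simp; ring
    · simp only [F, Matrix.cons_val, e1, e2, e3, ha, hb, hc]; simp; ring
    · simp only [F, Matrix.cons_val, e1, e2, e3, ha, hb, hc]; simp; ring
    · simp only [F, Fin.reduceFinMk, Matrix.cons_val]
      have h4 : ∀ S T : ℂ, S ≠ 0 → 4 * (T / (4 * S)) * S = T := by
        intro S T hS; field_simp
      rw [h4 _ _ hs, e1, e2, e3]; ring
  refine ⟨_, ?_, hF, hs⟩
  generalize (![p, c / p, b / p, (P 3 + a ^ 2 + b ^ 2 + c ^ 2) / (4 * (p * (c / p) * (b / p)))] : Fin 4 → ℂ) = v at hF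
  subst hF
  refine ⟨fun h => h01 ?_, fun h => h12 ?_, fun h => h02 ?_⟩
  · have : F v 0 = F v 1 := by
      simp [F]; linear_combination 2 * v 2 ^ 2 * h
    rw [this]
  · have : F v 1 = F v 2 := by
      simp [F]; linear_combination 2 * v 0 ^ 2 * h
    rw [this]
  · have : F v 0 = F v 2 := by
      simp [F]; linear_combination 2 * v 1 ^ 2 * h
    rw [this]

/-- The target point. -/
def qq : Fin 4 → ℂ := ![0, 1, 2, 0]

lemma exists_point (n : ℕ) : ∃ v, Good v ∧ F^[n] v = qq ∧
    ∀ j < n, F^[j] v 0 * F^[j] v 1 * F^[j] v 2 ≠ 0 := by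
  induction n with
  | zero =>
    refine ⟨qq, ?_, rfl, by simp⟩
    simp only [Good, qq, Matrix.cons_val]
    norm_num
  | succ n ih =>
    obtain ⟨v, hv, hq, hs⟩ := ih
    obtain ⟨v', hv', hF, hs'⟩ := F_surj v hv
    refine ⟨v', hv', by rw [Function.iterate_succ_apply, hF, hq], fun j hj => ?_⟩
    rcases j with _ | j
    · exact hs'
    · rw [Function.iterate_succ_apply, hF]
      exact hs j (by omega)

lemma F_special (ε t : ℂ) (hε : ε ^ 2 = 1) :
    F ![ε * t, t, t, ε * t] = ![1 * t ^ 4, t ^ 4, t ^ 4, 1 * t ^ 4] := by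
  ext l
  fin_cases l
  · simp [F]; linear_combination 2 * t ^ 4 * hε
  · simp [F]; ring
  · simp [F]; ring
  · simp [F]; linear_combination 2 * t ^ 4 * hε

lemma orbit (k : ℕ) : ∃ ε t : ℂ, ε ^ 2 = 1 ∧ t ≠ 0 ∧ F^[k + 1] qq = ![ε * t, t, t, ε * t] := by
  induction k with
  | zero =>
    refine ⟨-1, 4, by norm_num, by norm_num, ?_⟩
    ext l
    fin_cases l <;> simp [F, qq] <;> norm_num
  | succ k ih =>
    obtain ⟨ε, t, hε, ht, h⟩ := ih
    refine ⟨1, t ^ 4, by norm_num, pow_ne_zero _ ht, ?_⟩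
    rw [Function.iterate_succ_apply', h, F_special ε t hε]

/-- The key family of stable primes. -/
lemma exists_prime (r n : ℕ) : ∃ (v : Fin 4 → ℂ) (Q : Ideal (Alg r)), Good v ∧ F^[n] v = qq ∧
    Q.IsPrime ∧ Q ∈ (J r n).minimalPrimes ∧ (∀ f ∈ Q, eval (Sum.elim v (fun _ => 1)) f = 0) ∧
    (∀ a ∈ Q, E r a ∈ Q) ∧ (∀ a ∈ Q, D r a ∈ Q) := by
  obtain ⟨v, hv, hq, hs⟩ := exists_point n
  have hker : (RingHom.ker (eval (Sum.elim v (fun _ : Fin r => (1 : ℂ))))).IsPrime :=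
    RingHom.ker_isPrime _
  have hle : J r n ≤ RingHom.ker (eval (Sum.elim v (fun _ : Fin r => (1 : ℂ)))) := by
    rw [J, Ideal.span_le]
    rintro s (rfl | rfl)
    · change eval _ _ = 0
      rw [eval_iter, hq]; simp [qq]
    · change eval _ _ = 0
      rw [eval_iter, hq]; simp [qq]
  obtain ⟨Q, hQ, hQle⟩ := Ideal.exists_minimalPrimes_le hle
  have hQp : Q.IsPrime := hQ.1.1
  refine ⟨v, Q, hv, hq, hQp, hQ, fun f hf => hQle hf, minimalPrime_stable _ _ _ (J_E r n) hQ, ?_⟩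
  intro a ha
  have h1 := minimalPrime_stable _ _ _ (J_D r n) hQ a ha
  rw [Derivation.smul_apply, smul_eq_mul] at h1
  refine (hQp.mem_or_mem h1).resolve_left fun h2 => ?_
  exact eval_W n v _ hs (hQle h2)

lemma ideal_poisson {r : ℕ} (Q : Ideal (Alg r)) (hE : ∀ a ∈ Q, E r a ∈ Q)
    (hD : ∀ a ∈ Q, D r a ∈ Q) : (pb r).IsPoissonIdeal Q := by
  intro a ha b
  rw [pb_apply]
  exact sub_mem (Ideal.mul_mem_right _ _ (hE a ha)) (Ideal.mul_mem_right _ _ (hD a ha))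

lemma Lf_eval {r : ℕ} (v : Fin 4 → ℂ) (u : Fin r → ℂ) (hv : Good v) (t : Fin 3 × Bool) :
    eval (Sum.elim v u) (Lf r t) ≠ 0 := by
  obtain ⟨t, s⟩ := t
  obtain ⟨h01, h12, h02⟩ := hv
  intro h
  simp only [Lf, map_sub, map_mul, eval_X, eval_C, Sum.elim_inl] at h
  have h2 : v (LJ t) ^ 2 = v (LI t) ^ 2 := by
    rw [sub_eq_zero.1 h, mul_pow, sgn_sq, one_mul]
  fin_cases t
  · exact h01 h2.symm
  · exact h12 h2.symm
  · exact h02 h2.symm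

lemma not_locallyClosed (r : ℕ) : ¬ (pb r).IsPoissonLocallyClosed ⊥ := by
  intro hlc
  choose v Q hv hq hQp hQm hQe hQE hQD using exists_prime r
  have hmem : ∀ n, (phi r)^[n] (x r 0) ∈ Q n := fun n =>
    (hQm n).1.2 (Ideal.subset_span (by simp))
  have hinj' : ∀ n m, n < m → Q n ≠ Q m := by
    intro n m hnm h
    have h1 := hmem m
    rw [← h] at h1
    have h2 := hQe n _ h1
    rw [eval_iter] at h2
    obtain ⟨k, rfl⟩ : ∃ k, m = (k + 1) + n := ⟨m - n - 1, by omega⟩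
    rw [Function.iterate_add_apply, hq] at h2
    obtain ⟨ε, t, hε, ht, h3⟩ := orbit k
    rw [h3] at h2
    have hε0 : ε ≠ 0 := by rintro rfl; norm_num at hε
    exact mul_ne_zero hε0 ht h2
  have hinj : Function.Injective Q := by
    intro n m h
    by_contra hne
    rcases lt_or_gt_of_ne hne with h1 | h1
    · exact hinj' n m h1 h
    · exact hinj' m n h1 h.symm
  have hQbot : ∀ n, Q n ≠ ⊥ := by
    intro n h
    have h1 := hmem n
    rw [h, Ideal.mem_bot] at h1
    have h2 := eval_iter (r := r) n ![1 * 1, 1, 1, 1 * 1] (fun _ => 0) 0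
    have h3 : F^[n] ![1 * 1, 1, 1, 1 * 1] = ![1 * 1, 1, 1, 1 * 1] := by
      apply Function.iterate_fixed
      have := F_special 1 1 (by norm_num)
      rw [this]; norm_num
    rw [h1, h3] at h2
    simp at h2
  set I : Ideal (Alg r) := ⨅ n, Q n with hI
  have hIbot : I ≠ ⊥ := by
    intro h
    have hle : sInf {Q : Ideal (Alg r) | Q.IsPrime ∧ (pb r).IsPoissonIdeal Q ∧ ⊥ < Q} ≤ I :=
      le_iInf fun n => sInf_le ⟨hQp n, ideal_poisson _ (hQE n) (hQD n), bot_lt_iff_ne_bot.2 (hQbot n)⟩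
    rw [h] at hle
    exact absurd hlc (not_lt_of_ge hle)
  have hIE : ∀ a ∈ I, E r a ∈ I := by
    intro a ha
    rw [hI, Submodule.mem_iInf] at ha ⊢
    exact fun n => hQE n a (ha n)
  have hID : ∀ a ∈ I, D r a ∈ I := by
    intro a ha
    rw [hI, Submodule.mem_iInf] at ha ⊢
    exact fun n => hQD n a (ha n)
  have hall : ∀ n, Q n ∈ I.minimalPrimes := by
    intro n
    have := hQp n
    obtain ⟨p, hp, hpQ⟩ := Ideal.exists_minimalPrimes_le (iInf_le Q n)
    have hpp : p.IsPrime := hp.1.1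
    rcases eq_or_lt_of_le hpQ with h | h
    · rwa [← h]
    exfalso
    have hpbot : p ≠ ⊥ := by
      rintro rfl
      exact hIbot (le_bot_iff.1 hp.1.2)
    have hht : (Q n).height ≤ 2 := by
      refine (Ideal.height_le_card_of_mem_minimalPrimes_span (Set.toFinite _) (hQm n)).trans ?_
      have := Set.ncard_insert_le ((phi r)^[n] (x r 0)) {(phi r)^[n] (x r 3)}
      rw [Set.ncard_singleton] at this
      exact_mod_cast this
    have h1 := (Ideal.height_add_one_le_of_lt_of_isPrime h).trans hht
    have h2 : p.height ≠ 0 := fun h0 => hpbot (Ideal.height_eq_zero_iff_eq_bot.1 h0)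
    have h3 : p.height = 1 := by
      have h4 : p.height ≤ 1 := by
        have : p.height + 1 ≤ 1 + 1 := h1.trans (by norm_num)
        exact (ENat.add_le_add_iff_right (by norm_num)).1 this
      exact le_antisymm h4 (Order.one_le_iff_ne_zero.2 h2)
    obtain ⟨f, hfp, hf⟩ := hpp.exists_mem_prime_of_ne_bot hpbot
    have hpf := Ideal.eq_span_singleton_of_height_eq_one h3 hfp hf
    have hEf := minimalPrime_stable _ _ _ hIE hp f hfp
    have hDf := minimalPrime_stable _ _ _ hID hp f hfp
    rw [hpf, Ideal.mem_span_singleton'] at hEf hDf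
    obtain ⟨e', he'⟩ := hEf
    obtain ⟨c, hc⟩ := hDf
    obtain ⟨e, rfl⟩ := E_cofactor hf.ne_zero he'.symm
    have hfe := hQe n f (hpQ hfp)
    have hq0 : ∀ q : Alg r, ¬ IsUnit q → q ∣ f →
        eval (Sum.elim (v n) (fun _ => 1)) q = 0 := by
      rintro q hqu ⟨g, rfl⟩
      have hg := (hf.irreducible.isUnit_or_isUnit rfl).resolve_left hqu
      rw [map_mul] at hfe
      exact (mul_eq_zero.1 hfe).resolve_right (hg.map (eval _)).ne_zero
    rcases darboux f c e hf.ne_zero he'.symm hc.symm with ⟨j, hj⟩ | ⟨t, ht⟩ | ⟨a, rfl⟩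
    · have := hq0 _ (X_not_isUnit _) hj
      simp at this
    · exact Lf_eval (v n) _ (hv n) t (hq0 _ (Lf_not_isUnit r t) ht)
    · rw [eval_C] at hfe
      exact hf.ne_zero (by rw [hfe, C_0])
  exact Set.infinite_range_of_injective hinj
    ((Ideal.finite_minimalPrimes_of_isNoetherianRing (Alg r) I).subset (by rintro _ ⟨n, rfl⟩; exact hall n))

lemma krullDim_eq (d : ℕ) (hd : 4 ≤ d) : ringKrullDim (Alg (d - 4)) = d := by
  rw [MvPolynomial.ringKrullDim_of_isNoetherianRing, ringKrullDim_eq_zero_of_field, zero_add]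
  have : Nat.card (Idx (d - 4)) = d := by
    simp only [Idx, Nat.card_eq_fintype_card, Fintype.card_sum, Fintype.card_fin]; omega
  rw [this]

end PoissonCE

/-- For every `d ≥ 4` there exists a complex affine Poisson algebra of
Krull dimension `d` in which `(0)` is Poisson rational but not Poisson locally closed. -/
theorem exists_poisson_counterexample (d : ℕ) (hd : 4 ≤ d) :
    Nonempty (PoissonCounterexample d) := by
  exact ⟨{ A := PoissonCE.Alg (d - 4)
           finiteType := inferInstance
           pb := PoissonCE.pb (d - 4)
           krullDim := PoissonCE.krullDim_eq d hd
           rational := PoissonCE.rational (d - 4)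
           not_locallyClosed := PoissonCE.not_locallyClosed (d - 4) }⟩
end
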